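/- Let 1 < q < 2, λ, μ > 0 and φ ∈ L¹(ℝ), and let u = u^μ_λ be the classical solution of the rescaled regularized problem. Then |u(t,x)| ≤ (q‖φ‖_{L¹(ℝ)}/((q−1)t))^{1/q} for all t > 0 and a.e. x ∈ ℝ, and for every p ∈ [1, ∞] there exists a constant C(‖φ‖_{L¹(ℝ)}, p, q) > 0 such that ‖u(t)‖_{L^p(ℝ)} ≤ C(‖φ‖_{L¹(ℝ)}, p, q)·t^{−(1/q)(1−1/p)} for all t > 0, uniformly in λ and μ. -/

import Mathlib

open MeasureTheory Filter ENNReal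

/-- `u` is a classical solution of the rescaled regularized problem
`u_t + |u|^{q-1} u_x = λ^q (J_λ ∗ u - u) + μ u_xx` with initial datum
`φ_λ(x) = λ φ(λ x)`, where `J_λ(x) = λ J(λ x)`. -/
def IsRescaledSol (J : ℝ → ℝ) (q lam μ : ℝ) (φ : ℝ → ℝ) (u : ℝ → ℝ → ℝ) : Prop :=
  (∀ t : ℝ, 0 ≤ t → Integrable (u t)) ∧
  (∀ t₀ : ℝ, 0 ≤ t₀ →
    Tendsto (fun t => ∫ x, |u t x - u t₀ x|) (nhdsWithin t₀ (Set.Ici 0)) (nhds 0)) ∧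
  (∀ t : ℝ, 0 < t → ContDiff ℝ 2 (u t)) ∧
  (∀ x : ℝ, ContDiffOn ℝ 1 (fun s => u s x) (Set.Ioi 0)) ∧
  (∀ t : ℝ, 0 < t → ∀ x : ℝ,
    deriv (fun s => u s x) t + |u t x| ^ (q - 1) * deriv (u t) x
      = lam ^ q * ((∫ y, lam * J (lam * (x - y)) * u t y) - u t x)
        + μ * deriv (deriv (u t)) x) ∧
  (u 0 =ᵐ[volume] fun x => lam * φ (lam * x))

namespace Aux
open Set Topology

/-- indicator of positivity -/
noncomputable def ps (w : ℝ) : ℝ := if 0 < w then 1 else 0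

lemma ps_nonneg (w : ℝ) : 0 ≤ ps w := by unfold ps; split_ifs <;> norm_num
lemma ps_le_one (w : ℝ) : ps w ≤ 1 := by unfold ps; split_ifs <;> norm_num
lemma measurable_ps : Measurable ps := by
  unfold ps
  exact Measurable.ite measurableSet_Ioi measurable_const measurable_const

lemma ps_mul_le (w z : ℝ) : ps w * z ≤ max z 0 := by
  unfold ps; split_ifs <;> simp

lemma hasDerivAt_possq (w : ℝ) : HasDerivAt (fun w : ℝ => (max w 0)^2) (2 * max w 0) w := by
  rcases lt_trichotomy w 0 with h | h | h
  · have : (fun w : ℝ => (max w 0)^2) =ᶠ[𝓝 w] fun _ => 0 := by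
      filter_upwards [Iio_mem_nhds h] with y hy
      rw [max_eq_right (le_of_lt hy)]; norm_num
    rw [max_eq_right h.le]
    simpa using (hasDerivAt_const w (0:ℝ)).congr_of_eventuallyEq this
  · subst h
    simp only [max_self, mul_zero]
    rw [hasDerivAt_iff_isLittleO_nhds_zero]
    simp only [zero_add, max_self, smul_zero, sub_zero, ne_eq, OfNat.ofNat_ne_zero, not_false_eq_true, zero_pow]
    have h1 : (fun h : ℝ => (max h 0)^2) =O[𝓝 0] fun h => h^2 := by
      refine Asymptotics.IsBigO.of_bound 1 (Eventually.of_forall fun y => ?_)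
      simp only [norm_pow, Real.norm_eq_abs, one_mul]
      refine pow_le_pow_left₀ (abs_nonneg _) ?_ 2
      rcases le_total y 0 with hy | hy
      · rw [max_eq_right hy]; simp
      · rw [max_eq_left hy]
    have h2 : (fun h : ℝ => h^2) =o[𝓝 0] fun h => h := by
      exact Asymptotics.isLittleO_pow_id (by norm_num)
    exact h1.trans_isLittleO h2
  · have : (fun w : ℝ => (max w 0)^2) =ᶠ[𝓝 w] fun w => w^2 := by
      filter_upwards [Ioi_mem_nhds h] with y hy
      rw [max_eq_left (le_of_lt hy)]
    rw [max_eq_left h.le]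
    simpa using (hasDerivAt_pow 2 w).congr_of_eventuallyEq this

noncomputable def sg (ε w : ℝ) : ℝ := (max w 0)^2 / ((max w 0)^2 + ε)

lemma sg_deriv {ε : ℝ} (hε : 0 < ε) (w : ℝ) :
    HasDerivAt (sg ε) (2 * max w 0 * ε / ((max w 0)^2 + ε)^2) w := by
  have h := (hasDerivAt_possq w).div ((hasDerivAt_possq w).add_const ε) (by positivity)
  refine (h.congr_deriv ?_)
  ring

lemma sg_nonneg {ε : ℝ} (hε : 0 < ε) (w : ℝ) : 0 ≤ sg ε w := by unfold sg; positivity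
lemma sg_le_one {ε : ℝ} (hε : 0 < ε) (w : ℝ) : sg ε w ≤ 1 := by
  unfold sg
  rw [div_le_one (by positivity)]; linarith

lemma sg_tendsto (w : ℝ) : Tendsto (fun n : ℕ => sg (1/((n:ℝ)+1)) w) atTop (𝓝 (ps w)) := by
  unfold sg ps
  split_ifs with h
  · rw [max_eq_left h.le]
    have h1 : Tendsto (fun n : ℕ => w^2 / (w^2 + 1/((n:ℝ)+1))) atTop (𝓝 (w^2/(w^2+0))) :=
      tendsto_const_nhds.div (tendsto_const_nhds.add tendsto_one_div_add_atTop_nhds_zero_nat)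
        (by positivity)
    simpa [h.ne'] using h1
  · rw [max_eq_right (not_lt.mp h)]
    simp

/-- bound `s'(w) w² ≤ √ε` in the form used -/
lemma sg_bound {ε : ℝ} (hε : 0 < ε) (w : ℝ) :
    2 * max w 0 * ε / ((max w 0)^2 + ε)^2 * (max w 0)^2 ≤ Real.sqrt ε := by
  set p := max w 0 with hp
  have hp0 : 0 ≤ p := le_max_right _ _
  have hs : 0 < Real.sqrt ε := Real.sqrt_pos.mpr hε
  have hse : Real.sqrt ε ^ 2 = ε := Real.sq_sqrt hε.le
  rw [div_mul_eq_mul_div, div_le_iff₀ (by positivity)]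
  set r := Real.sqrt ε
  rw [← hse]
  have h1 : 2 * p * r ≤ p^2 + r^2 := by nlinarith [sq_nonneg (p - r)]
  have h2 : p^2 ≤ p^2 + r^2 := by nlinarith [sq_nonneg r]
  calc 2 * p * r^2 * p^2 = r * ((2 * p * r) * p^2) := by ring
    _ ≤ r * ((p^2+r^2) * (p^2+r^2)) := by gcongr
    _ = r * (p^2+r^2)^2 := by ring

/-- primitive of the velocity -/
noncomputable def fl (a : ℝ → ℝ) (v : ℝ) : ℝ := ∫ s in (0:ℝ)..v, a s

lemma fl_deriv {a : ℝ → ℝ} (ha : Continuous a) (v : ℝ) : HasDerivAt (fl a) (a v) v :=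
  intervalIntegral.integral_hasDerivAt_right (ha.intervalIntegrable _ _)
    (ha.stronglyMeasurableAtFilter _ _) ha.continuousAt

lemma fl_lip {a : ℝ → ℝ} (ha : Continuous a) (M : ℝ) :
    ∃ L, 0 ≤ L ∧ ∀ v w, |v| ≤ M → |w| ≤ M → |fl a v - fl a w| ≤ L * |v - w| := by
  obtain ⟨L, hL⟩ := isCompact_Icc.exists_bound_of_continuousOn (ha.continuousOn (s := Icc (-M) M))
  refine ⟨max L 0, le_max_right _ _, fun v w hv hw => ?_⟩
  unfold fl
  rw [intervalIntegral.integral_interval_sub_left (ha.intervalIntegrable _ _) (ha.intervalIntegrable _ _)]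
  rw [← Real.norm_eq_abs]
  refine intervalIntegral.norm_integral_le_of_norm_le_const fun x hx => ?_
  refine (hL x ?_).trans (le_max_left _ _)
  rw [abs_le] at hv hw
  have := uIoc_subset_uIcc hx
  rw [mem_uIcc] at this
  constructor <;> rcases this with h | h <;> linarith [h.1, h.2]

lemma cd_deriv {u : ℝ → ℝ} (hu : ContDiff ℝ 2 u) : ContDiff ℝ 1 (deriv u) :=
  ((contDiff_succ_iff_deriv (n := 1)).mp (by simpa [one_add_one_eq_two] using hu)).2.2
lemma cd_d0 {u : ℝ → ℝ} (hu : ContDiff ℝ 2 u) (x : ℝ) : HasDerivAt u (deriv u x) x :=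
  (hu.differentiable (by norm_num) x).hasDerivAt
lemma cd_d1 {u : ℝ → ℝ} (hu : ContDiff ℝ 2 u) (x : ℝ) : HasDerivAt (deriv u) (deriv (deriv u) x) x :=
  ((cd_deriv hu).differentiable (by norm_num) x).hasDerivAt
lemma cd_c1 {u : ℝ → ℝ} (hu : ContDiff ℝ 2 u) : Continuous (deriv u) := (cd_deriv hu).continuous
lemma cd_c2 {u : ℝ → ℝ} (hu : ContDiff ℝ 2 u) : Continuous (deriv (deriv u)) :=
  (cd_deriv hu).continuous_deriv (by norm_num)

theorem kato {a : ℝ → ℝ} (ha : Continuous a) {μ : ℝ} (hμ : 0 < μ) {u B : ℝ → ℝ}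
    (hu : ContDiff ℝ 2 u) (hB : ContDiff ℝ 2 B) {c d : ℝ} (hcd : c ≤ d)
    (wc : u c ≤ B c) (wd : u d ≤ B d) :
    ∫ x in c..d, ps (u x - B x) * (μ * (deriv (deriv u) x - deriv (deriv B) x)
      - (a (u x) * deriv u x - a (B x) * deriv B x)) ≤ 0 := by
  set G' : ℝ → ℝ := fun x => (μ * (deriv (deriv u) x - deriv (deriv B) x)
      - (a (u x) * deriv u x - a (B x) * deriv B x)) with hG'
  set G : ℝ → ℝ := fun x => μ * (deriv u x - deriv B x) - (fl a (u x) - fl a (B x)) with hG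
  have hGd : ∀ x, HasDerivAt G (G' x) x := fun x =>
    (((cd_d1 hu x).sub (cd_d1 hB x)).const_mul μ).sub
      (((fl_deriv ha (u x)).comp x (cd_d0 hu x)).sub ((fl_deriv ha (B x)).comp x (cd_d0 hB x)))
  have hG'c : Continuous G' := by
    have := cd_c1 hu; have := cd_c2 hu; have := cd_c1 hB; have := cd_c2 hB
    have := hu.continuous; have := hB.continuous
    fun_prop
  have hGc : Continuous G := continuous_iff_continuousAt.mpr fun x => (hGd x).continuousAt
  obtain ⟨M1, hM1⟩ := isCompact_Icc.exists_bound_of_continuousOn (hu.continuous.continuousOn (s := Icc c d))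
  obtain ⟨M2, hM2⟩ := isCompact_Icc.exists_bound_of_continuousOn (hB.continuous.continuousOn (s := Icc c d))
  obtain ⟨L, hL0, hL⟩ := fl_lip ha (max M1 M2)
  have key : ∀ ε : ℝ, 0 < ε → ∫ x in c..d, sg ε (u x - B x) * G' x ≤ (d - c) * (L^2/(4*μ) * Real.sqrt ε) := by
    intro ε hε
    set s' : ℝ → ℝ := fun w => 2 * max w 0 * ε / ((max w 0)^2 + ε)^2 with hs'
    have hs'0 : ∀ w, 0 ≤ s' w := fun w => by
      have : 0 ≤ max w 0 := le_max_right _ _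
      positivity
    have hs'c : Continuous s' := by
      refine Continuous.div (by fun_prop) (by fun_prop) fun w => by positivity
    have hsd : ∀ x, HasDerivAt (fun x => sg ε (u x - B x)) (s' (u x - B x) * (deriv u x - deriv B x)) x :=
      fun x => (sg_deriv hε _).comp x ((cd_d0 hu x).sub (cd_d0 hB x))
    have hcont : Continuous fun x => s' (u x - B x) * (deriv u x - deriv B x) :=
      (hs'c.comp (hu.continuous.sub hB.continuous)).mul ((cd_c1 hu).sub (cd_c1 hB))
    rw [intervalIntegral.integral_mul_deriv_eq_deriv_mul (fun x _ => hsd x) (fun x _ => hGd x)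
      (hcont.intervalIntegrable _ _) (hG'c.intervalIntegrable _ _)]
    have e1 : sg ε (u d - B d) = 0 := by unfold sg; rw [max_eq_right (by linarith)]; simp
    have e2 : sg ε (u c - B c) = 0 := by unfold sg; rw [max_eq_right (by linarith)]; simp
    rw [e1, e2]
    simp only [zero_mul, sub_self, zero_sub]
    rw [← intervalIntegral.integral_neg]
    calc ∫ x in c..d, -(s' (u x - B x) * (deriv u x - deriv B x) * G x)
        ≤ ∫ x in c..d, (L^2/(4*μ) * Real.sqrt ε) := by
          refine intervalIntegral.integral_mono_on hcd ((hcont.mul hGc).neg.intervalIntegrable _ _)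
            (intervalIntegrable_const) fun x hx => ?_
          set w := u x - B x with hw
          set p := deriv u x - deriv B x with hp
          have hlip := hL (u x) (B x) ((hM1 x hx).trans (le_max_left _ _)) ((hM2 x hx).trans (le_max_right _ _))
          have hb := sg_bound hε w
          change s' w * (max w 0)^2 ≤ _ at hb
          have hGx : G x = μ * p - (fl a (u x) - fl a (B x)) := rfl
          rw [hGx]
          set D := fl a (u x) - fl a (B x)
          rcases le_or_gt w 0 with hw0 | hw0
          · have : s' w = 0 := by simp [hs', max_eq_right hw0]
            rw [this]; simp; positivity
          · rw [max_eq_left hw0.le] at hb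
            rw [← hw, abs_of_pos hw0] at hlip
            have h1 : -(p * (μ * p - D)) ≤ L^2/(4*μ) * w^2 := by
              have hD2 : D^2 ≤ (L*w)^2 := by
                rw [← sq_abs D]; gcongr
              have : L^2/(4*μ) * w^2 = (L*w)^2/(4*μ) := by ring
              rw [this, le_div_iff₀ (by positivity)]
              nlinarith [sq_nonneg (2*μ*p - D)]
            calc -(s' w * p * (μ * p - D)) = s' w * (-(p * (μ * p - D))) := by ring
              _ ≤ s' w * (L^2/(4*μ) * w^2) := mul_le_mul_of_nonneg_left h1 (hs'0 w)
              _ = L^2/(4*μ) * (s' w * w^2) := by ring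
              _ ≤ L^2/(4*μ) * Real.sqrt ε := mul_le_mul_of_nonneg_left hb (by positivity)
      _ = _ := by simp; ring
  have lim1 : Tendsto (fun n : ℕ => ∫ x in c..d, sg (1/((n:ℝ)+1)) (u x - B x) * G' x) atTop
      (𝓝 (∫ x in c..d, ps (u x - B x) * G' x)) := by
    refine intervalIntegral.tendsto_integral_filter_of_dominated_convergence (fun x => |G' x|) ?_ ?_ ?_ ?_
    · refine Eventually.of_forall fun n => ?_
      have hn : (0:ℝ) < 1/((n:ℝ)+1) := by positivity
      have : Continuous (sg (1/((n:ℝ)+1))) := continuous_iff_continuousAt.mpr fun x => (sg_deriv hn x).continuousAt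
      exact ((this.comp (hu.continuous.sub hB.continuous)).mul hG'c).aestronglyMeasurable
    · refine Eventually.of_forall fun n => Eventually.of_forall fun x _ => ?_
      have hn : (0:ℝ) < 1/((n:ℝ)+1) := by positivity
      rw [norm_mul, Real.norm_eq_abs, Real.norm_eq_abs, abs_of_nonneg (sg_nonneg hn _)]
      exact mul_le_of_le_one_left (abs_nonneg _) (sg_le_one hn _)
    · exact hG'c.abs.intervalIntegrable _ _
    · exact Eventually.of_forall fun x _ => (sg_tendsto _).mul_const _
  have lim2 : Tendsto (fun n : ℕ => (d - c) * (L^2/(4*μ) * Real.sqrt (1/((n:ℝ)+1)))) atTop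
      (𝓝 ((d - c) * (L^2/(4*μ) * Real.sqrt 0))) :=
    ((Real.continuous_sqrt.tendsto 0).comp tendsto_one_div_add_atTop_nhds_zero_nat |>.const_mul _).const_mul _
  have := le_of_tendsto_of_tendsto' lim1 lim2 fun n => key _ (by positivity)
  simpa using this

noncomputable def pp (ε w : ℝ) : ℝ := (max w 0)^2 / (max w 0 + ε)

lemma pp_deriv {ε : ℝ} (hε : 0 < ε) (w : ℝ) :
    HasDerivAt (pp ε) (((max w 0)^2 + 2 * max w 0 * ε)/(max w 0 + ε)^2) w := by
  have h0 : pp ε = fun w => max w 0 - ε + ε^2/(max w 0 + ε) := by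
    funext w
    have : (0:ℝ) ≤ max w 0 := le_max_right _ _
    unfold pp; field_simp; ring
  rcases lt_trichotomy w 0 with h | h | h
  · have : pp ε =ᶠ[𝓝 w] fun _ => 0 := by
      filter_upwards [Iio_mem_nhds h] with y hy
      unfold pp
      rw [max_eq_right (le_of_lt hy)]; norm_num
    rw [max_eq_right h.le]
    simpa using (hasDerivAt_const w (0:ℝ)).congr_of_eventuallyEq this
  · subst h
    simp only [max_self]
    rw [hasDerivAt_iff_isLittleO_nhds_zero]
    have e0 : pp ε 0 = 0 := by simp [pp]
    simp only [zero_add, e0, sub_zero]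
    have h1 : (fun h : ℝ => pp ε h - h • ((0^2 + 2 * 0 * ε)/ε^2)) =O[𝓝 0] fun h => h^2 := by
      refine Asymptotics.IsBigO.of_bound (1/ε) (Eventually.of_forall fun y => ?_)
      have hm : (0:ℝ) ≤ max y 0 := le_max_right _ _
      have : pp ε y - y • ((0^2 + 2 * 0 * ε)/ε^2) = pp ε y := by simp
      rw [this, Real.norm_eq_abs, abs_of_nonneg (by unfold pp; positivity), Real.norm_eq_abs, abs_of_nonneg (sq_nonneg _)]
      unfold pp
      rw [div_le_iff₀ (by positivity)]
      have h3 : (max y 0)^2 ≤ y^2 := by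
        rcases le_total y 0 with hy | hy
        · rw [max_eq_right hy]; nlinarith [sq_nonneg y]
        · rw [max_eq_left hy]
      have : 1/ε * y^2 * (max y 0 + ε) = y^2 + 1/ε * y^2 * max y 0 := by field_simp; ring
      rw [this]
      have : 0 ≤ 1/ε * y^2 * max y 0 := by positivity
      linarith
    have h2 : (fun h : ℝ => h^2) =o[𝓝 0] fun h => h := by
      exact Asymptotics.isLittleO_pow_id (by norm_num)
    exact h1.trans_isLittleO h2
  · have : pp ε =ᶠ[𝓝 w] fun w => w^2/(w+ε) := by
      filter_upwards [Ioi_mem_nhds h] with y hy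
      unfold pp
      rw [max_eq_left (le_of_lt hy)]
    rw [max_eq_left h.le]
    have hwε : id w + ε ≠ 0 := by
      have : w + ε ≠ 0 := by positivity
      simpa using this
    have h4 := ((hasDerivAt_pow 2 w).div ((hasDerivAt_id w).add_const ε) hwε)
    refine (HasDerivAt.congr_of_eventuallyEq (h4.congr_deriv ?_) this)
    simp; ring

theorem pos_ftc {w w' : ℝ → ℝ} {s t : ℝ} (hst : s ≤ t) (hw : ∀ τ ∈ Icc s t, HasDerivAt w (w' τ) τ)
    (hw' : ContinuousOn w' (Icc s t)) :
    ∫ τ in s..t, ps (w τ) * w' τ = max (w t) 0 - max (w s) 0 := by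
  have hwc : ContinuousOn w (Icc s t) := fun τ hτ => (hw τ hτ).continuousAt.continuousWithinAt
  have dcont : ∀ ε : ℝ, 0 < ε → Continuous fun w : ℝ => (((max w 0)^2 + 2 * max w 0 * ε)/(max w 0 + ε)^2) := by
    intro ε hε
    refine Continuous.div (by fun_prop) (by fun_prop) fun w => ?_
    have : (0:ℝ) ≤ max w 0 := le_max_right _ _
    positivity
  have key : ∀ n : ℕ, ∫ τ in s..t, (((max (w τ) 0)^2 + 2 * max (w τ) 0 * (1/((n:ℝ)+1)))/(max (w τ) 0 + (1/((n:ℝ)+1)))^2) * w' τ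
      = pp (1/((n:ℝ)+1)) (w t) - pp (1/((n:ℝ)+1)) (w s) := by
    intro n
    have hn : (0:ℝ) < 1/((n:ℝ)+1) := by positivity
    refine intervalIntegral.integral_eq_sub_of_hasDerivAt (f := fun τ => pp (1/((n:ℝ)+1)) (w τ)) (fun τ hτ => ?_) ?_
    · rw [uIcc_of_le hst] at hτ
      exact (pp_deriv hn (w τ)).comp τ (hw τ hτ)
    · refine ContinuousOn.intervalIntegrable ?_
      rw [uIcc_of_le hst]
      exact ((dcont _ hn).comp_continuousOn hwc).mul hw'
  have hpp : ∀ v : ℝ, Tendsto (fun n : ℕ => pp (1/((n:ℝ)+1)) v) atTop (𝓝 (max v 0)) := by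
    intro v
    unfold pp
    rcases le_or_gt v 0 with hv | hv
    · rw [max_eq_right hv]; simp
    · rw [max_eq_left hv.le]
      have h1 : Tendsto (fun n : ℕ => v^2 / (v + 1/((n:ℝ)+1))) atTop (𝓝 (v^2/(v+0))) :=
        tendsto_const_nhds.div (tendsto_const_nhds.add tendsto_one_div_add_atTop_nhds_zero_nat)
          (by positivity)
      have e : v^2/(v+0) = v := by field_simp; ring
      rwa [e] at h1
  have lim1 : Tendsto (fun n : ℕ => ∫ τ in s..t, (((max (w τ) 0)^2 + 2 * max (w τ) 0 * (1/((n:ℝ)+1)))/(max (w τ) 0 + (1/((n:ℝ)+1)))^2) * w' τ) atTop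
      (𝓝 (∫ τ in s..t, ps (w τ) * w' τ)) := by
    refine intervalIntegral.tendsto_integral_filter_of_dominated_convergence (fun x => |w' x|) ?_ ?_ ?_ ?_
    · refine Eventually.of_forall fun n => ?_
      have hn : (0:ℝ) < 1/((n:ℝ)+1) := by positivity
      refine ContinuousOn.aestronglyMeasurable ?_ measurableSet_uIoc
      rw [uIoc_of_le hst]
      exact (((dcont _ hn).comp_continuousOn hwc).mul hw').mono Ioc_subset_Icc_self
    · refine Eventually.of_forall fun n => Eventually.of_forall fun x _ => ?_
      have hn : (0:ℝ) < 1/((n:ℝ)+1) := by positivity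
      have hm : (0:ℝ) ≤ max (w x) 0 := le_max_right _ _
      rw [norm_mul, Real.norm_eq_abs, Real.norm_eq_abs, abs_of_nonneg (by positivity)]
      refine mul_le_of_le_one_left (abs_nonneg _) ?_
      rw [div_le_one (by positivity)]
      nlinarith
    · refine ContinuousOn.intervalIntegrable ?_
      rw [uIcc_of_le hst]; exact hw'.abs
    · refine Eventually.of_forall fun x _ => Tendsto.mul_const _ ?_
      unfold ps
      split_ifs with h
      · rw [max_eq_left h.le]
        have h1 : Tendsto (fun n : ℕ => ((w x)^2 + 2 * w x * (1/((n:ℝ)+1))) / (w x + 1/((n:ℝ)+1))^2) atTop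
            (𝓝 (((w x)^2 + 2 * w x * 0)/(w x+0)^2)) :=
          (tendsto_const_nhds.add (tendsto_one_div_add_atTop_nhds_zero_nat.const_mul _)).div
            ((tendsto_const_nhds.add tendsto_one_div_add_atTop_nhds_zero_nat).pow 2) (by positivity)
        have e : (((w x)^2 + 2 * w x * 0)/(w x+0)^2) = 1 := by field_simp; ring
        rwa [e] at h1
      · rw [max_eq_right (not_lt.mp h)]; simp
  have lim2 := (hpp (w t)).sub (hpp (w s))
  simp only [key] at lim1
  exact tendsto_nhds_unique lim1 lim2

end Aux

namespace Aux
open Set Topology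

/-- local-in-time solution structure (positive times only) -/
structure LocSol (a : ℝ → ℝ) (μ : ℝ) (u h : ℝ → ℝ → ℝ) : Prop where
  ac : Continuous a
  ae : ∀ v, a (-v) = a v
  μp : 0 < μ
  ui : ∀ t, 0 < t → Integrable (u t)
  uc : ∀ t₀, 0 < t₀ → Tendsto (fun t => ∫ x, |u t x - u t₀ x|) (𝓝 t₀) (𝓝 0)
  hi : ∀ t, 0 < t → Integrable (h t)
  hc : ∀ t₀, 0 < t₀ → Tendsto (fun t => ∫ x, |h t x - h t₀ x|) (𝓝 t₀) (𝓝 0)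
  u2 : ∀ t, 0 < t → ContDiff ℝ 2 (u t)
  u1 : ∀ x, ContDiffOn ℝ 1 (fun s => u s x) (Ioi 0)
  pde : ∀ t, 0 < t → ∀ x, deriv (fun s => u s x) t
    = h t x + μ * deriv (deriv (u t)) x - a (u t x) * deriv (u t) x

lemma LocSol.neg {a : ℝ → ℝ} {μ : ℝ} {u h : ℝ → ℝ → ℝ} (S : LocSol a μ u h) :
    LocSol a μ (fun t x => -u t x) (fun t x => -h t x) where
  ac := S.ac
  ae := S.ae
  μp := S.μp
  ui t ht := (S.ui t ht).neg
  uc t₀ ht := by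
    refine (S.uc t₀ ht).congr fun t => ?_
    congr 1; funext x; rw [← abs_neg]; ring_nf
  hi t ht := (S.hi t ht).neg
  hc t₀ ht := by
    refine (S.hc t₀ ht).congr fun t => ?_
    congr 1; funext x; rw [← abs_neg]; ring_nf
  u2 t ht := (S.u2 t ht).neg
  u1 x := (S.u1 x).neg
  pde t ht x := by
    have h1 : deriv (fun x => -u t x) = fun x => -deriv (u t) x := by
      funext y; exact deriv.fun_neg
    have h2 : deriv (fun s => -u s x) t = -deriv (fun s => u s x) t := deriv.fun_neg
    have h3 : deriv (fun x => -deriv (u t) x) x = -deriv (deriv (u t)) x := deriv.fun_neg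
    rw [h2, S.pde t ht x]
    simp only [h1, h3, S.ae]
    ring

lemma LocSol.dt {a : ℝ → ℝ} {μ : ℝ} {u h : ℝ → ℝ → ℝ} (S : LocSol a μ u h) {t : ℝ} (ht : 0 < t) (x : ℝ) :
    HasDerivAt (fun s => u s x) (deriv (fun s => u s x) t) t :=
  (((S.u1 x).differentiableOn (by norm_num) t ht).differentiableAt (Ioi_mem_nhds ht)).hasDerivAt

lemma LocSol.dtc {a : ℝ → ℝ} {μ : ℝ} {u h : ℝ → ℝ → ℝ} (S : LocSol a μ u h) (x : ℝ) :
    ContinuousOn (deriv (fun s => u s x)) (Ioi 0) :=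
  (S.u1 x).continuousOn_deriv_of_isOpen isOpen_Ioi (by norm_num)

/-- continuity of truncated integrals -/
lemma cont_pos {p e : ℝ → ℝ → ℝ} (pi : ∀ t, 0 < t → Integrable (p t))
    (pc : ∀ t₀, 0 < t₀ → Tendsto (fun t => ∫ x, |p t x - p t₀ x|) (𝓝 t₀) (𝓝 0))
    (ec : Continuous (Function.uncurry e)) (c d : ℝ) :
    ContinuousOn (fun τ => ∫ x in Ioc c d, max (p τ x + e τ x) 0) (Ioi 0) := by
  intro t₀ ht₀
  refine ContinuousAt.continuousWithinAt ?_
  have ht₀' : 0 < t₀ := ht₀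
  have eI : ∀ τ, IntegrableOn (e τ) (Ioc c d) := fun τ =>
    ((ec.comp (Continuous.prodMk_right τ)).integrableOn_Icc (a := c) (b := d)).mono_set Ioc_subset_Icc_self
  have e2 : Tendsto (fun τ => ∫ x in Ioc c d, |e τ x - e t₀ x|) (𝓝 t₀) (𝓝 0) := by
    have hc : Continuous fun τ => ∫ x in Icc c d, |e τ x - e t₀ x| := by
      refine continuous_parametric_integral_of_continuous (f := fun τ x => |e τ x - e t₀ x|) ?_ isCompact_Icc
      have : Continuous fun q : ℝ × ℝ => e t₀ q.2 := (ec.comp (Continuous.prodMk_right t₀)).comp continuous_snd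
      exact (ec.sub this).abs
    have := hc.tendsto t₀
    simp only [integral_Icc_eq_integral_Ioc] at this
    simpa using this
  have lim := (pc t₀ ht₀').add e2
  rw [add_zero] at lim
  refine tendsto_iff_dist_tendsto_zero.mpr ?_
  refine squeeze_zero' (Eventually.of_forall fun _ => dist_nonneg) ?_ lim
  filter_upwards [Ioi_mem_nhds ht₀'] with τ hτ
  have I1 : ∀ τ, 0 < τ → IntegrableOn (fun x => max (p τ x + e τ x) 0) (Ioc c d) := fun τ hτ =>
    ((pi τ hτ).integrableOn.add (eI τ)).pos_part
  rw [Real.dist_eq, ← integral_sub (I1 τ hτ) (I1 t₀ ht₀')]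
  have I2 : Integrable fun x => |p τ x - p t₀ x| := ((pi τ hτ).sub (pi t₀ ht₀')).abs
  have I3 : IntegrableOn (fun x => |e τ x - e t₀ x|) (Ioc c d) := ((eI τ).sub (eI t₀)).abs
  calc |∫ x in Ioc c d, (max (p τ x + e τ x) 0 - max (p t₀ x + e t₀ x) 0)|
      ≤ ∫ x in Ioc c d, |max (p τ x + e τ x) 0 - max (p t₀ x + e t₀ x) 0| := abs_integral_le_integral_abs
    _ ≤ ∫ x in Ioc c d, (|p τ x - p t₀ x| + |e τ x - e t₀ x|) := by
        refine integral_mono (((I1 τ hτ).sub (I1 t₀ ht₀')).abs) (I2.integrableOn.add I3) fun x => ?_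
        refine (abs_max_sub_max_le_abs _ _ _).trans ?_
        calc |p τ x + e τ x - (p t₀ x + e t₀ x)| = |(p τ x - p t₀ x) + (e τ x - e t₀ x)| := by ring_nf
          _ ≤ _ := abs_add_le _ _
    _ = (∫ x in Ioc c d, |p τ x - p t₀ x|) + ∫ x in Ioc c d, |e τ x - e t₀ x| := integral_add I2.integrableOn I3
    _ ≤ _ := add_le_add (setIntegral_le_integral I2 (Eventually.of_forall fun x => abs_nonneg _)) le_rfl

/-- source defect of the barrier `k + τ r` -/
noncomputable def er (a : ℝ → ℝ) (μ : ℝ) (k r : ℝ → ℝ) (τ x : ℝ) : ℝ :=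
  μ * (deriv (deriv k) x + τ * deriv (deriv r) x)
    - a (k x + τ * r x) * (deriv k x + τ * deriv r x) - r x

lemma er_cont {a : ℝ → ℝ} {μ : ℝ} {k r : ℝ → ℝ} (ha : Continuous a) (hk : ContDiff ℝ 2 k) (hr : ContDiff ℝ 2 r) :
    Continuous (Function.uncurry (er a μ k r)) := by
  have := cd_c1 hk; have := cd_c2 hk; have := cd_c1 hr; have := cd_c2 hr
  have := hk.continuous; have := hr.continuous
  unfold er Function.uncurry
  fun_prop

noncomputable def mB (a : ℝ → ℝ) (μ : ℝ) (h : ℝ → ℝ → ℝ) (c d : ℝ) (k r : ℝ → ℝ) (τ : ℝ) : ℝ :=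
  ∫ x in Ioc c d, max (h τ x + er a μ k r τ x) 0

noncomputable def PhB (u : ℝ → ℝ → ℝ) (c d : ℝ) (k r : ℝ → ℝ) (τ : ℝ) : ℝ :=
  ∫ x in Ioc c d, max (u τ x + -(k x + τ * r x)) 0

lemma mB_cont {a : ℝ → ℝ} {μ : ℝ} {u h : ℝ → ℝ → ℝ} (S : LocSol a μ u h) (c d : ℝ) {k r : ℝ → ℝ}
    (hk : ContDiff ℝ 2 k) (hr : ContDiff ℝ 2 r) : ContinuousOn (mB a μ h c d k r) (Ioi 0) :=
  cont_pos S.hi S.hc (er_cont S.ac hk hr) c d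

lemma mB_ii {a : ℝ → ℝ} {μ : ℝ} {u h : ℝ → ℝ → ℝ} (S : LocSol a μ u h) (c d : ℝ) {k r : ℝ → ℝ}
    (hk : ContDiff ℝ 2 k) (hr : ContDiff ℝ 2 r) {s t : ℝ} (hs : 0 < s) (ht : 0 < t) :
    IntervalIntegrable (mB a μ h c d k r) volume s t := by
  refine ContinuousOn.intervalIntegrable ((mB_cont S c d hk hr).mono fun x hx => ?_)
  rw [mem_uIcc] at hx
  rcases hx with h | h
  · exact hs.trans_le h.1
  · exact ht.trans_le h.1

lemma PhB_cont {a : ℝ → ℝ} {μ : ℝ} {u h : ℝ → ℝ → ℝ} (S : LocSol a μ u h) (c d : ℝ) {k r : ℝ → ℝ}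
    (hk : ContDiff ℝ 2 k) (hr : ContDiff ℝ 2 r) : ContinuousOn (PhB u c d k r) (Ioi 0) := by
  refine cont_pos (p := u) (e := fun τ x => -(k x + τ * r x)) S.ui S.uc ?_ c d
  have := hk.continuous; have := hr.continuous
  unfold Function.uncurry
  fun_prop

def KrOn (a : ℝ → ℝ) (μ : ℝ) (u h : ℝ → ℝ → ℝ) (c d s t : ℝ) : Prop :=
  ∀ k r : ℝ → ℝ, ContDiff ℝ 2 k → ContDiff ℝ 2 r →
    (∀ τ ∈ Icc s t, u τ c ≤ k c + τ * r c ∧ u τ d ≤ k d + τ * r d) →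
    PhB u c d k r t - PhB u c d k r s ≤ ∫ τ in s..t, mB a μ h c d k r τ

lemma KrOn.glue {a : ℝ → ℝ} {μ : ℝ} {u h : ℝ → ℝ → ℝ} (S : LocSol a μ u h) {c d s m t : ℝ} (hs : 0 < s)
    (hsm : s ≤ m) (hmt : m ≤ t) (h1 : KrOn a μ u h c d s m) (h2 : KrOn a μ u h c d m t) :
    KrOn a μ u h c d s t := by
  intro k r hk hr hb
  have e1 := h1 k r hk hr fun τ hτ => hb τ ⟨hτ.1, hτ.2.trans hmt⟩
  have e2 := h2 k r hk hr fun τ hτ => hb τ ⟨hsm.trans hτ.1, hτ.2⟩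
  rw [← intervalIntegral.integral_add_adjacent_intervals (mB_ii S c d hk hr hs (hs.trans_le hsm))
    (mB_ii S c d hk hr (hs.trans_le hsm) (hs.trans_le (hsm.trans hmt)))]
  linarith

lemma KrOn.refl {a : ℝ → ℝ} {μ : ℝ} {u h : ℝ → ℝ → ℝ} {c d s : ℝ} : KrOn a μ u h c d s s := by
  intro k r hk hr hb
  simp

/-- locally good implies good -/
lemma KrOn.of_local {a : ℝ → ℝ} {μ : ℝ} {u h : ℝ → ℝ → ℝ} (S : LocSol a μ u h) {c d s t : ℝ} (hs : 0 < s)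
    (hst : s ≤ t)
    (hloc : ∀ τ ∈ Icc s t, ∃ δ > 0, ∀ s' t', s ≤ s' → s' ≤ t' → t' ≤ t → |s' - τ| < δ → |t' - τ| < δ →
      KrOn a μ u h c d s' t') : KrOn a μ u h c d s t := by
  choose! δ hδ hK using hloc
  let cov : Icc s t → Set (Icc s t) := fun τ => {σ | |(σ:ℝ) - τ| < δ τ}
  have hopen : ∀ τ, IsOpen (cov τ) := fun τ => by
    refine isOpen_lt ?_ continuous_const
    fun_prop
  obtain ⟨f, hf0, hfm, ⟨m, hm⟩, hf⟩ := exists_monotone_Icc_subset_open_cover_Icc hst hopen (by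
    intro σ _
    refine mem_iUnion.mpr ⟨σ, ?_⟩
    simp only [cov, mem_ofPred_eq, sub_self, abs_zero]
    exact hδ σ σ.2)
  have main : ∀ n, KrOn a μ u h c d s (f n) := by
    intro n
    induction n with
    | zero => rw [hf0]; exact KrOn.refl
    | succ n ih =>
      refine KrOn.glue S hs (f n).2.1 (hfm (Nat.le_succ n)) ih ?_
      obtain ⟨τ, hτ⟩ := hf n
      have hle : f n ≤ f (n+1) := hfm (Nat.le_succ n)
      have h1 : f n ∈ cov τ := hτ ⟨le_rfl, hle⟩
      have h2 : f (n+1) ∈ cov τ := hτ ⟨hle, le_rfl⟩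
      exact hK τ τ.2 _ _ (f n).2.1 hle (f (n+1)).2.2 h1 h2
  have := main m
  rwa [hm m le_rfl] at this

/-- closing up an open interval -/
lemma KrOn.of_open {a : ℝ → ℝ} {μ : ℝ} {u h : ℝ → ℝ → ℝ} (S : LocSol a μ u h) {c d s t : ℝ} (hs : 0 < s)
    (hst : s < t)
    (hin : ∀ s' t', s < s' → s' ≤ t' → t' < t → KrOn a μ u h c d s' t') : KrOn a μ u h c d s t := by
  intro k r hk hr hb
  have ht : 0 < t := hs.trans hst
  set P : ℝ → ℝ := fun τ => PhB u c d k r τ with hP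
  have hPc := PhB_cont S c d hk hr
  have hii : IntervalIntegrable (mB a μ h c d k r) volume s t := mB_ii S c d hk hr hs ht
  set G : ℝ → ℝ := fun τ => ∫ σ in s..τ, mB a μ h c d k r σ with hG
  have hGc : ContinuousOn G (Icc s t) := by
    have := intervalIntegral.continuousOn_primitive_interval (a := s) (b := t)
      (f := mB a μ h c d k r) (μ := volume) (by
        rw [uIcc_of_le hst.le]
        exact ((mB_cont S c d hk hr).mono fun x hx => hs.trans_le hx.1).integrableOn_Icc)
    rwa [uIcc_of_le hst.le] at this
  have hanti : ∀ s' t', s < s' → s' ≤ t' → t' < t → P t' - G t' ≤ P s' - G s' := by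
    intro s' t' h1 h2 h3
    have := hin s' t' h1 h2 h3 k r hk hr fun τ hτ => hb τ ⟨h1.le.trans hτ.1, hτ.2.trans h3.le⟩
    have e : G t' = G s' + ∫ τ in s'..t', mB a μ h c d k r τ := by
      rw [hG]
      exact (intervalIntegral.integral_add_adjacent_intervals (mB_ii S c d hk hr hs (hs.trans h1))
        (mB_ii S c d hk hr (hs.trans h1) ((hs.trans h1).trans_le h2))).symm
    rw [e]
    simp only [hP]
    linarith
  have cs : ContinuousOn (fun τ => P τ - G τ) (Icc s t) :=
    (hPc.mono fun x hx => hs.trans_le hx.1).sub hGc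
  have lim1 : Tendsto (fun τ => P τ - G τ) (𝓝[>] s) (𝓝 (P s - G s)) := by
    have := (cs s ⟨le_rfl, hst.le⟩).mono_left (nhdsWithin_mono s (Ioc_subset_Icc_self))
    rwa [nhdsWithin_Ioc_eq_nhdsGT hst] at this
  have lim2 : Tendsto (fun τ => P τ - G τ) (𝓝[<] t) (𝓝 (P t - G t)) := by
    have := (cs t ⟨hst.le, le_rfl⟩).mono_left (nhdsWithin_mono t (Ico_subset_Icc_self))
    rwa [nhdsWithin_Ico_eq_nhdsLT hst] at this
  have mid : ∀ m, s < m → m < t → P t - G t ≤ P m - G m ∧ P m - G m ≤ P s - G s := by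
    intro m h1 h2
    constructor
    · refine le_of_tendsto lim2 ?_
      filter_upwards [Ioo_mem_nhdsLT h2] with τ hτ using hanti m τ h1 hτ.1.le hτ.2
    · refine ge_of_tendsto lim1 ?_
      filter_upwards [Ioo_mem_nhdsGT h1] with τ hτ using hanti τ m hτ.1 hτ.2.le h2
  obtain ⟨m1, m2⟩ := mid ((s+t)/2) (by linarith) (by linarith)
  have : G s = 0 := by simp [hG]
  have e3 := m1.trans m2
  rw [this] at e3
  change P t - P s ≤ G t
  linarith
end Aux

namespace Aux
open Set Topology

/-- L¹ norms are bounded on compact time intervals -/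
lemma l1_bdd {h : ℝ → ℝ → ℝ} (hi : ∀ t, 0 < t → Integrable (h t))
    (hc : ∀ t₀, 0 < t₀ → Tendsto (fun t => ∫ x, |h t x - h t₀ x|) (𝓝 t₀) (𝓝 0)) {s t : ℝ} (hs : 0 < s) :
    ∃ H, 0 ≤ H ∧ ∀ τ ∈ Icc s t, ∫ x, |h τ x| ≤ H := by
  have cont : ContinuousOn (fun τ => ∫ x, |h τ x|) (Icc s t) := by
    intro t₀ ht₀
    have h0 : 0 < t₀ := hs.trans_le ht₀.1
    refine ContinuousAt.continuousWithinAt ?_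
    refine tendsto_iff_dist_tendsto_zero.mpr ?_
    refine squeeze_zero' (Eventually.of_forall fun _ => dist_nonneg) ?_ (hc t₀ h0)
    filter_upwards [Ioi_mem_nhds h0] with τ hτ
    rw [Real.dist_eq, ← integral_sub (hi τ hτ).abs (hi t₀ h0).abs]
    refine abs_integral_le_integral_abs.trans ?_
    refine integral_mono (((hi τ hτ).abs.sub (hi t₀ h0).abs).abs) (((hi τ hτ).sub (hi t₀ h0)).abs) fun x => ?_
    exact abs_abs_sub_abs_le_abs_sub _ _
  obtain ⟨H, hH⟩ := isCompact_Icc.exists_bound_of_continuousOn cont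
  refine ⟨max H 0, le_max_right _ _, fun τ hτ => ?_⟩
  exact (le_abs_self _).trans ((hH τ hτ).trans (le_max_left _ _))

/-- one-sided gap estimate -/
lemma gap_one {a : ℝ → ℝ} {μ : ℝ} {u h : ℝ → ℝ → ℝ} (S : LocSol a μ u h) {c d t1 t2 : ℝ} (hcd : c < d)
    (h1 : 0 < t1) {C : ℝ} (hC : 0 ≤ C) :
    ∃ C', 0 ≤ C' ∧ ∀ α β, t1 ≤ α → α ≤ β → β ≤ t2 →
      (∀ x ∈ Ioo c d, |u α x| ≤ C ∧ |deriv (u α) x| ≤ C ∧ |deriv (deriv (u α)) x| ≤ C) →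
      KrOn a μ u h c d α β →
      ∫ x in Ioc c d, max (u β x - u α x) 0 ≤ C' * (β - α) := by
  obtain ⟨H, hH0, hH⟩ := l1_bdd S.hi S.hc (t := t2) h1
  have bd : ∀ x, ∃ D, ∀ τ ∈ Icc t1 t2, ‖deriv (fun s => u s x) τ‖ ≤ D := fun x =>
    isCompact_Icc.exists_bound_of_continuousOn ((S.dtc x).mono fun τ hτ => h1.trans_le hτ.1)
  obtain ⟨Dc, hDc⟩ := bd c
  obtain ⟨Dd, hDd⟩ := bd d
  set C1 := max (max Dc Dd) 0 with hC1
  have hC10 : 0 ≤ C1 := le_max_right _ _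
  obtain ⟨A, hA⟩ := isCompact_Icc.exists_bound_of_continuousOn
    (S.ac.continuousOn (s := Icc (-(C + C1*(t2-t1))) (C + C1*(t2-t1))))
  set A' := max A 0
  have hA'0 : 0 ≤ A' := le_max_right _ _
  have μp := S.μp
  refine ⟨C1 * (d - c) + (H + (μ * C + A' * C) * (d - c)), ?_, ?_⟩
  · have : 0 ≤ d - c := by linarith
    positivity
  intro α β hα hαβ hβ hb hK
  have α0 : 0 < α := h1.trans_le hα
  have β0 : 0 < β := α0.trans_le hαβ
  have hdc : 0 < d - c := by linarith
  set k : ℝ → ℝ := fun x => u α x - α * C1 with hk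
  set r : ℝ → ℝ := fun _ => C1 with hr
  have hk2 : ContDiff ℝ 2 k := (S.u2 α α0).sub contDiff_const
  have hr2 : ContDiff ℝ 2 r := contDiff_const
  have mv : ∀ x, (∀ τ ∈ Icc t1 t2, ‖deriv (fun s => u s x) τ‖ ≤ C1) → ∀ τ ∈ Icc α β, u τ x ≤ k x + τ * r x := by
    intro x hx τ hτ
    have := (convex_Icc t1 t2).norm_image_sub_le_of_norm_hasDerivWithin_le (f := fun s => u s x)
      (f' := deriv (fun s => u s x)) (C := C1) (x := α) (y := τ)
      (fun σ hσ => (S.dt (h1.trans_le hσ.1) x).hasDerivWithinAt) hx ⟨hα, hαβ.trans hβ⟩ ⟨hα.trans hτ.1, hτ.2.trans hβ⟩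
    rw [Real.norm_eq_abs, Real.norm_eq_abs, abs_of_nonneg (by linarith [hτ.1] : 0 ≤ τ - α)] at this
    have := (abs_le.mp this).2
    simp only [hk, hr]
    nlinarith
  have key := hK k r hk2 hr2 fun τ hτ => ⟨mv c (fun σ hσ => (hDc σ hσ).trans ((le_max_left _ _).trans (le_max_left _ _))) τ hτ,
    mv d (fun σ hσ => (hDd σ hσ).trans ((le_max_right _ _).trans (le_max_left _ _))) τ hτ⟩
  have e0 : PhB u c d k r α = 0 := by
    unfold PhB
    have : ∀ x, max (u α x + -(k x + α * r x)) 0 = 0 := fun x => by simp [hk, hr]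
    simp only [this]; simp
  have e1 : ∫ x in Ioc c d, max (u β x - u α x) 0 ≤ PhB u c d k r β + C1 * (d - c) * (β - α) := by
    unfold PhB
    have I1 : IntegrableOn (fun x => max (u β x + -(k x + β * r x)) 0) (Ioc c d) := by
      refine Continuous.integrableOn_Ioc ?_
      have := (S.u2 β β0).continuous; have := hk2.continuous
      fun_prop
    have I2 : IntegrableOn (fun x => max (u β x - u α x) 0) (Ioc c d) := by
      refine Continuous.integrableOn_Ioc ?_
      have := (S.u2 β β0).continuous; have := (S.u2 α α0).continuous
      fun_prop
    have : C1 * (d - c) * (β - α) = ∫ x in Ioc c d, C1 * (β - α) := by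
      simp [hcd.le]; ring
    rw [this, ← integral_add I1 (integrable_const _)]
    refine integral_mono I2 (I1.add (integrable_const _)) fun x => ?_
    simp only [hk, hr]
    have : 0 ≤ C1 * (β - α) := mul_nonneg hC10 (by linarith)
    refine max_le ?_ ?_
    · have := le_max_left (u β x + -(u α x - α * C1 + β * C1)) 0
      linarith
    · have := le_max_right (u β x + -(u α x - α * C1 + β * C1)) 0
      linarith
  have e2 : ∫ τ in α..β, mB a μ h c d k r τ ≤ (H + (μ * C + A' * C) * (d - c)) * (β - α) := by
    have : (H + (μ * C + A' * C) * (d - c)) * (β - α) = ∫ τ in α..β, (H + (μ * C + A' * C) * (d - c)) := by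
      simp; ring
    rw [this]
    refine intervalIntegral.integral_mono_on hαβ (mB_ii S c d hk2 hr2 α0 β0) (by simp) fun τ hτ => ?_
    have τ0 : 0 < τ := α0.trans_le hτ.1
    have I3 : IntegrableOn (fun x => max (h τ x + er a μ k r τ x) 0) (Ioc c d) := by
      refine ((S.hi τ τ0).integrableOn.add ?_).pos_part
      exact ((er_cont S.ac hk2 hr2).comp (Continuous.prodMk_right τ)).integrableOn_Ioc
    have e5 : (μ * C + A' * C) * (d - c) = ∫ x in Ioc c d, (μ * C + A' * C) := by
      simp [hcd.le]; ring
    calc mB a μ h c d k r τ ≤ ∫ x in Ioc c d, (|h τ x| + (μ * C + A' * C)) := by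
          unfold mB
          rw [integral_Ioc_eq_integral_Ioo, integral_Ioc_eq_integral_Ioo]
          refine setIntegral_mono_on (I3.mono_set Ioo_subset_Ioc_self)
            (((S.hi τ τ0).abs.integrableOn).add (by simp)) measurableSet_Ioo fun x hx => ?_
          obtain ⟨b1, b2, b3⟩ := hb x hx
          have d1 : deriv k = deriv (u α) := by
            funext y; simp [hk]
          have d2 : deriv r = fun _ => 0 := by funext y; simp [hr]
          have B1 : |a (k x + τ * r x)| ≤ A' := by
            refine (hA _ ?_).trans (le_max_left _ _)
            rw [mem_Icc, ← abs_le]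
            have : k x + τ * r x = u α x + C1 * (τ - α) := by simp only [hk, hr]; ring
            rw [this]
            refine (abs_add_le _ _).trans (add_le_add b1 ?_)
            rw [abs_of_nonneg (mul_nonneg hC10 (by linarith [hτ.1]))]
            refine mul_le_mul_of_nonneg_left ?_ hC10
            linarith [hτ.2]
          have B2 : |a (k x + τ * r x) * deriv (u α) x| ≤ A' * C := by
            rw [abs_mul]; exact mul_le_mul B1 b2 (abs_nonneg _) hA'0
          have B3 : μ * deriv (deriv (u α)) x ≤ μ * C := mul_le_mul_of_nonneg_left ((le_abs_self _).trans b3) μp.le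
          refine max_le ?_ (by positivity)
          unfold er
          rw [d1, d2]
          simp only [deriv_const, mul_zero, add_zero]
          have : r x = C1 := rfl
          rw [this] at *
          have := neg_abs_le (a (k x + τ * C1) * deriv (u α) x)
          linarith [le_abs_self (h τ x)]
      _ = (∫ x in Ioc c d, |h τ x|) + (μ * C + A' * C) * (d - c) := by
          rw [integral_add (S.hi τ τ0).abs.integrableOn (by simp), e5]
      _ ≤ _ := add_le_add ((setIntegral_le_integral (S.hi τ τ0).abs (Eventually.of_forall fun x => abs_nonneg _)).trans
          (hH τ ⟨hα.trans hτ.1, hτ.2.trans hβ⟩)) le_rfl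
  rw [e0] at key
  nlinarith

lemma gap_two {a : ℝ → ℝ} {μ : ℝ} {u h : ℝ → ℝ → ℝ} (S : LocSol a μ u h) {c d t1 t2 : ℝ} (hcd : c < d)
    (h1 : 0 < t1) {C : ℝ} (hC : 0 ≤ C) :
    ∃ C', 0 ≤ C' ∧ ∀ α β, t1 ≤ α → α ≤ β → β ≤ t2 →
      (∀ x ∈ Ioo c d, |u α x| ≤ C ∧ |deriv (u α) x| ≤ C ∧ |deriv (deriv (u α)) x| ≤ C) →
      KrOn a μ u h c d α β → KrOn a μ (fun t x => -u t x) (fun t x => -h t x) c d α β →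
      ∫ x in Ioc c d, |u β x - u α x| ≤ C' * (β - α) := by
  obtain ⟨C1, h10, hC1⟩ := gap_one S (t2 := t2) hcd h1 hC
  obtain ⟨C2, h20, hC2⟩ := gap_one S.neg (t2 := t2) hcd h1 hC
  refine ⟨C1 + C2, by positivity, fun α β hα hαβ hβ hb k1 k2 => ?_⟩
  have α0 : 0 < α := h1.trans_le hα
  have β0 : 0 < β := α0.trans_le hαβ
  have := (S.u2 β β0).continuous; have := (S.u2 α α0).continuous
  have e1 := hC1 α β hα hαβ hβ hb k1
  have e2 := hC2 α β hα hαβ hβ (fun x hx => by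
    have q1 : deriv (fun x => -u α x) = fun x => -deriv (u α) x := by
      funext y; exact deriv.fun_neg
    have q3 : deriv (fun x => -deriv (u α) x) x = -deriv (deriv (u α)) x := deriv.fun_neg
    simpa only [q1, q3, abs_neg] using hb x hx) k2
  have I1 : IntegrableOn (fun x => max (u β x - u α x) 0) (Ioc c d) :=
    Continuous.integrableOn_Ioc (by fun_prop)
  have I2 : IntegrableOn (fun x => max (-u β x - -u α x) 0) (Ioc c d) :=
    Continuous.integrableOn_Ioc (by fun_prop)
  calc ∫ x in Ioc c d, |u β x - u α x| = ∫ x in Ioc c d, (max (u β x - u α x) 0 + max (-u β x - -u α x) 0) := by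
        congr 1; funext x
        rcases le_total (u β x - u α x) 0 with h | h
        · rw [abs_of_nonpos h, max_eq_right h, max_eq_left (by linarith)]; ring
        · rw [abs_of_nonneg h, max_eq_left h, max_eq_right (by linarith)]; ring
    _ = _ := integral_add I1 I2
    _ ≤ _ := by linarith

/-- gap decomposition of the complement of a compact set in an interval -/
lemma gaps {T : Set ℝ} {t1 t2 : ℝ} (hT : IsClosed T) (hsub : T ⊆ Icc t1 t2) (m1 : t1 ∈ T) (m2 : t2 ∈ T) :
    ∃ (L : Set ℝ) (b : ℝ → ℝ), L.Countable ∧ (∀ α ∈ L, α ∈ T ∧ b α ∈ T ∧ α < b α ∧ Ioo α (b α) ∩ T = ∅) ∧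
      L.PairwiseDisjoint (fun α => Ioo α (b α)) ∧ Icc t1 t2 \ T = ⋃ α ∈ L, Ioo α (b α) := by
  classical
  set L : Set ℝ := {α | α ∈ T ∧ ∃ β ∈ T, α < β ∧ Ioo α β ∩ T = ∅} with hL
  have hex : ∀ α ∈ L, ∃ β, β ∈ T ∧ α < β ∧ Ioo α β ∩ T = ∅ := fun α hα => by
    obtain ⟨_, β, h1, h2, h3⟩ := hα; exact ⟨β, h1, h2, h3⟩
  choose! b hb1 hb2 hb3 using hex
  have pd : L.PairwiseDisjoint (fun α => Ioo α (b α)) := by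
    have aux : ∀ α ∈ L, ∀ α' ∈ L, α < α' → Disjoint (Ioo α (b α)) (Ioo α' (b α')) := by
      intro α hα α' hα' hlt
      rw [Set.disjoint_left]
      intro x hx hx'
      have : α' ∈ Ioo α (b α) ∩ T := ⟨⟨hlt, hx'.1.trans hx.2⟩, hα'.1⟩
      rw [hb3 α hα] at this
      exact this
    intro α hα α' hα' hne
    rcases lt_or_gt_of_ne hne with h | h
    · exact aux α hα α' hα' h
    · exact (aux α' hα' α hα h).symm
  refine ⟨L, b, ?_, fun α hα => ⟨hα.1, hb1 α hα, hb2 α hα, hb3 α hα⟩, pd, ?_⟩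
  · exact pd.countable_of_Ioo fun α hα => hb2 α hα
  · ext τ
    simp only [Set.mem_sdiff, mem_iUnion]
    constructor
    · rintro ⟨hτ, hτT⟩
      have comp : IsCompact T := isCompact_Icc.of_isClosed_subset hT hsub
      have c1 : IsCompact (T ∩ Iic τ) := comp.inter_right isClosed_Iic
      have c2 : IsCompact (T ∩ Ici τ) := comp.inter_right isClosed_Ici
      obtain ⟨α, hα, hαm⟩ := c1.exists_isGreatest ⟨t1, m1, hτ.1⟩
      obtain ⟨β, hβ, hβm⟩ := c2.exists_isLeast ⟨t2, m2, hτ.2⟩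
      have l1 : α < τ := lt_of_le_of_ne hα.2 fun e => hτT (e ▸ hα.1)
      have l2 : τ < β := lt_of_le_of_ne hβ.2 fun e => hτT (e ▸ hβ.1)
      have emp : Ioo α β ∩ T = ∅ := by
        ext σ
        simp only [mem_inter_iff, mem_empty_iff_false, iff_false]
        rintro ⟨hσ, hσT⟩
        rcases le_total σ τ with h | h
        · exact absurd (hαm ⟨hσT, h⟩) (not_le.mpr hσ.1)
        · exact absurd (hβm ⟨hσT, h⟩) (not_le.mpr hσ.2)
      have hαL : α ∈ L := ⟨hα.1, β, hβ.1, l1.trans l2, emp⟩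
      refine ⟨α, hαL, l1, ?_⟩
      by_contra hcon
      push Not at hcon
      have : b α ∈ Ioo α β ∩ T := ⟨⟨hb2 α hαL, hcon.trans_lt l2⟩, hb1 α hαL⟩
      rw [emp] at this
      exact this
    · rintro ⟨α, hα, hτ⟩
      refine ⟨⟨(hsub hα.1).1.trans hτ.1.le, hτ.2.le.trans (hsub (hb1 α hα)).2⟩, fun hT' => ?_⟩
      have : τ ∈ Ioo α (b α) ∩ T := ⟨hτ, hT'⟩
      rw [hb3 α hα] at this
      exact this
end Aux

namespace Aux
open Set Topology

lemma LocSol.ut_meas {a : ℝ → ℝ} {μ : ℝ} {u h : ℝ → ℝ → ℝ} (S : LocSol a μ u h) {t : ℝ} (ht : 0 < t) :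
    Measurable fun x => deriv (fun s => u s x) t := by
  refine measurable_of_tendsto_metrizable (f := fun (n : ℕ) x => ((n:ℝ)+1) * (u (t + 1/((n:ℝ)+1)) x - u t x)) ?_ ?_
  · intro n
    have : 0 < t + 1/((n:ℝ)+1) := by positivity
    have := (S.u2 _ this).continuous
    have := (S.u2 t ht).continuous
    exact Continuous.measurable (by fun_prop)
  · rw [tendsto_pi_nhds]
    intro x
    have h1 := (S.dt ht x).tendsto_slope_zero
    have h2 : Tendsto (fun n : ℕ => 1/((n:ℝ)+1)) atTop (𝓝[≠] 0) := by
      refine tendsto_nhdsWithin_iff.mpr ⟨tendsto_one_div_add_atTop_nhds_zero_nat, ?_⟩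
      refine Eventually.of_forall fun n => ?_
      have : (0:ℝ) < 1/((n:ℝ)+1) := by positivity
      exact this.ne'
    refine (h1.comp h2).congr fun n => ?_
    simp

/-- joint measurability for times at least `t1` -/
lemma LocSol.meas2 {a : ℝ → ℝ} {μ : ℝ} {u h : ℝ → ℝ → ℝ} (S : LocSol a μ u h) {t1 : ℝ} (h1 : 0 < t1) :
    Measurable (Function.uncurry fun τ x => u (max τ t1) x) ∧
    Measurable (Function.uncurry fun τ x => deriv (fun s => u s x) (max τ t1)) := by
  have hm : ∀ τ, 0 < max τ t1 := fun τ => h1.trans_le (le_max_right _ _)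
  constructor
  · refine measurable_uncurry_of_continuous_of_measurable (fun x => ?_) fun τ => (S.u2 _ (hm τ)).continuous.measurable
    exact ((S.u1 x).continuousOn).comp_continuous (by fun_prop) hm
  · refine measurable_uncurry_of_continuous_of_measurable (fun x => ?_) fun τ => S.ut_meas (hm τ)
    exact (S.dtc x).comp_continuous (by fun_prop) hm

/-- Slice bound at a fixed time -/
lemma slice {a : ℝ → ℝ} {μ : ℝ} {u h : ℝ → ℝ → ℝ} (S : LocSol a μ u h) {c d τ : ℝ} (hcd : c < d) (hτ : 0 < τ)
    {k r : ℝ → ℝ} (hk : ContDiff ℝ 2 k) (hr : ContDiff ℝ 2 r)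
    (hc : u τ c ≤ k c + τ * r c) (hd : u τ d ≤ k d + τ * r d) :
    ∫ x in Ioc c d, ps (u τ x - (k x + τ * r x)) * (deriv (fun s => u s x) τ - r x) ≤ mB a μ h c d k r τ := by
  have hB : ContDiff ℝ 2 fun x => k x + τ * r x := hk.add (contDiff_const.mul hr)
  have dB : deriv (fun x => k x + τ * r x) = fun x => deriv k x + τ * deriv r x := by
    funext x
    exact ((cd_d0 hk x).add ((cd_d0 hr x).const_mul τ)).deriv
  have ddB : deriv (fun x => deriv k x + τ * deriv r x) = fun x => deriv (deriv k) x + τ * deriv (deriv r) x := by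
    funext x
    exact ((cd_d1 hk x).add ((cd_d1 hr x).const_mul τ)).deriv
  have K := kato S.ac S.μp (S.u2 τ hτ) hB hcd.le hc hd
  rw [intervalIntegral.integral_of_le hcd.le, dB, ddB] at K
  have psm : Measurable fun x => ps (u τ x - (k x + τ * r x)) :=
    measurable_ps.comp ((S.u2 τ hτ).continuous.measurable.sub hB.continuous.measurable)
  have bdmul : ∀ {f : ℝ → ℝ}, IntegrableOn f (Ioc c d) → IntegrableOn (fun x => ps (u τ x - (k x + τ * r x)) * f x) (Ioc c d) := by
    intro f hf
    refine Integrable.bdd_mul (c := 1) hf psm.aestronglyMeasurable (Eventually.of_forall fun x => ?_)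
    rw [Real.norm_eq_abs, abs_of_nonneg (ps_nonneg _)]; exact ps_le_one _
  have I1 : IntegrableOn (fun x => h τ x + er a μ k r τ x) (Ioc c d) :=
    (S.hi τ hτ).integrableOn.add ((er_cont S.ac hk hr).comp (Continuous.prodMk_right τ)).integrableOn_Ioc
  set G : ℝ → ℝ := fun x => μ * (deriv (deriv (u τ)) x - (deriv (deriv k) x + τ * deriv (deriv r) x)) -
    (a (u τ x) * deriv (u τ) x - a (k x + τ * r x) * (deriv k x + τ * deriv r x)) with hG
  have I2 : IntegrableOn G (Ioc c d) := by
    refine Continuous.integrableOn_Ioc ?_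
    have := cd_c1 hk; have := cd_c2 hk; have := cd_c1 hr; have := cd_c2 hr
    have := hk.continuous; have := hr.continuous; have := S.ac
    have := cd_c1 (S.u2 τ hτ); have := cd_c2 (S.u2 τ hτ); have := (S.u2 τ hτ).continuous
    fun_prop
  calc ∫ x in Ioc c d, ps (u τ x - (k x + τ * r x)) * (deriv (fun s => u s x) τ - r x)
      = ∫ x in Ioc c d, (ps (u τ x - (k x + τ * r x)) * (h τ x + er a μ k r τ x) + ps (u τ x - (k x + τ * r x)) * G x) := by
        congr 1; funext x
        rw [S.pde τ hτ x, hG]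
        simp only [er]
        ring
    _ = _ := integral_add (bdmul I1) (bdmul I2)
    _ ≤ (∫ x in Ioc c d, max (h τ x + er a μ k r τ x) 0) + 0 := by
        refine add_le_add ?_ K
        exact integral_mono (bdmul I1) I1.pos_part fun x => ps_mul_le _ _
    _ = _ := by rw [add_zero]; rfl

theorem main_gap {a : ℝ → ℝ} {μ : ℝ} {u h : ℝ → ℝ → ℝ} (S : LocSol a μ u h) {c d t1 t2 : ℝ} (hcd : c < d)
    (h1 : 0 < t1) {C : ℝ} (hC : 0 ≤ C) {T : Set ℝ} (hT : IsClosed T) (hsub : T ⊆ Icc t1 t2)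
    (m1 : t1 ∈ T) (m2 : t2 ∈ T)
    (hb : ∀ τ ∈ T, ∀ x ∈ Ioo c d, |u τ x| ≤ C ∧ |deriv (u τ) x| ≤ C ∧ |deriv (deriv (u τ)) x| ≤ C)
    (hg : ∀ α β, α ∈ T → β ∈ T → α < β → Ioo α β ∩ T = ∅ →
      KrOn a μ u h c d α β ∧ KrOn a μ (fun t x => -u t x) (fun t x => -h t x) c d α β) :
    KrOn a μ u h c d t1 t2 := by
  intro k r hk hr hbar
  have h12 : t1 ≤ t2 := (hsub m1).2
  have h2 : 0 < t2 := h1.trans_le h12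
  obtain ⟨L, b, Lc, hLb, Lpd, Lun⟩ := gaps hT hsub m1 m2
  obtain ⟨C', hC'0, hC'⟩ := gap_two S (t2 := t2) hcd h1 hC
  obtain ⟨H, hH0, hH⟩ := l1_bdd S.hi S.hc (t := t2) h1
  obtain ⟨R, hR⟩ := isCompact_Icc.exists_bound_of_continuousOn (hr.continuous.continuousOn (s := Icc c d))
  have hR0 : 0 ≤ R := (norm_nonneg _).trans (hR c ⟨le_rfl, hcd.le⟩)
  have hdc : 0 < d - c := by linarith
  have pos : ∀ τ ∈ Icc t1 t2, 0 < τ := fun τ hτ => h1.trans_le hτ.1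
  have : Countable L := Lc.to_subtype
  set w : ℝ → ℝ → ℝ := fun τ x => u τ x - (k x + τ * r x) with hw
  set w' : ℝ → ℝ → ℝ := fun τ x => deriv (fun s => u s x) τ - r x with hw'
  have hwd : ∀ τ, 0 < τ → ∀ x, HasDerivAt (fun σ => w σ x) (w' τ x) τ := fun τ hτ x => by
    have := (S.dt hτ x).sub (((hasDerivAt_id τ).mul_const (r x)).const_add (k x))
    refine HasDerivAt.congr_deriv this ?_
    simp [hw']
  have hwc : ∀ x, ContinuousOn (fun σ => w' σ x) (Ioi 0) := fun x => (S.dtc x).sub continuousOn_const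
  have hwx : ∀ τ, 0 < τ → Continuous (w τ) := fun τ hτ => by
    have := hk.continuous; have := hr.continuous; have := (S.u2 τ hτ).continuous
    simp only [hw]; fun_prop
  set v : ℝ → ℝ → ℝ := fun τ x => ps (w τ x) * w' τ x with hv
  -- time integrability of v
  have vI : ∀ x, ∀ s t, 0 < s → IntegrableOn (fun τ => v τ x) (Icc s t) := by
    intro x s t hs
    have c1 : ContinuousOn (fun σ => w σ x) (Icc s t) := fun σ hσ =>
      (hwd σ (hs.trans_le hσ.1) x).continuousAt.continuousWithinAt
    have c2 : ContinuousOn (fun σ => w' σ x) (Icc s t) := (hwc x).mono fun σ hσ => hs.trans_le hσ.1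
    refine Integrable.bdd_mul (c := 1) c2.integrableOn_Icc ?_ (Eventually.of_forall fun x => ?_)
    · exact (measurable_ps.comp_aemeasurable (c1.aemeasurable measurableSet_Icc)).aestronglyMeasurable
    · rw [Real.norm_eq_abs, abs_of_nonneg (ps_nonneg _)]; exact ps_le_one _
  have ftc : ∀ x, ∀ s t, 0 < s → s ≤ t → ∫ τ in Ioc s t, v τ x = max (w t x) 0 - max (w s x) 0 := by
    intro x s t hs hst
    rw [← intervalIntegral.integral_of_le hst]
    exact pos_ftc hst (fun τ hτ => hwd τ (hs.trans_le hτ.1) x) ((hwc x).mono fun σ hσ => hs.trans_le hσ.1)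
  -- gap increments
  set g : L → ℝ → ℝ := fun α x => max (w (b α) x) 0 - max (w α x) 0 with hgdef
  have Lpos : ∀ α : L, 0 < (α:ℝ) := fun α => pos _ (hsub (hLb α α.2).1)
  have bpos : ∀ α : L, 0 < b α := fun α => pos _ (hsub (hLb α α.2).2.1)
  have Ioosub : (⋃ α : L, Ioo (α:ℝ) (b α)) = Icc t1 t2 \ T := by rw [Lun, biUnion_eq_iUnion]
  have Lpd' : Pairwise (Function.onFun Disjoint fun α : L => Ioo (α:ℝ) (b α)) := by
    intro α β hne
    exact Lpd α.2 β.2 fun e => hne (Subtype.ext e)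
  have hsum : ∀ {F : ℝ → ℝ}, IntegrableOn F (Icc t1 t2) →
      HasSum (fun α : L => ∫ τ in Ioo (α:ℝ) (b α), F τ) (∫ τ in Icc t1 t2 \ T, F τ) := by
    intro F hF
    have := hasSum_integral_iUnion (f := F) (μ := volume) (fun α : L => measurableSet_Ioo (a := (α:ℝ)) (b := b α)) Lpd'
      (by rw [Ioosub]; exact hF.mono_set sdiff_subset)
    rwa [Ioosub] at this
  have len : Summable fun α : L => b α - (α:ℝ) := by
    have := (hsum (F := fun _ => (1:ℝ)) (by simp)).summable
    refine this.congr fun α => ?_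
    simp [(hLb α α.2).2.2.1.le]
  have gcont : ∀ α, Continuous (g α) := fun α =>
    ((hwx _ (bpos α)).max continuous_const).sub ((hwx _ (Lpos α)).max continuous_const)
  have gI : ∀ α, Integrable (g α) (volume.restrict (Ioc c d)) := fun α => (gcont α).integrableOn_Ioc
  have gbound : ∀ α, ∫ x in Ioc c d, ‖g α x‖ ≤ (C' + R * (d - c)) * (b α - α) := by
    intro α
    obtain ⟨l1, l2, l3, l4⟩ := hLb α α.2
    have ii := hC' α (b α) (hsub l1).1 l3.le (hsub l2).2 (hb α l1) (hg α (b α) l1 l2 l3 l4).1 (hg α (b α) l1 l2 l3 l4).2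
    have cu := (S.u2 _ (bpos α)).continuous
    have cu' := (S.u2 _ (Lpos α)).continuous
    have I1 : IntegrableOn (fun x => |u (b α) x - u α x|) (Ioc c d) := Continuous.integrableOn_Ioc (by fun_prop)
    have e5 : R * (d - c) * (b α - α) = ∫ x in Ioc c d, R * (b α - (α:ℝ)) := by
      simp [hcd.le]; ring
    calc ∫ x in Ioc c d, ‖g α x‖ ≤ ∫ x in Ioc c d, (|u (b α) x - u α x| + R * (b α - (α:ℝ))) := by
          refine setIntegral_mono_on (gI α).norm (I1.add (integrable_const _)) measurableSet_Ioc fun x hx => ?_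
          rw [Real.norm_eq_abs]
          refine (abs_max_sub_max_le_abs _ _ _).trans ?_
          have : w (b α) x - w α x = (u (b α) x - u α x) + -(r x * (b α - α)) := by simp only [hw]; ring
          rw [this]
          refine (abs_add_le _ _).trans (add_le_add le_rfl ?_)
          rw [abs_neg, abs_mul, abs_of_pos (by linarith : 0 < b α - (α:ℝ))]
          exact mul_le_mul_of_nonneg_right (hR x ⟨hx.1.le, hx.2⟩) (by linarith)
      _ = (∫ x in Ioc c d, |u (b α) x - u α x|) + R * (d - c) * (b α - α) := by
          rw [integral_add I1 (integrable_const _), e5]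
      _ ≤ _ := by nlinarith
  have gsumm : Summable fun α => ∫ x in Ioc c d, ‖g α x‖ :=
    Summable.of_nonneg_of_le (fun α => integral_nonneg fun x => norm_nonneg _) gbound (len.mul_left _)
  have gHS := hasSum_integral_of_summable_integral_norm gI gsumm
  have gpt : ∀ x, HasSum (fun α => g α x) (∫ τ in Icc t1 t2 \ T, v τ x) := by
    intro x
    refine (hsum (vI x t1 t2 h1)).congr_fun ?_ |> id
    intro α
    simp only [hgdef]
    rw [← integral_Ioc_eq_integral_Ioo, ftc x α (b α) (Lpos α) (hLb α α.2).2.2.1.le]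
  have tsumI : ∀ x, ∑' α, g α x = ∫ τ in Icc t1 t2 \ T, v τ x := fun x => (gpt x).tsum_eq
  -- Fubini on T × K
  set V : ℝ → ℝ → ℝ := fun τ x => ps (u (max τ t1) x - (k x + τ * r x)) * (deriv (fun s => u s x) (max τ t1) - r x) with hV
  have VT : ∀ τ ∈ T, ∀ x, V τ x = v τ x := by
    intro τ hτ x
    simp only [hV, hv, hw, hw', max_eq_left (hsub hτ).1]
  have Vm : Measurable (Function.uncurry V) := by
    obtain ⟨q1, q2⟩ := S.meas2 h1
    have q3 : Measurable fun p : ℝ × ℝ => k p.2 + p.1 * r p.2 := by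
      have := hk.continuous; have := hr.continuous
      exact Continuous.measurable (by fun_prop)
    have q4 : Measurable fun p : ℝ × ℝ => r p.2 := (hr.continuous.comp continuous_snd).measurable
    exact (measurable_ps.comp (q1.sub q3)).mul (q2.sub q4)
  obtain ⟨A, hA⟩ := isCompact_Icc.exists_bound_of_continuousOn (S.ac.continuousOn (s := Icc (-C) C))
  have hA0 : 0 ≤ A := (norm_nonneg _).trans (hA C ⟨by linarith, le_rfl⟩)
  have μp := S.μp
  have vslice : ∀ τ ∈ T, IntegrableOn (v τ) (Ioc c d) ∧ ∫ x in Ioc c d, ‖v τ x‖ ≤ H + (μ * C + A * C + R) * (d - c) := by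
    intro τ hτT
    have τ0 := pos τ (hsub hτT)
    have I0 : IntegrableOn (fun x => w' τ x) (Ioc c d) := by
      have : (fun x => w' τ x) = fun x => h τ x + (μ * deriv (deriv (u τ)) x - a (u τ x) * deriv (u τ) x - r x) := by
        funext x; simp only [hw']; rw [S.pde τ τ0 x]; ring
      rw [this]
      refine (S.hi τ τ0).integrableOn.add (Continuous.integrableOn_Ioc ?_)
      have := hr.continuous; have := S.ac
      have := cd_c1 (S.u2 τ τ0); have := cd_c2 (S.u2 τ τ0); have := (S.u2 τ τ0).continuous
      fun_prop
    have I1 : IntegrableOn (v τ) (Ioc c d) := by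
      refine Integrable.bdd_mul (c := 1) I0 (measurable_ps.comp (hwx τ τ0).measurable).aestronglyMeasurable (Eventually.of_forall fun x => ?_)
      rw [Real.norm_eq_abs, abs_of_nonneg (ps_nonneg _)]; exact ps_le_one _
    refine ⟨I1, ?_⟩
    have e5 : (μ * C + A * C + R) * (d - c) = ∫ x in Ioc c d, (μ * C + A * C + R) := by
      simp [hcd.le]; ring
    calc ∫ x in Ioc c d, ‖v τ x‖ ≤ ∫ x in Ioc c d, (|h τ x| + (μ * C + A * C + R)) := by
          rw [integral_Ioc_eq_integral_Ioo, integral_Ioc_eq_integral_Ioo]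
          refine setIntegral_mono_on ((I1.mono_set Ioo_subset_Ioc_self).norm)
            (((S.hi τ τ0).abs.integrableOn).add (by simp)) measurableSet_Ioo fun x hx => ?_
          obtain ⟨b1, b2, b3⟩ := hb τ hτT x hx
          have B1 : |a (u τ x)| ≤ A := hA _ (by rw [mem_Icc, ← abs_le]; exact b1)
          have B2 : |a (u τ x) * deriv (u τ) x| ≤ A * C := by
            rw [abs_mul]; exact mul_le_mul B1 b2 (abs_nonneg _) hA0
          have B3 : |μ * deriv (deriv (u τ)) x| ≤ μ * C := by
            rw [abs_mul, abs_of_pos μp]; exact mul_le_mul_of_nonneg_left b3 μp.le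
          have B4 : |r x| ≤ R := hR x ⟨hx.1.le, hx.2.le⟩
          simp only [hv]
          rw [norm_mul, Real.norm_eq_abs, Real.norm_eq_abs, abs_of_nonneg (ps_nonneg _)]
          refine (mul_le_of_le_one_left (abs_nonneg _) (ps_le_one _)).trans ?_
          simp only [hw']
          rw [S.pde τ τ0 x]
          rw [abs_le] at *
          constructor <;> linarith [neg_abs_le (h τ x), le_abs_self (h τ x), B2.1, B2.2, B3.1, B3.2, B4.1, B4.2]
      _ = (∫ x in Ioc c d, |h τ x|) + (μ * C + A * C + R) * (d - c) := by
          rw [integral_add (S.hi τ τ0).abs.integrableOn (by simp), e5]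
      _ ≤ _ := add_le_add ((setIntegral_le_integral (S.hi τ τ0).abs (Eventually.of_forall fun x => abs_nonneg _)).trans
          (hH τ (hsub hτT))) le_rfl
  have Tfin : volume T < ∞ := (measure_mono hsub).trans_lt (by simp)
  have : IsFiniteMeasure (volume.restrict T) := ⟨by simpa using Tfin⟩
  have TM : MeasurableSet T := hT.measurableSet
  have VI : Integrable (Function.uncurry V) ((volume.restrict T).prod (volume.restrict (Ioc c d))) := by
    rw [integrable_prod_iff Vm.aestronglyMeasurable]
    constructor
    · filter_upwards [ae_restrict_mem TM] with τ hτ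
      have : (fun x => Function.uncurry V (τ, x)) = v τ := by funext x; exact VT τ hτ x
      rw [this]; exact (vslice τ hτ).1
    · refine Measure.integrableOn_of_bounded (s_finite := Tfin.ne) (M := H + (μ * C + A * C + R) * (d - c)) ?_ ?_
      · exact (Vm.norm.aestronglyMeasurable (μ := (volume : Measure ℝ).prod (volume.restrict (Ioc c d)))).integral_prod_right'
      · filter_upwards [ae_restrict_mem TM] with τ hτ
        rw [Real.norm_eq_abs, abs_of_nonneg (integral_nonneg fun x => norm_nonneg _)]
        have : (fun x => ‖Function.uncurry V (τ, x)‖) = fun x => ‖v τ x‖ := by funext x; rw [← VT τ hτ x]; rfl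
        rw [this]; exact (vslice τ hτ).2
  have fub : ∫ x in Ioc c d, ∫ τ in T, v τ x ≤ ∫ τ in T, mB a μ h c d k r τ := by
    have e1 : ∀ x, ∫ τ in T, v τ x = ∫ τ in T, V τ x := fun x =>
      setIntegral_congr_fun TM fun τ hτ => (VT τ hτ x).symm
    simp only [e1]
    rw [← integral_integral_swap VI]
    refine setIntegral_mono_on VI.integral_prod_left ?_ TM fun τ hτ => ?_
    · refine IntegrableOn.mono_set (t := Icc t1 t2) ?_ hsub
      exact ((mB_cont S c d hk hr).mono fun τ hτ => pos τ hτ).integrableOn_Icc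
    · have : ∀ x, V τ x = v τ x := VT τ hτ
      simp only [this]
      exact slice S hcd (pos τ (hsub hτ)) hk hr (hbar τ (hsub hτ)).1 (hbar τ (hsub hτ)).2
  have ITv : Integrable (fun x => ∫ τ in T, v τ x) (volume.restrict (Ioc c d)) := by
    have e1 : ∀ x, ∫ τ in T, v τ x = ∫ τ in T, V τ x := fun x =>
      setIntegral_congr_fun TM fun τ hτ => (VT τ hτ x).symm
    simp only [e1]
    exact VI.integral_prod_right
  have split : ∀ x, max (w t2 x) 0 - max (w t1 x) 0 = (∫ τ in T, v τ x) + ∫ τ in Icc t1 t2 \ T, v τ x := by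
    intro x
    rw [← ftc x t1 t2 h1 h12, ← integral_Icc_eq_integral_Ioc]
    have := integral_inter_add_sdiff (s := Icc t1 t2) TM (vI x t1 t2 h1)
    rw [← this, inter_eq_self_of_subset_right hsub]
  have wI : ∀ τ, 0 < τ → Integrable (fun x => max (w τ x) 0) (volume.restrict (Ioc c d)) := fun τ hτ =>
    ((hwx τ hτ).max continuous_const).integrableOn_Ioc
  have PhE : ∀ τ, PhB u c d k r τ = ∫ x in Ioc c d, max (w τ x) 0 := fun τ => by
    unfold PhB; simp only [hw, sub_eq_add_neg]
  have IG : Integrable (fun x => ∫ τ in Icc t1 t2 \ T, v τ x) (volume.restrict (Ioc c d)) := by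
    have : (fun x => ∫ τ in Icc t1 t2 \ T, v τ x) = fun x => (max (w t2 x) 0 - max (w t1 x) 0) - ∫ τ in T, v τ x := by
      funext x; rw [split x]; ring
    rw [this]
    exact ((wI t2 h2).sub (wI t1 h1)).sub ITv
  have gle : ∀ α : L, ∫ x in Ioc c d, g α x ≤ ∫ τ in Ioo (α:ℝ) (b α), mB a μ h c d k r τ := by
    intro α
    obtain ⟨l1, l2, l3, l4⟩ := hLb α α.2
    have := (hg α (b α) l1 l2 l3 l4).1 k r hk hr fun τ hτ => hbar τ ⟨(hsub l1).1.trans hτ.1, hτ.2.trans (hsub l2).2⟩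
    rw [PhE, PhE, ← integral_sub (wI _ (bpos α)) (wI _ (Lpos α)), intervalIntegral.integral_of_le l3.le,
      integral_Ioc_eq_integral_Ioo (f := mB a μ h c d k r)] at this
    exact this
  have mI : IntegrableOn (mB a μ h c d k r) (Icc t1 t2) :=
    ((mB_cont S c d hk hr).mono fun τ hτ => pos τ hτ).integrableOn_Icc
  have sle := hasSum_le gle gHS (hsum mI)
  simp only [tsumI] at sle
  rw [PhE, PhE, ← integral_sub (wI t2 h2) (wI t1 h1)]
  simp only [split]
  rw [integral_add ITv IG, intervalIntegral.integral_of_le h12,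
    ← integral_Icc_eq_integral_Ioc (f := mB a μ h c d k r), ← integral_inter_add_sdiff (s := Icc t1 t2) TM mI, inter_eq_self_of_subset_right hsub]
  exact add_le_add fub sle
end Aux

namespace Aux
open Set Topology

def An (u : ℝ → ℝ → ℝ) (c d n τ : ℝ) : Prop :=
  ∀ x ∈ Icc c d, ∀ y ∈ Icc c d,
    (u τ x ≤ n ∧ -u τ x ≤ n) ∧
    (x ≤ y → n * x + u τ x ≤ n * y + u τ y ∧ n * x + -u τ x ≤ n * y + -u τ y) ∧
    (∀ α β : ℝ, 0 ≤ α → 0 ≤ β → α + β = 1 →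
      n * (α * x + β * y)^2 + u τ (α * x + β * y) ≤ α * (n * x^2 + u τ x) + β * (n * y^2 + u τ y) ∧
      n * (α * x + β * y)^2 + -u τ (α * x + β * y) ≤ α * (n * x^2 + -u τ x) + β * (n * y^2 + -u τ y))

lemma mono_deriv_nonneg {f : ℝ → ℝ} {c d x f' : ℝ} (hf : MonotoneOn f (Ioo c d)) (hx : x ∈ Ioo c d)
    (hd : HasDerivAt f f' x) : 0 ≤ f' := by
  have h1 := hd.tendsto_slope
  have h2 : Tendsto (slope f x) (𝓝[>] x) (𝓝 f') := h1.mono_left (nhdsWithin_mono x fun y hy => ne_of_gt hy)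
  refine ge_of_tendsto h2 ?_
  filter_upwards [Ioo_mem_nhdsGT hx.2] with y hy
  rw [slope_def_field]
  have := hf hx ⟨hx.1.trans hy.1, hy.2⟩ hy.1.le
  exact div_nonneg (by linarith) (by linarith [hy.1])

lemma An_bound {u : ℝ → ℝ → ℝ} {c d n τ : ℝ} (hu : ContDiff ℝ 2 (u τ)) (hA : An u c d n τ) :
    ∀ x ∈ Ioo c d, |u τ x| ≤ 2 * n ∧ |deriv (u τ) x| ≤ 2 * n ∧ |deriv (deriv (u τ)) x| ≤ 2 * n := by
  have aux : ∀ v : ℝ → ℝ, ContDiff ℝ 2 v →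
     (∀ x ∈ Icc c d, ∀ y ∈ Icc c d, x ≤ y → n * x + v x ≤ n * y + v y) →
     (∀ x ∈ Icc c d, ∀ y ∈ Icc c d, ∀ α β : ℝ, 0 ≤ α → 0 ≤ β → α + β = 1 →
      n * (α * x + β * y)^2 + v (α * x + β * y) ≤ α * (n * x^2 + v x) + β * (n * y^2 + v y)) →
      ∀ x ∈ Ioo c d, 0 ≤ n + deriv v x ∧ 0 ≤ 2 * n + deriv (deriv v) x := by
    intro v hv hm hcx x hx
    constructor
    · refine mono_deriv_nonneg (f := fun x => n * x + v x) (c := c) (d := d) ?_ hx ?_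
      · intro y hy z hz hyz
        exact hm y (Ioo_subset_Icc_self hy) z (Ioo_subset_Icc_self hz) hyz
      · simpa using ((hasDerivAt_id' x).const_mul n).fun_add (cd_d0 hv x)
    · have d1 : ∀ y, HasDerivAt (fun y => n * y^2 + v y) (2 * n * y + deriv v y) y := fun y => by
        refine (((hasDerivAt_pow 2 y).const_mul n).add (cd_d0 hv y)).congr_deriv ?_
        simp; ring
      have conv : ConvexOn ℝ (Ioo c d) (fun y => n * y^2 + v y) := by
        refine ⟨convex_Ioo c d, fun y hy z hz α β hα hβ hab => ?_⟩
        simpa using hcx y (Ioo_subset_Icc_self hy) z (Ioo_subset_Icc_self hz) α β hα hβ hab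
      have mono := conv.monotoneOn_deriv fun y _ => (d1 y).differentiableAt
      have e : deriv (fun y => n * y^2 + v y) = fun y => 2 * n * y + deriv v y := funext fun y => (d1 y).deriv
      rw [e] at mono
      refine mono_deriv_nonneg mono hx ?_
      simpa using ((hasDerivAt_id' x).const_mul (2 * n)).fun_add (cd_d1 hv x)
  intro x hx
  have hx' := Ioo_subset_Icc_self hx
  obtain ⟨⟨b1, b2⟩, _⟩ := hA x hx' x hx'
  obtain ⟨p1, p2⟩ := aux (u τ) hu (fun x hx y hy hxy => ((hA x hx y hy).2.1 hxy).1)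
    (fun x hx y hy α β h1 h2 h3 => ((hA x hx y hy).2.2 α β h1 h2 h3).1) x hx
  obtain ⟨q1, q2⟩ := aux (fun x => -u τ x) hu.neg (fun x hx y hy hxy => ((hA x hx y hy).2.1 hxy).2)
    (fun x hx y hy α β h1 h2 h3 => ((hA x hx y hy).2.2 α β h1 h2 h3).2) x hx
  have s1 : deriv (fun x => -u τ x) = fun x => -deriv (u τ) x := by
    funext y; exact deriv.fun_neg
  have s3 : deriv (fun x => -deriv (u τ) x) x = -deriv (deriv (u τ)) x := deriv.fun_neg
  rw [s1] at q1 q2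
  rw [s3] at q2
  simp only at q1
  refine ⟨?_, ?_, ?_⟩ <;> rw [abs_le] <;> constructor <;> linarith

lemma An_exists {u : ℝ → ℝ → ℝ} {τ : ℝ} (c d : ℝ) (hu : ContDiff ℝ 2 (u τ)) : ∃ n : ℕ, An u c d n τ := by
  obtain ⟨M0, hM0⟩ := isCompact_Icc.exists_bound_of_continuousOn (hu.continuous.continuousOn (s := Icc c d))
  obtain ⟨M1, hM1⟩ := isCompact_Icc.exists_bound_of_continuousOn ((cd_c1 hu).continuousOn (s := Icc c d))
  obtain ⟨M2, hM2⟩ := isCompact_Icc.exists_bound_of_continuousOn ((cd_c2 hu).continuousOn (s := Icc c d))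
  obtain ⟨n, hn⟩ := exists_nat_ge (max M0 (max M1 M2))
  have n0 := (le_max_left _ _).trans hn
  have n1 := ((le_max_left _ _).trans (le_max_right _ _)).trans hn
  have n2 := ((le_max_right _ _).trans (le_max_right _ _)).trans hn
  have nn : (0:ℝ) ≤ n := Nat.cast_nonneg n
  have aux : ∀ v : ℝ → ℝ, ContDiff ℝ 2 v → (∀ x ∈ Icc c d, 0 ≤ n + deriv v x) → (∀ x ∈ Icc c d, 0 ≤ n + deriv (deriv v) x) →
     (∀ x ∈ Icc c d, ∀ y ∈ Icc c d, x ≤ y → n * x + v x ≤ n * y + v y) ∧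
     (∀ x ∈ Icc c d, ∀ y ∈ Icc c d, ∀ α β : ℝ, 0 ≤ α → 0 ≤ β → α + β = 1 →
      n * (α * x + β * y)^2 + v (α * x + β * y) ≤ α * (n * x^2 + v x) + β * (n * y^2 + v y)) := by
    intro v hv hd1 hd2
    have e1 : ∀ x, HasDerivAt (fun x => n * x + v x) (n + deriv v x) x := fun x => by
      simpa using ((hasDerivAt_id' x).const_mul (n:ℝ)).fun_add (cd_d0 hv x)
    have d1 : ∀ y, HasDerivAt (fun y => n * y^2 + v y) (2 * n * y + deriv v y) y := fun y => by
      refine (((hasDerivAt_pow 2 y).const_mul (n:ℝ)).add (cd_d0 hv y)).congr_deriv ?_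
      simp; ring
    have d2 : ∀ y, HasDerivAt (fun y => 2 * n * y + deriv v y) (2 * n + deriv (deriv v) y) y := fun y => by
      simpa using ((hasDerivAt_id' y).const_mul (2 * (n:ℝ))).fun_add (cd_d1 hv y)
    constructor
    · intro x hx y hy hxy
      refine monotoneOn_of_deriv_nonneg (convex_Icc c d) (f := fun x => n * x + v x)
        (fun x _ => (e1 x).continuousAt.continuousWithinAt) (fun x _ => (e1 x).differentiableAt.differentiableWithinAt)
        (fun x hx => ?_) hx hy hxy
      rw [(e1 x).deriv]
      exact hd1 x (interior_subset hx)
    · have ed : deriv (fun y => n * y^2 + v y) = fun y => 2 * n * y + deriv v y := funext fun y => (d1 y).deriv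
      have conv : ConvexOn ℝ (Icc c d) (fun y => n * y^2 + v y) := by
        refine convexOn_of_deriv2_nonneg (convex_Icc c d) (fun x _ => (d1 x).continuousAt.continuousWithinAt)
          (fun x _ => (d1 x).differentiableAt.differentiableWithinAt) ?_ ?_
        · rw [ed]; exact fun x _ => (d2 x).differentiableAt.differentiableWithinAt
        · intro x hx
          simp only [Function.iterate_succ, Function.iterate_zero, Function.comp_apply, id]
          rw [ed, (d2 x).deriv]
          have := hd2 x (interior_subset hx)
          linarith
      intro x hx y hy α β h1 h2 h3
      simpa using conv.2 hx hy h1 h2 h3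
  have s1 : deriv (fun x => -u τ x) = fun x => -deriv (u τ) x := by
    funext y; exact deriv.fun_neg
  have s3 : deriv (fun x => -deriv (u τ) x) = fun x => -deriv (deriv (u τ)) x := by
    funext y; exact deriv.fun_neg
  obtain ⟨p1, p2⟩ := aux (u τ) hu (fun x hx => by linarith [(abs_le.mp ((hM1 x hx).trans n1)).1])
    (fun x hx => by linarith [(abs_le.mp ((hM2 x hx).trans n2)).1])
  obtain ⟨q1, q2⟩ := aux (fun x => -u τ x) hu.neg
    (fun x hx => by rw [s1]; linarith [(abs_le.mp ((hM1 x hx).trans n1)).2])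
    (fun x hx => by rw [s1, s3]; linarith [(abs_le.mp ((hM2 x hx).trans n2)).2])
  refine ⟨n, fun x hx y hy => ⟨?_, fun hxy => ⟨p1 x hx y hy hxy, q1 x hx y hy hxy⟩,
    fun α β h1 h2 h3 => ⟨p2 x hx y hy α β h1 h2 h3, q2 x hx y hy α β h1 h2 h3⟩⟩⟩
  have := abs_le.mp ((hM0 x hx).trans n0)
  constructor <;> linarith [this.1, this.2]

theorem Kr {a : ℝ → ℝ} {μ : ℝ} {u h : ℝ → ℝ → ℝ} (S : LocSol a μ u h) {c d s t : ℝ} (hcd : c < d)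
    (hs : 0 < s) (hst : s ≤ t) :
    KrOn a μ u h c d s t ∧ KrOn a μ (fun t x => -u t x) (fun t x => -h t x) c d s t := by
  set KK : ℝ → ℝ → Prop := fun s t => KrOn a μ u h c d s t ∧
    KrOn a μ (fun t x => -u t x) (fun t x => -h t x) c d s t with hKK
  set Good : ℝ → Prop := fun τ => ∃ δ > 0, ∀ s' t', s ≤ s' → s' ≤ t' → t' ≤ t → |s' - τ| < δ → |t' - τ| < δ → KK s' t'
    with hGood
  have fromGood : ∀ s' t', s ≤ s' → s' ≤ t' → t' ≤ t → (∀ τ ∈ Icc s' t', Good τ) → KK s' t' := by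
    intro s' t' h1 h2 h3 hG
    constructor
    · refine KrOn.of_local S (hs.trans_le h1) h2 fun τ hτ => ?_
      obtain ⟨δ, hδ, hh⟩ := hG τ hτ
      exact ⟨δ, hδ, fun s'' t'' g1 g2 g3 g4 g5 => (hh s'' t'' (h1.trans g1) g2 (g3.trans h3) g4 g5).1⟩
    · refine KrOn.of_local S.neg (hs.trans_le h1) h2 fun τ hτ => ?_
      obtain ⟨δ, hδ, hh⟩ := hG τ hτ
      exact ⟨δ, hδ, fun s'' t'' g1 g2 g3 g4 g5 => (hh s'' t'' (h1.trans g1) g2 (g3.trans h3) g4 g5).2⟩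
  have fromGoodIoo : ∀ s' t', s ≤ s' → s' < t' → t' ≤ t → (∀ τ ∈ Ioo s' t', Good τ) → KK s' t' := by
    intro s' t' h1 h2 h3 hG
    have : ∀ s'' t'', s' < s'' → s'' ≤ t'' → t'' < t' → KK s'' t'' := fun s'' t'' g1 g2 g3 =>
      fromGood s'' t'' (h1.trans g1.le) g2 (g3.le.trans h3) fun τ hτ => hG τ ⟨g1.trans_le hτ.1, hτ.2.trans_lt g3⟩
    exact ⟨KrOn.of_open S (hs.trans_le h1) h2 fun s'' t'' g1 g2 g3 => (this s'' t'' g1 g2 g3).1,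
      KrOn.of_open S.neg (hs.trans_le h1) h2 fun s'' t'' g1 g2 g3 => (this s'' t'' g1 g2 g3).2⟩
  set T : Set ℝ := {τ | τ ∈ Icc s t ∧ ¬ Good τ} with hT
  have Topen : IsOpen {τ | Good τ} := by
    rw [Metric.isOpen_iff]
    rintro τ ⟨δ, hδ, hh⟩
    refine ⟨δ/2, by positivity, fun σ hσ => ⟨δ/2, by positivity, fun s' t' h1 h2 h3 h4 h5 => ?_⟩⟩
    rw [Metric.mem_ball, Real.dist_eq] at hσ
    refine hh s' t' h1 h2 h3 ?_ ?_
    · calc |s' - τ| = |(s' - σ) + (σ - τ)| := by ring_nf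
        _ ≤ _ := abs_add_le _ _
        _ < δ := by linarith
    · calc |t' - τ| = |(t' - σ) + (σ - τ)| := by ring_nf
        _ ≤ _ := abs_add_le _ _
        _ < δ := by linarith
  have Tcl : IsClosed T := isClosed_Icc.inter Topen.isClosed_compl
  refine fromGood s t le_rfl hst le_rfl ?_
  by_contra hcon
  push Not at hcon
  obtain ⟨τ0, hτ0, hbad⟩ := hcon
  have Tne : Nonempty T := ⟨⟨τ0, hτ0, hbad⟩⟩
  have : CompleteSpace T := Tcl.completeSpace_coe
  have Tpos : ∀ τ : T, 0 < (τ:ℝ) := fun τ => hs.trans_le τ.2.1.1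
  have ucont : ∀ x, Continuous fun τ : T => u τ x := fun x =>
    (S.u1 x).continuousOn.comp_continuous continuous_subtype_val Tpos
  obtain ⟨n, hn⟩ := nonempty_interior_of_iUnion_of_closed (X := T) (f := fun n : ℕ => {τ : T | An u c d n τ}) (by
      intro n
      simp only [An, ofPred_forall, ofPred_and]
      refine isClosed_iInter fun x => isClosed_iInter fun _ => isClosed_iInter fun y => isClosed_iInter fun _ => ?_
      refine IsClosed.inter (IsClosed.inter ?_ ?_) (IsClosed.inter ?_ ?_)
      · exact isClosed_le (ucont x) continuous_const
      · exact isClosed_le (ucont x).neg continuous_const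
      · refine isClosed_iInter fun _ => IsClosed.inter ?_ ?_
        · exact isClosed_le (continuous_const.add (ucont x)) (continuous_const.add (ucont y))
        · exact isClosed_le (continuous_const.add (ucont x).neg) (continuous_const.add (ucont y).neg)
      · refine isClosed_iInter fun α => isClosed_iInter fun β => isClosed_iInter fun _ => isClosed_iInter fun _ =>
          isClosed_iInter fun _ => IsClosed.inter ?_ ?_
        · exact isClosed_le (continuous_const.add (ucont _)) ((continuous_const.mul (continuous_const.add (ucont x))).add (continuous_const.mul (continuous_const.add (ucont y))))
        · exact isClosed_le (continuous_const.add (ucont _).neg) ((continuous_const.mul (continuous_const.add (ucont x).neg)).add (continuous_const.mul (continuous_const.add (ucont y).neg)))) (by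
      ext τ
      simp only [mem_iUnion, mem_univ, iff_true]
      exact An_exists c d (S.u2 τ (Tpos τ)))
  obtain ⟨τs, hτs⟩ := hn
  rw [mem_interior_iff_mem_nhds, Metric.mem_nhds_iff] at hτs
  obtain ⟨δ, hδ, hball⟩ := hτs
  have hAn : ∀ τ ∈ T, |τ - τs| < δ → An u c d n τ := fun τ hτ hd =>
    hball (show (⟨τ, hτ⟩ : T) ∈ Metric.ball τs δ from by rw [Metric.mem_ball, Subtype.dist_eq, Real.dist_eq]; exact hd)
  refine τs.2.2 ⟨δ, hδ, fun t1 t2 g1 g2 g3 g4 g5 => ?_⟩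
  have p1 : 0 < t1 := hs.trans_le g1
  have p2 : 0 < t2 := p1.trans_le g2
  obtain ⟨n1, hn1⟩ := An_exists c d (S.u2 t1 p1)
  obtain ⟨n2, hn2⟩ := An_exists c d (S.u2 t2 p2)
  set C : ℝ := 2 * n + 2 * n1 + 2 * n2 with hC
  have hC0 : 0 ≤ C := by positivity
  set T' : Set ℝ := (T ∩ Icc t1 t2) ∪ {t1, t2} with hT'
  have T'cl : IsClosed T' := (Tcl.inter isClosed_Icc).union (by simp)
  have T'sub : T' ⊆ Icc t1 t2 := by
    rintro τ (hτ | hτ | hτ)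
    · exact hτ.2
    · rw [hτ]; exact ⟨le_rfl, g2⟩
    · rw [hτ]; exact ⟨g2, le_rfl⟩
  have bnd : ∀ τ ∈ T', ∀ x ∈ Ioo c d, |u τ x| ≤ C ∧ |deriv (u τ) x| ≤ C ∧ |deriv (deriv (u τ)) x| ≤ C := by
    intro τ hτ x hx
    have nn : (0:ℝ) ≤ n := Nat.cast_nonneg n
    have nn1 : (0:ℝ) ≤ n1 := Nat.cast_nonneg n1
    have nn2 : (0:ℝ) ≤ n2 := Nat.cast_nonneg n2
    have τ0 : 0 < τ := p1.trans_le (T'sub hτ).1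
    have key : ∃ m : ℕ, 2 * (m:ℝ) ≤ C ∧ An u c d m τ := by
      rcases hτ with hτ | hτ | hτ
      · refine ⟨n, by linarith, hAn τ hτ.1 ?_⟩
        rw [abs_lt] at *
        constructor
        · linarith [hτ.2.1, g4.1]
        · linarith [hτ.2.2, g5.2]
      · rw [hτ]; exact ⟨n1, by linarith, hn1⟩
      · rw [hτ]; exact ⟨n2, by linarith, hn2⟩
    obtain ⟨m, hm, hAm⟩ := key
    obtain ⟨b1, b2, b3⟩ := An_bound (S.u2 τ τ0) hAm x hx
    exact ⟨b1.trans hm, b2.trans hm, b3.trans hm⟩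
  have gap : ∀ α β, α ∈ T' → β ∈ T' → α < β → Ioo α β ∩ T' = ∅ → KK α β := by
    intro α β hα hβ hαβ hemp
    refine fromGoodIoo α β (g1.trans (T'sub hα).1) hαβ ((T'sub hβ).2.trans g3) fun τ hτ => ?_
    by_contra hng
    have hτI : τ ∈ Icc t1 t2 := ⟨(T'sub hα).1.trans hτ.1.le, hτ.2.le.trans (T'sub hβ).2⟩
    have : τ ∈ Ioo α β ∩ T' := ⟨hτ, Or.inl ⟨⟨⟨g1.trans hτI.1, hτI.2.trans g3⟩, hng⟩, hτI⟩⟩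
    rw [hemp] at this
    exact this
  have mm1 : t1 ∈ T' := Or.inr (Or.inl rfl)
  have mm2 : t2 ∈ T' := Or.inr (Or.inr rfl)
  refine ⟨main_gap S hcd p1 hC0 T'cl T'sub mm1 mm2 bnd gap, ?_⟩
  refine main_gap S.neg hcd p1 hC0 T'cl T'sub mm1 mm2 (fun τ hτ x hx => ?_) fun α β hα hβ hαβ hemp => ?_
  · have q1 : deriv (fun x => -u τ x) = fun x => -deriv (u τ) x := by
      funext y; exact deriv.fun_neg
    have q3 : deriv (fun x => -deriv (u τ) x) x = -deriv (deriv (u τ)) x := deriv.fun_neg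
    simpa only [q1, q3, abs_neg] using bnd τ hτ x hx
  · obtain ⟨k1, k2⟩ := gap α β hα hβ hαβ hemp
    refine ⟨k2, ?_⟩
    simpa only [neg_neg] using k1
end Aux

namespace Aux
open Set Topology

lemma bump_small {c d : ℝ} (hcd : c < d) : Tendsto (fun n : ℕ => ∫ x in Ioc c d, ((2*x-c-d)/(d-c))^(2*n)) atTop (𝓝 0) := by
  have hd : 0 < d - c := sub_pos.2 hcd
  have : (0:ℝ) = ∫ x in Ioc c d, (0:ℝ) := by simp
  rw [this]
  refine tendsto_integral_of_dominated_convergence (fun _ => (1:ℝ)) ?_ ?_ ?_ ?_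
  · intro n; exact Continuous.aestronglyMeasurable (by fun_prop)
  · exact integrable_const _
  · intro n
    filter_upwards [ae_restrict_mem measurableSet_Ioc] with x hx
    rw [norm_pow, Real.norm_eq_abs]
    refine pow_le_one₀ (abs_nonneg _) ?_
    rw [abs_le, div_le_iff₀ hd, le_div_iff₀ hd]
    constructor <;> linarith [hx.1, hx.2]
  · have h2 : ∀ᵐ x ∂(volume : Measure ℝ), x ≠ d := by simp [ae_iff, measure_singleton]
    filter_upwards [ae_restrict_mem measurableSet_Ioc, ae_restrict_of_ae h2] with x hx hxd
    have hx2 : x < d := lt_of_le_of_ne hx.2 hxd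
    have : |(2*x-c-d)/(d-c)| < 1 := by
      rw [abs_lt, div_lt_iff₀ hd, lt_div_iff₀ hd]
      constructor <;> linarith [hx.1]
    have h3 := tendsto_pow_atTop_nhds_zero_of_abs_lt_one this
    exact h3.comp (tendsto_atTop_mono (fun n : ℕ => (by simp; omega : id n ≤ 2*n)) tendsto_id)

lemma approx_r {c d : ℝ} (hcd : c < d) {f : ℝ → ℝ} (hf : IntegrableOn f (Ioc c d)) (M : ℝ) {ε : ℝ} (hε : 0 < ε) :
    ∃ r : ℝ → ℝ, ContDiff ℝ 2 r ∧ M < r c ∧ M < r d ∧ ∫ x in Ioc c d, |f x - r x| ≤ ε := by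
  have hd : 0 < d - c := sub_pos.2 hcd
  obtain ⟨g, -, hg, gc, gi⟩ := Integrable.exists_hasCompactSupport_integral_sub_le hf (ε := ε/3) (by positivity)
  obtain ⟨P, hP⟩ := exists_polynomial_near_of_continuousOn c d g gc.continuousOn (ε/(3*(d-c))) (by positivity)
  set Q := max (M - P.eval c) (M - P.eval d) with hQ
  set B := max Q 0 + 1 with hB
  have Bp : 0 < B := by positivity
  have hs := bump_small hcd
  obtain ⟨n, hn⟩ := (hs.eventually (gt_mem_nhds (show (0:ℝ) < ε/(3*B) by positivity))).exists
  have pc : Continuous fun x => P.eval x := P.continuous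
  have bc : Continuous fun x : ℝ => ((2*x-c-d)/(d-c))^(2*n) := by fun_prop
  refine ⟨fun x => P.eval x + B * ((2*x-c-d)/(d-c))^(2*n), ?_, ?_, ?_, ?_⟩
  · refine ContDiff.add ?_ (by fun_prop)
    simpa using P.contDiff_aeval (𝕜 := ℝ) (n := 2)
  · have : (2*c-c-d)/(d-c) = -1 := by field_simp; ring
    simp only [this]; rw [pow_mul]; norm_num
    have := le_max_left (M - P.eval c) (M - P.eval d)
    have := le_max_left Q 0
    linarith
  · have : (2*d-c-d)/(d-c) = 1 := by field_simp; ring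
    simp only [this]; norm_num
    have := le_max_right (M - P.eval c) (M - P.eval d)
    have := le_max_left Q 0
    linarith
  · have i1 : IntegrableOn (fun x => |f x - g x|) (Ioc c d) := (hf.sub gi).abs
    have i2 : IntegrableOn (fun x : ℝ => ((2*x-c-d)/(d-c))^(2*n)) (Ioc c d) := bc.integrableOn_Ioc
    have i3 : IntegrableOn (fun _ : ℝ => ε/(3*(d-c))) (Ioc c d) := integrable_const _
    calc ∫ x in Ioc c d, |f x - (P.eval x + B * ((2*x-c-d)/(d-c))^(2*n))|
        ≤ ∫ x in Ioc c d, (|f x - g x| + ε/(3*(d-c)) + B * ((2*x-c-d)/(d-c))^(2*n)) := by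
          refine setIntegral_mono_on ?_ ((i1.add i3).add (i2.const_mul B)) measurableSet_Ioc ?_
          · exact (hf.sub (Continuous.integrableOn_Ioc (by fun_prop))).abs
          · intro x hx
            have h1 := hP x ⟨hx.1.le, hx.2⟩
            have h2 : 0 ≤ B * ((2*x-c-d)/(d-c))^(2*n) := by
              rw [pow_mul]; positivity
            rw [abs_lt] at h1
            have := abs_le.1 (le_refl |f x - g x|)
            rw [abs_le]; constructor <;> linarith
      _ = (∫ x in Ioc c d, |f x - g x|) + (∫ x in Ioc c d, ε/(3*(d-c))) + B * ∫ x in Ioc c d, ((2*x-c-d)/(d-c))^(2*n) := by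
          have i13 : IntegrableOn (fun x => |f x - g x| + ε/(3*(d-c))) (Ioc c d) := i1.add i3
          rw [integral_add i13 (i2.const_mul B), integral_add i1 i3, integral_const_mul]
      _ ≤ ε/3 + ε/3 + ε/3 := by
          refine add_le_add (add_le_add hg ?_) ?_
          · rw [setIntegral_const]
            simp [hcd.le]
            apply le_of_eq; field_simp
          · calc _ ≤ B * (ε/(3*B)) := by gcongr
              _ = ε/3 := by field_simp
      _ = ε := by ring

lemma LocSol.r0_int {a : ℝ → ℝ} {μ : ℝ} {u h : ℝ → ℝ → ℝ} (S : LocSol a μ u h) {t : ℝ} (ht : 0 < t) (c d : ℝ) :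
    IntegrableOn (fun x => deriv (fun s => u s x) t) (Ioc c d) := by
  have := cd_c1 (S.u2 t ht); have := cd_c2 (S.u2 t ht); have := (S.u2 t ht).continuous
  have := S.ac
  have : IntegrableOn (fun x => h t x + (μ * deriv (deriv (u t)) x - a (u t x) * deriv (u t) x)) (Ioc c d) :=
    (S.hi t ht).integrableOn.add (Continuous.integrableOn_Ioc (by fun_prop))
  refine this.congr (Eventually.of_forall fun x => ?_)
  simp only [S.pde t ht x]; ring

lemma D_pos {a : ℝ → ℝ} {μ : ℝ} {u h : ℝ → ℝ → ℝ} (S : LocSol a μ u h) {c d t : ℝ} (hcd : c < d) (ht : 0 < t)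
    {ε : ℝ} (hε : 0 < ε) : ∀ᶠ η in 𝓝[>] (0:ℝ),
      ∫ x in Ioc c d, max (u (t+η) x - u t x - η * deriv (fun s => u s x) t) 0 ≤ ε * η := by
  set r₀ : ℝ → ℝ := fun x => deriv (fun s => u s x) t with hr₀
  obtain ⟨r, r2, rc, rd, hr⟩ := approx_r hcd (S.r0_int ht c d) (max (r₀ c) (r₀ d)) (ε := ε/3) (by positivity)
  have rc' : r₀ c < r c := (le_max_left _ _).trans_lt rc
  have rd' : r₀ d < r d := (le_max_right _ _).trans_lt rd
  set k : ℝ → ℝ := fun x => u t x - t * r x with hk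
  have k2 : ContDiff ℝ 2 k := (S.u2 t ht).sub (contDiff_const.mul r2)
  have kd : deriv k = fun x => deriv (u t) x - t * deriv r x := by
    funext x
    exact ((cd_d0 (S.u2 t ht) x).sub ((cd_d0 r2 x).const_mul t)).deriv
  have kdd : ∀ x, deriv (deriv k) x = deriv (deriv (u t)) x - t * deriv (deriv r) x := by
    intro x
    rw [kd]
    exact ((cd_d1 (S.u2 t ht) x).sub ((cd_d1 r2 x).const_mul t)).deriv
  have er0 : ∀ x, h t x + er a μ k r t x = r₀ x - r x := by
    intro x
    have : k x + t * r x = u t x := by simp only [hk]; ring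
    unfold er
    rw [this, kdd, kd]
    simp only [hr₀, S.pde t ht x]; ring
  have m0 : mB a μ h c d k r t ≤ ε/3 := by
    refine le_trans ?_ hr
    unfold mB
    simp only [er0]
    have i := (S.r0_int ht c d).sub (r2.continuous.integrableOn_Ioc (a := c) (b := d))
    refine integral_mono i.pos_part i.abs fun x => ?_
    exact max_le (le_abs_self _) (abs_nonneg _)
  have mc : ∀ᶠ τ in 𝓝 t, mB a μ h c d k r τ < 2*ε/3 :=
    ((mB_cont S c d k2 r2).continuousAt (Ioi_mem_nhds ht)).eventually (gt_mem_nhds (by linarith))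
  have bd : ∀ y, r₀ y < r y → ∀ᶠ τ in 𝓝 t, t ≤ τ → u τ y ≤ k y + τ * r y := by
    intro y hy
    have h1 := (S.dt ht y).sub ((hasDerivAt_id' t).mul_const (r y))
    have h2 : deriv (fun s => u s y) t - 1 * r y < 0 := by simp only [hr₀] at hy; linarith
    have h3 := (hasDerivAt_iff_tendsto_slope.1 h1).eventually (gt_mem_nhds h2)
    rw [eventually_nhdsWithin_iff] at h3
    filter_upwards [h3] with τ hτ hle
    rcases hle.eq_or_lt with rfl | hlt
    · simp [hk]
    · have := hτ (by simp; exact hlt.ne')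
      rw [slope_def_field, div_lt_iff₀ (sub_pos.2 hlt)] at this
      simp at this
      simp only [hk]; nlinarith
  have all := mc.and ((bd c rc').and (bd d rd'))
  obtain ⟨δ, δp, hδ⟩ := Metric.eventually_nhds_iff.1 all
  have : Ioo (0:ℝ) δ ∈ 𝓝[>] (0:ℝ) := Ioo_mem_nhdsGT δp
  filter_upwards [this] with η hη
  have near : ∀ τ ∈ Icc t (t+η), dist τ t < δ := by
    intro τ hτ
    rw [Real.dist_eq, abs_of_nonneg (by linarith [hτ.1])]
    linarith [hτ.2, hη.2]
  have K := (Kr S hcd ht (show t ≤ t + η by linarith [hη.1])).1 k r k2 r2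
    (fun τ hτ => ⟨(hδ (near τ hτ)).2.1 hτ.1, (hδ (near τ hτ)).2.2 hτ.1⟩)
  have P0 : PhB u c d k r t = 0 := by
    unfold PhB
    have : ∀ x, max (u t x + -(k x + t * r x)) 0 = 0 := by
      intro x; have : u t x + -(k x + t * r x) = 0 := by simp only [hk]; ring
      rw [this, max_self]
    simp only [this, integral_zero]
  have K2 : PhB u c d k r (t+η) ≤ 2*ε/3 * η := by
    rw [P0, sub_zero] at K
    refine K.trans ?_
    calc _ ≤ ∫ τ in t..(t+η), 2*ε/3 := by
          refine intervalIntegral.integral_mono_on (by linarith [hη.1]) (mB_ii S c d k2 r2 ht (by linarith [hη.1])) (by simp) ?_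
          intro τ hτ
          exact (hδ (near τ hτ)).1.le
      _ = _ := by simp; ring
  have hη0 := hη.1
  have tη : 0 < t + η := by linarith
  have i1 : IntegrableOn (fun x => max (u (t+η) x + -(k x + (t+η) * r x)) 0) (Ioc c d) := by
    have := k2.continuous; have := r2.continuous
    exact ((S.ui _ tη).integrableOn.add (Continuous.integrableOn_Ioc (by fun_prop))).pos_part
  have i2 : IntegrableOn (fun x => |r₀ x - r x|) (Ioc c d) :=
    ((S.r0_int ht c d).sub (r2.continuous.integrableOn_Ioc (a := c) (b := d))).abs
  calc ∫ x in Ioc c d, max (u (t+η) x - u t x - η * deriv (fun s => u s x) t) 0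
      ≤ ∫ x in Ioc c d, (max (u (t+η) x + -(k x + (t+η) * r x)) 0 + η * |r₀ x - r x|) := by
        refine integral_mono ?_ (i1.add (i2.const_mul η)) fun x => ?_
        · exact (((S.ui _ tη).integrableOn.sub (S.ui _ ht).integrableOn).sub ((S.r0_int ht c d).const_mul η)).pos_part
        · simp only [hk]
          have e : η * -(r₀ x - r x) ≤ η * |r₀ x - r x| := mul_le_mul_of_nonneg_left (neg_le_abs _) hη0.le
          refine max_le ?_ (by positivity)
          have := le_max_left (u (t+η) x + -(u t x - t * r x + (t+η) * r x)) 0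
          simp only [hr₀] at e ⊢
          linarith
    _ = PhB u c d k r (t+η) + η * ∫ x in Ioc c d, |r₀ x - r x| := by
        rw [integral_add i1 (i2.const_mul η), integral_const_mul]; rfl
    _ ≤ 2*ε/3*η + η * (ε/3) := by gcongr
    _ = ε * η := by ring

theorem D_abs {a : ℝ → ℝ} {μ : ℝ} {u h : ℝ → ℝ → ℝ} (S : LocSol a μ u h) (c d : ℝ) {t : ℝ} (ht : 0 < t)
    {ε : ℝ} (hε : 0 < ε) : ∀ᶠ η in 𝓝[>] (0:ℝ),
      ∫ x in Ioc c d, |u (t+η) x - u t x - η * deriv (fun s => u s x) t| ≤ ε * η := by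
  rcases le_or_gt d c with hcd | hcd
  · filter_upwards [self_mem_nhdsWithin] with η hη
    rw [Ioc_eq_empty (by simpa using hcd)]; simp
    exact mul_nonneg hε.le (le_of_lt hη)
  have h1 := D_pos S hcd ht (half_pos hε)
  have h2 := D_pos S.neg hcd ht (half_pos hε)
  filter_upwards [h1, h2, self_mem_nhdsWithin] with η e1 e2 hη
  have hη' : 0 < η := hη
  have hd : ∀ x, deriv (fun s => -u s x) t = - deriv (fun s => u s x) t := fun x => deriv.fun_neg
  have i := ((S.ui _ (by linarith : 0 < t + η)).integrableOn.sub (S.ui _ ht).integrableOn).sub ((S.r0_int ht c d).const_mul η)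
  have i2 := ((S.neg.ui _ (by linarith : 0 < t + η)).integrableOn.sub (S.neg.ui _ ht).integrableOn).sub ((S.neg.r0_int ht c d).const_mul η)
  calc ∫ x in Ioc c d, |u (t+η) x - u t x - η * deriv (fun s => u s x) t|
      = ∫ x in Ioc c d, (max (u (t+η) x - u t x - η * deriv (fun s => u s x) t) 0 +
        max (-u (t+η) x - -u t x - η * deriv (fun s => -u s x) t) 0) := by
        congr 1; funext x
        rw [hd]
        have : -u (t+η) x - -u t x - η * -deriv (fun s => u s x) t = -(u (t+η) x - u t x - η * deriv (fun s => u s x) t) := by ring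
        rw [this]
        generalize u (t+η) x - u t x - η * deriv (fun s => u s x) t = w
        rcases le_total w 0 with hw | hw
        · rw [abs_of_nonpos hw, max_eq_right hw, max_eq_left (by linarith)]; ring
        · rw [abs_of_nonneg hw, max_eq_left hw, max_eq_right (by linarith)]; ring
    _ = _ := integral_add i.pos_part i2.pos_part
    _ ≤ ε/2*η + ε/2*η := add_le_add e1 e2
    _ = ε * η := by ring

end Aux

namespace Aux
open Set Topology

lemma snd_max {g g' : ℝ → ℝ} {g2 x₀ : ℝ} (hg : ∀ x, HasDerivAt g (g' x) x) (h2 : HasDerivAt g' g2 x₀)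
    (hm : IsLocalMax g x₀) : g2 ≤ 0 := by
  by_contra hpos
  push Not at hpos
  have h0 : g' x₀ = 0 := hm.hasDerivAt_eq_zero (hg x₀)
  have h3 := (hasDerivAt_iff_tendsto_slope.1 h2).eventually (lt_mem_nhds hpos)
  rw [eventually_nhdsWithin_iff] at h3
  obtain ⟨δ, δp, hδ⟩ := Metric.eventually_nhds_iff.1 (h3.and hm)
  have : g x₀ < g (x₀ + δ/2) := by
    obtain ⟨ξ, hξ, e⟩ := exists_hasDerivAt_eq_slope g g' (show x₀ < x₀ + δ/2 by linarith)
      (fun x _ => (hg x).continuousAt.continuousWithinAt) (fun x _ => hg x)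
    have hd : dist ξ x₀ < δ := by
      rw [Real.dist_eq, abs_of_pos (by linarith [hξ.1])]; linarith [hξ.2]
    have := (hδ hd).1 (by simp; exact hξ.1.ne')
    rw [slope_def_field, h0, sub_zero] at this
    have hp : 0 < g' ξ := by
      have h5 := mul_pos this (sub_pos.2 hξ.1)
      rwa [div_mul_cancel₀ _ (sub_pos.2 hξ.1).ne'] at h5
    rw [e] at hp
    have h6 := mul_pos hp (show 0 < x₀ + δ/2 - x₀ by linarith)
    rw [div_mul_cancel₀ _ (show x₀ + δ/2 - x₀ ≠ 0 by simp; exact δp.ne')] at h6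
    linarith
  have h7 : dist (x₀ + δ/2) x₀ < δ := by
    rw [Real.dist_eq, abs_of_pos (by linarith)]; linarith
  exact absurd ((hδ h7).2) (not_le.2 this)

/-- abstract maximum principle -/
theorem maxp {X : Type*} [TopologicalSpace X] {K D : Set X} (hK : IsCompact K) {Ψ : ℝ → X → ℝ} {s T η : ℝ}
    (hst : s ≤ T) (hKD : K ⊆ D)
    (hout : ∀ t ∈ Icc s T, ∀ p ∈ D, p ∉ K → Ψ t p ≤ η)
    (cont : ContinuousOn (fun z : ℝ × X => Ψ z.1 z.2) (Icc s T ×ˢ K))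
    (init : ∀ p ∈ D, Ψ s p ≤ η)
    (step : ∀ t ∈ Ico s T, (∀ p ∈ D, Ψ t p ≤ η) → ∀ p ∈ K, Ψ t p = η →
      ∀ᶠ z : ℝ × X in 𝓝 ((0:ℝ), p), 0 < z.1 → z.2 ∈ K → Ψ (t + z.1) z.2 ≤ Ψ t z.2) :
    ∀ t ∈ Icc s T, ∀ p ∈ D, Ψ t p ≤ η := by
  set A : Set ℝ := {t | ∀ p ∈ K, Ψ t p ≤ η} with hA
  have key : Icc s T ⊆ A := by
    have hcl : IsClosed (A ∩ Icc s T) := by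
      have : A ∩ Icc s T = Icc s T ∩ ⋂ p ∈ K, (Icc s T ∩ (fun t => Ψ t p) ⁻¹' Iic η) := by
        ext t; simp only [hA, mem_inter_iff, mem_ofPred_eq, mem_iInter, mem_preimage, mem_Iic]
        exact ⟨fun h => ⟨h.2, fun p hp => ⟨h.2, h.1 p hp⟩⟩, fun h => ⟨fun p hp => (h.2 p hp).2, h.1⟩⟩
      rw [this]
      refine isClosed_Icc.inter (isClosed_biInter fun p hp => ?_)
      refine ContinuousOn.preimage_isClosed_of_isClosed ?_ isClosed_Icc isClosed_Iic
      exact cont.comp (f := fun t : ℝ => (t, p)) (by fun_prop) fun t ht => ⟨ht, hp⟩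
    refine hcl.Icc_subset_of_forall_mem_nhdsWithin (fun p hp => init p (hKD hp)) ?_
    rintro t ⟨htA, ht⟩
    have htD : ∀ p ∈ D, Ψ t p ≤ η := fun p hp => by
      by_cases hpK : p ∈ K
      · exact htA p hpK
      · exact hout t ⟨ht.1, ht.2.le⟩ p hp hpK
    have ev : ∀ p ∈ K, ∀ᶠ z : ℝ × X in 𝓝 ((0:ℝ), p), 0 < z.1 → z.2 ∈ K → Ψ (t + z.1) z.2 ≤ η := by
      intro p hp
      rcases (htA p hp).lt_or_eq with hlt | heq
      · have h1 := (cont (t, p) ⟨⟨ht.1, ht.2.le⟩, hp⟩).eventually (gt_mem_nhds hlt)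
        rw [eventually_nhdsWithin_iff] at h1
        have h2 : Tendsto (fun z : ℝ × X => (t + z.1, z.2)) (𝓝 ((0:ℝ), p)) (𝓝 (t, p)) := by
          have : Continuous fun z : ℝ × X => (t + z.1, z.2) := by fun_prop
          have := this.tendsto ((0:ℝ), p)
          simpa using this
        have h3 : ∀ᶠ z : ℝ × X in 𝓝 ((0:ℝ), p), z.1 < T - t :=
          continuous_fst.continuousAt.eventually (gt_mem_nhds (by simpa using ht.2))
        filter_upwards [h2.eventually h1, h3] with z hz hz3 hpos hzK
        exact (hz ⟨⟨by linarith [ht.1], by linarith⟩, hzK⟩).le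
      · filter_upwards [step t ht htD p hp heq] with z hz hpos hzK
        exact (hz hpos hzK).trans (htA _ hzK)
    have h5 : ∀ᶠ x : ℝ in 𝓝 (0:ℝ), ∀ p ∈ K, 0 < x → p ∈ K → Ψ (t + x) p ≤ η :=
      hK.eventually_forall_of_forall_eventually (P := fun x p => 0 < x → p ∈ K → Ψ (t + x) p ≤ η) ev
    have h6 : Tendsto (fun τ : ℝ => τ - t) (𝓝 t) (𝓝 0) := by
      have := (show Continuous fun τ : ℝ => τ - t by fun_prop).tendsto t
      simpa using this
    have h7 := h6.eventually h5
    refine mem_nhdsWithin_iff_eventually.2 ?_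
    filter_upwards [h7] with τ hτ hlt p hp
    have := hτ p hp (sub_pos.2 hlt) hp
    simpa using this
  intro t ht p hp
  by_cases hpK : p ∈ K
  · exact key ht p hpK
  · exact hout t ht p hp hpK

/-- uniform tails -/
lemma tails {h : ℝ → ℝ → ℝ} (hi : ∀ t, 0 < t → Integrable (h t))
    (hc : ∀ t₀, 0 < t₀ → Tendsto (fun t => ∫ x, |h t x - h t₀ x|) (𝓝 t₀) (𝓝 0)) {s T : ℝ} (hs : 0 < s) {ε : ℝ} (hε : 0 < ε) :
    ∃ R : ℝ, 0 < R ∧ ∀ τ ∈ Icc s T, ∫ x in (Icc (-R) R)ᶜ, |h τ x| ≤ ε := by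
  have main : ∀ t ∈ Icc s T, ∃ V ∈ 𝓝[Icc s T] t, ∃ R : ℝ, 0 < R ∧ ∀ τ ∈ V, ∫ x in (Icc (-R) R)ᶜ, |h τ x| ≤ ε := by
    intro t ht
    have ht0 : 0 < t := hs.trans_le ht.1
    have hlim : Tendsto (fun n : ℕ => ∫ x in (Icc (-(n:ℝ)) n)ᶜ, |h t x|) atTop (𝓝 0) := by
      have e : ∀ n : ℕ, ∫ x in (Icc (-(n:ℝ)) n)ᶜ, |h t x| = ∫ x, (Icc (-(n:ℝ)) n)ᶜ.indicator (fun x => |h t x|) x :=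
        fun n => (integral_indicator measurableSet_Icc.compl).symm
      simp only [e]
      have z : (0:ℝ) = ∫ x : ℝ, (0:ℝ) := by simp
      rw [z]
      refine tendsto_integral_of_dominated_convergence (fun x => |h t x|) ?_ (hi t ht0).abs ?_ ?_
      · intro n; exact (hi t ht0).abs.aestronglyMeasurable.indicator measurableSet_Icc.compl
      · intro n; refine Eventually.of_forall fun x => ?_
        refine (norm_indicator_le_norm_self _ _).trans ?_
        simp
      · refine Eventually.of_forall fun x => ?_
        refine tendsto_const_nhds.congr' ?_
        obtain ⟨N, hN⟩ := exists_nat_ge |x|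
        filter_upwards [eventually_ge_atTop N] with n hn
        have : |x| ≤ n := hN.trans (by exact_mod_cast hn)
        rw [indicator_of_notMem]
        simp only [mem_compl_iff, not_not]
        exact abs_le.1 this
    obtain ⟨n, hn, hn1⟩ := ((hlim.eventually (gt_mem_nhds (half_pos hε))).and (eventually_gt_atTop 0)).exists
    have h1 := (hc t ht0).eventually (gt_mem_nhds (half_pos hε))
    refine ⟨{τ | ∫ x, |h τ x - h t x| < ε/2} ∩ Ioi 0, mem_nhdsWithin_of_mem_nhds (inter_mem h1 (Ioi_mem_nhds ht0)),
      n, by exact_mod_cast hn1, ?_⟩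
    rintro τ ⟨hτ, hτ0⟩
    have hτ0' : 0 < τ := hτ0
    have i1 : Integrable (fun x => |h τ x - h t x|) := ((hi τ hτ0').sub (hi t ht0)).abs
    calc ∫ x in (Icc (-(n:ℝ)) n)ᶜ, |h τ x| ≤ ∫ x in (Icc (-(n:ℝ)) n)ᶜ, (|h τ x - h t x| + |h t x|) := by
          refine integral_mono (hi τ hτ0').abs.integrableOn (i1.integrableOn.add (hi t ht0).abs.integrableOn) fun x => ?_
          have := abs_add_le (h τ x - h t x) (h t x)
          simpa using this
      _ = (∫ x in (Icc (-(n:ℝ)) n)ᶜ, |h τ x - h t x|) + ∫ x in (Icc (-(n:ℝ)) n)ᶜ, |h t x| :=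
          integral_add i1.integrableOn (hi t ht0).abs.integrableOn
      _ ≤ ε/2 + ε/2 := add_le_add ((setIntegral_le_integral i1 (Eventually.of_forall fun x => abs_nonneg _)).trans (le_of_lt hτ)) hn.le
      _ = ε := by ring
  have hmon : ∀ {R R' : ℝ} {τ : ℝ}, s ≤ τ → R ≤ R' → ∫ x in (Icc (-R') R')ᶜ, |h τ x| ≤ ∫ x in (Icc (-R) R)ᶜ, |h τ x| := by
    intro R R' τ hτ hRR
    refine setIntegral_mono_set (hi τ (hs.trans_le hτ)).abs.integrableOn (Eventually.of_forall fun x => abs_nonneg _) ?_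
    exact (compl_subset_compl.2 (Icc_subset_Icc (by linarith) hRR)).eventuallyLE
  refine (isCompact_Icc (a := s) (b := T)).induction_on
    (p := fun V => ∃ R : ℝ, 0 < R ∧ ∀ τ ∈ V ∩ Icc s T, ∫ x in (Icc (-R) R)ᶜ, |h τ x| ≤ ε) ⟨1, one_pos, by simp⟩ ?_ ?_ ?_ |>.imp ?_
  · rintro A B hAB ⟨R, hR, hB⟩
    exact ⟨R, hR, fun τ hτ => hB τ ⟨hAB hτ.1, hτ.2⟩⟩
  · rintro A B ⟨R, hR, hA⟩ ⟨R', hR', hB⟩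
    refine ⟨max R R', lt_max_of_lt_left hR, ?_⟩
    rintro τ ⟨hτ | hτ, h2⟩
    · exact (hmon h2.1 (le_max_left _ _)).trans (hA τ ⟨hτ, h2⟩)
    · exact (hmon h2.1 (le_max_right _ _)).trans (hB τ ⟨hτ, h2⟩)
  · intro t ht
    obtain ⟨V, hV, R, hR, h1⟩ := main t ht
    exact ⟨V, hV, R, hR, fun τ hτ => h1 τ hτ.1⟩
  · rintro R ⟨hR, h1⟩
    exact ⟨hR, fun τ hτ => h1 τ ⟨hτ, hτ⟩⟩

end Aux

namespace Aux
open Set Topology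

noncomputable def V (u : ℝ → ℝ → ℝ) (t x : ℝ) : ℝ := ∫ y in Iic x, u t y

lemma V_sub {u : ℝ → ℝ → ℝ} {t : ℝ} (hu : Integrable (u t)) (x y : ℝ) : V u t x - V u t y = ∫ w in y..x, u t w :=
  intervalIntegral.integral_Iic_sub_Iic hu.integrableOn hu.integrableOn

lemma V_sub' {u : ℝ → ℝ → ℝ} {t : ℝ} (hu : Integrable (u t)) {x y : ℝ} (h : y ≤ x) :
    V u t x - V u t y = ∫ w in Ioc y x, u t w := by
  rw [V_sub hu, intervalIntegral.integral_of_le h]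

lemma V_cx {u : ℝ → ℝ → ℝ} {t : ℝ} (hu : Integrable (u t)) : Continuous (V u t) := by
  have : V u t = fun x => V u t 0 + ∫ w in (0:ℝ)..x, u t w := by
    funext x; rw [← V_sub hu]; ring
  rw [this]
  exact continuous_const.add (intervalIntegral.continuous_primitive (fun a b => hu.intervalIntegrable) 0)

lemma V_der {u : ℝ → ℝ → ℝ} {t : ℝ} (hu : Integrable (u t)) (hc : Continuous (u t)) (x : ℝ) :
    HasDerivAt (V u t) (u t x) x := by
  have : V u t = fun x => V u t 0 + ∫ w in (0:ℝ)..x, u t w := by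
    funext x; rw [← V_sub hu]; ring
  rw [this]
  exact (intervalIntegral.integral_hasDerivAt_right hu.intervalIntegrable
    (hc.stronglyMeasurableAtFilter _ _) hc.continuousAt).const_add _

lemma V_abs {u : ℝ → ℝ → ℝ} {t : ℝ} (hu : Integrable (u t)) (x : ℝ) : |V u t x| ≤ ∫ y, |u t y| :=
  abs_integral_le_integral_abs.trans (setIntegral_le_integral hu.abs (Eventually.of_forall fun x => abs_nonneg _))

lemma V_dt {u : ℝ → ℝ → ℝ} {t s : ℝ} (hu : Integrable (u t)) (hs : Integrable (u s)) (x : ℝ) :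
    |V u t x - V u s x| ≤ ∫ y, |u t y - u s y| := by
  unfold V
  rw [← integral_sub hu.integrableOn hs.integrableOn]
  exact abs_integral_le_integral_abs.trans (setIntegral_le_integral (hu.sub hs).abs (Eventually.of_forall fun x => abs_nonneg _))

lemma V_cont {u : ℝ → ℝ → ℝ} (hi : ∀ t, 0 < t → Integrable (u t))
    (hc : ∀ t₀, 0 < t₀ → Tendsto (fun t => ∫ x, |u t x - u t₀ x|) (𝓝 t₀) (𝓝 0)) {t₀ : ℝ} (ht : 0 < t₀) (x₀ : ℝ) :
    ContinuousAt (fun z : ℝ × ℝ => V u z.1 z.2) (t₀, x₀) := by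
  refine tendsto_iff_dist_tendsto_zero.mpr ?_
  have l1 : Tendsto (fun z : ℝ × ℝ => ∫ x, |u z.1 x - u t₀ x|) (𝓝 (t₀, x₀)) (𝓝 0) :=
    (hc t₀ ht).comp continuous_fst.continuousAt
  have l2 : Tendsto (fun z : ℝ × ℝ => dist (V u t₀ z.2) (V u t₀ x₀)) (𝓝 (t₀, x₀)) (𝓝 0) :=
    tendsto_iff_dist_tendsto_zero.1 (((V_cx (hi t₀ ht)).tendsto x₀).comp continuous_snd.continuousAt)
  have l3 := l1.add l2
  rw [add_zero] at l3
  refine squeeze_zero' (Eventually.of_forall fun _ => dist_nonneg) ?_ l3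
  filter_upwards [continuous_fst.continuousAt.eventually (Ioi_mem_nhds ht : ∀ᶠ t in 𝓝 ((t₀, x₀):ℝ×ℝ).1, t ∈ Ioi 0)] with z hz
  refine (dist_triangle _ (V u t₀ z.2) _).trans (add_le_add ?_ le_rfl)
  exact V_dt (hi _ hz) (hi _ ht) _

/-- flux potential: spatial antiderivative of `u_t` -/
noncomputable def GG (a : ℝ → ℝ) (μ : ℝ) (u h : ℝ → ℝ → ℝ) (t x : ℝ) : ℝ :=
  μ * deriv (u t) x - fl a (u t x) + V h t x

lemma LocSol.GG_cont {a : ℝ → ℝ} {μ : ℝ} {u h : ℝ → ℝ → ℝ} (S : LocSol a μ u h) {t : ℝ} (ht : 0 < t) :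
    Continuous (GG a μ u h t) := by
  have := cd_c1 (S.u2 t ht); have := (S.u2 t ht).continuous
  have : Continuous (fl a) := continuous_iff_continuousAt.2 fun v => (fl_deriv S.ac v).continuousAt
  have := V_cx (S.hi t ht)
  unfold GG
  fun_prop

lemma LocSol.GG_sub {a : ℝ → ℝ} {μ : ℝ} {u h : ℝ → ℝ → ℝ} (S : LocSol a μ u h) {t : ℝ} (ht : 0 < t) (x y : ℝ) :
    GG a μ u h t x - GG a μ u h t y = ∫ w in y..x, deriv (fun s => u s w) t := by
  have c1 := cd_c1 (S.u2 t ht); have c2 := cd_c2 (S.u2 t ht); have c0 := (S.u2 t ht).continuous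
  have ac := S.ac
  have e : ∀ w, deriv (fun s => u s w) t = h t w + (μ * deriv (deriv (u t)) w - a (u t w) * deriv (u t) w) := by
    intro w; rw [S.pde t ht w]; ring
  simp only [e]
  have cc : Continuous fun w => μ * deriv (deriv (u t)) w - a (u t w) * deriv (u t) w := by fun_prop
  rw [intervalIntegral.integral_add (S.hi t ht).intervalIntegrable (cc.intervalIntegrable _ _), ← V_sub (S.hi t ht)]
  have := intervalIntegral.integral_eq_sub_of_hasDerivAt (a := y) (b := x)
    (f := fun x => μ * deriv (u t) x - fl a (u t x)) (f' := fun w => μ * deriv (deriv (u t)) w - a (u t w) * deriv (u t) w)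
    (fun w _ => ((cd_d1 (S.u2 t ht) w).const_mul μ).sub ((fl_deriv S.ac (u t w)).comp w (cd_d0 (S.u2 t ht) w)))
    (cc.intervalIntegrable _ _)
  rw [this]
  unfold GG; ring

/-- right differentiability of increments of `V`, uniformly on compacts -/
lemma LocSol.W_der {a : ℝ → ℝ} {μ : ℝ} {u h : ℝ → ℝ → ℝ} (S : LocSol a μ u h) {t : ℝ} (ht : 0 < t) (c d : ℝ)
    {ε : ℝ} (hε : 0 < ε) : ∀ᶠ η in 𝓝[>] (0:ℝ), ∀ x y, c ≤ y → y ≤ x → x ≤ d →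
      |(V u (t+η) x - V u (t+η) y) - (V u t x - V u t y) - η * (GG a μ u h t x - GG a μ u h t y)| ≤ ε * η := by
  filter_upwards [D_abs S c d ht hε, self_mem_nhdsWithin] with η hη hpos x y hc hyx hd
  have hpos' : 0 < η := hpos
  have tη : 0 < t + η := by linarith
  have i0 := (S.r0_int ht c d)
  have sub : Ioc y x ⊆ Ioc c d := Ioc_subset_Ioc hc hd
  rw [V_sub' (S.ui _ tη) hyx, V_sub' (S.ui _ ht) hyx, S.GG_sub ht, intervalIntegral.integral_of_le hyx,
    ← integral_const_mul, ← integral_sub (S.ui _ tη).integrableOn (S.ui _ ht).integrableOn]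
  have i1 : IntegrableOn (fun w => u (t+η) w - u t w) (Ioc c d) := (S.ui _ tη).integrableOn.sub (S.ui _ ht).integrableOn
  have i2 : IntegrableOn (fun w => η * deriv (fun s => u s w) t) (Ioc c d) := i0.const_mul η
  rw [← integral_sub (i1.mono_set sub) (i2.mono_set sub)]
  refine abs_integral_le_integral_abs.trans (le_trans ?_ hη)
  exact setIntegral_mono_set (i1.sub i2).abs (Eventually.of_forall fun x => abs_nonneg _) sub.eventuallyLE

/-- the compact region for doubling of variables -/
def KK (R z : ℝ) : Set (ℝ × ℝ) := {p | p.2 ≤ p.1 ∧ p.1 - p.2 ≤ z ∧ -R ≤ p.1 ∧ p.2 ≤ R}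

lemma KK_compact (R z : ℝ) : IsCompact (KK R z) := by
  have hcl : IsClosed (KK R z) := by
    have h1 : IsClosed {p : ℝ × ℝ | p.2 ≤ p.1} := isClosed_le continuous_snd continuous_fst
    have h2 : IsClosed {p : ℝ × ℝ | p.1 - p.2 ≤ z} := isClosed_le (continuous_fst.sub continuous_snd) continuous_const
    have h3 : IsClosed {p : ℝ × ℝ | -R ≤ p.1} := isClosed_le continuous_const continuous_fst
    have h4 : IsClosed {p : ℝ × ℝ | p.2 ≤ R} := isClosed_le continuous_snd continuous_const
    exact h1.inter (h2.inter (h3.inter h4))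
  refine IsCompact.of_isClosed_subset (isCompact_Icc.prod isCompact_Icc : IsCompact (Icc (-R) (R+z) ×ˢ Icc (-R-z) R)) hcl ?_
  rintro ⟨x, y⟩ ⟨h1, h2, h3, h4⟩
  simp only at h1 h2 h3 h4
  exact ⟨⟨h3, by linarith⟩, ⟨by linarith, h4⟩⟩

lemma V_tail {u : ℝ → ℝ → ℝ} {t R ε : ℝ} (hu : Integrable (u t)) (hR : ∫ x in (Icc (-R) R)ᶜ, |u t x| ≤ ε) {x y : ℝ} (hyx : y ≤ x)
    (h : x < -R ∨ R < y) : |V u t x - V u t y| ≤ ε := by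
  rw [V_sub' hu hyx]
  refine abs_integral_le_integral_abs.trans (le_trans ?_ hR)
  refine setIntegral_mono_set hu.abs.integrableOn (Eventually.of_forall fun x => abs_nonneg _) (LE.le.eventuallyLE ?_)
  intro w hw hw2
  rcases h with h | h
  · linarith [hw.2, hw2.1]
  · linarith [hw.1, hw2.2]

end Aux

namespace Aux
open Set Topology

lemma LocSol.stepW {a : ℝ → ℝ} {μ : ℝ} {u h : ℝ → ℝ → ℝ} (S : LocSol a μ u h) {t : ℝ} (ht : 0 < t) (R z : ℝ)
    {p : ℝ × ℝ} {m : ℝ} (hneg : GG a μ u h t p.1 - GG a μ u h t p.2 + m < 0) :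
    ∀ᶠ w : ℝ × (ℝ × ℝ) in 𝓝 ((0:ℝ), p), 0 < w.1 → w.2 ∈ KK R z →
      (V u (t + w.1) w.2.1 - V u (t + w.1) w.2.2) - (V u t w.2.1 - V u t w.2.2) + m * w.1 ≤ 0 := by
  set δ := -(GG a μ u h t p.1 - GG a μ u h t p.2 + m) / 2 with hδ
  have δp : 0 < δ := by rw [hδ]; linarith
  have h1 := S.W_der ht (-R-z) (R+z) δp
  rw [eventually_nhdsWithin_iff] at h1
  have h2 := h1.prod_inl_nhds p
  have gc := S.GG_cont ht
  have c2 : Continuous fun w : ℝ × (ℝ × ℝ) => GG a μ u h t w.2.1 - GG a μ u h t w.2.2 + m := by fun_prop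
  have h3 := (c2.tendsto ((0:ℝ), p)).eventually (gt_mem_nhds (show GG a μ u h t p.1 - GG a μ u h t p.2 + m < -δ by rw [hδ]; linarith))
  filter_upwards [h2, h3] with w hw hw3 hpos hK
  obtain ⟨k1, k2, k3, k4⟩ := hK
  have e := hw hpos w.2.1 w.2.2 (by linarith) k1 (by linarith)
  have e2 := (abs_le.1 e).2
  nlinarith

theorem LocSol.crude {a : ℝ → ℝ} {μ : ℝ} {u h : ℝ → ℝ → ℝ} (S : LocSol a μ u h) {s T N H ε : ℝ} (hs : 0 < s) (hsT : s < T)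
    (hN : 0 < N) (uN : ∀ τ ∈ Icc s T, ∫ x, |u τ x| ≤ N) (hH : ∀ τ ∈ Icc s T, ∫ x, |h τ x| ≤ H)
    (hε : 0 < ε) (cond : 2 * H + 2 * N / (T - s) < 16 * μ * N / ε^2) (x : ℝ) : u T x ≤ 4 * N / ε := by
  have hTs : 0 < T - s := sub_pos.2 hsT
  set φ : ℝ → ℝ := fun z => 2 * N * (2 * (z/ε) - (z/ε)^2) with hφ
  set φ1 : ℝ → ℝ := fun z => 2 * N * (2 * (1/ε) - 2 * (z/ε) * (1/ε)) with hφ1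
  have dφ : ∀ z, HasDerivAt φ (φ1 z) z := by
    intro z
    have h0 : HasDerivAt (fun z : ℝ => z/ε) (1/ε) z := (hasDerivAt_id' z).div_const ε
    refine (((h0.const_mul 2).fun_sub (h0.fun_pow 2)).const_mul (2*N)).congr_deriv ?_
    simp only [hφ1]; norm_num
  have dφ1 : ∀ z, HasDerivAt φ1 (-4 * N / ε^2) z := by
    intro z
    have h0 : HasDerivAt (fun z : ℝ => z/ε) (1/ε) z := (hasDerivAt_id' z).div_const ε
    refine ((((h0.const_mul 2).mul_const (1/ε)).const_sub (2 * (1/ε))).const_mul (2*N)).congr_deriv ?_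
    field_simp; ring
  have φnn : ∀ z, 0 ≤ z → z ≤ ε → 0 ≤ φ z := by
    intro z h1 h2
    have a1 : 0 ≤ z/ε := by positivity
    have a2 : z/ε ≤ 1 := by rw [div_le_one hε]; exact h2
    simp only [hφ]
    have : 0 ≤ 2 * (z/ε) - (z/ε)^2 := by nlinarith
    positivity
  set Ψ : ℝ → ℝ × ℝ → ℝ := fun t p => V u t p.1 - V u t p.2 - (φ (p.1 - p.2) + 2 * N * (1 - (t - s)/(T - s))) with hΨ
  set D : Set (ℝ × ℝ) := {p | p.2 ≤ p.1 ∧ p.1 - p.2 ≤ ε} with hD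
  have lin : ∀ t ∈ Icc s T, 0 ≤ 2 * N * (1 - (t - s)/(T - s)) := by
    intro t ht
    have : (t - s)/(T - s) ≤ 1 := by rw [div_le_one hTs]; linarith [ht.2]
    have : 0 ≤ 1 - (t - s)/(T - s) := by linarith
    positivity
  have Wle : ∀ t ∈ Icc s T, ∀ x y, y ≤ x → V u t x - V u t y ≤ N := by
    intro t ht x y hyx
    have t0 : 0 < t := hs.trans_le ht.1
    rw [V_sub' (S.ui t t0) hyx]
    refine (le_abs_self _).trans (abs_integral_le_integral_abs.trans ((setIntegral_le_integral (S.ui t t0).abs (Eventually.of_forall fun x => abs_nonneg _)).trans (uN t ht)))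
  have main : ∀ η, 0 < η → ∀ p ∈ D, Ψ T p ≤ η := by
    intro η hη
    obtain ⟨R, Rp, hR⟩ := tails S.ui S.uc (T := T) hs hη
    refine maxp (KK_compact R ε) (D := D) (Ψ := Ψ) (s := s) hsT.le (fun p hp => ⟨hp.1, hp.2.1⟩) ?_ ?_ ?_ ?_ T ⟨hsT.le, le_rfl⟩
    · intro t ht p hp hpK
      have t0 : 0 < t := hs.trans_le ht.1
      have : p.1 < -R ∨ R < p.2 := by
        by_contra hcon
        push Not at hcon
        exact hpK ⟨hp.1, hp.2, hcon.1, hcon.2⟩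
      have h1 := (abs_le.1 (V_tail (S.ui t t0) (hR t ht) hp.1 this)).2
      have h2 := φnn _ (sub_nonneg.2 hp.1) hp.2
      have h3 := lin t ht
      simp only [hΨ]; linarith
    · intro z hz
      have t0 : 0 < z.1 := hs.trans_le hz.1.1
      refine ContinuousAt.continuousWithinAt ?_
      have c1 : ContinuousAt (fun z : ℝ × (ℝ × ℝ) => V u z.1 z.2.1) z :=
        ContinuousAt.comp (f := fun z : ℝ × (ℝ × ℝ) => (z.1, z.2.1)) (g := fun z : ℝ × ℝ => V u z.1 z.2)
          (V_cont S.ui S.uc t0 z.2.1) (by fun_prop)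
      have c2 : ContinuousAt (fun z : ℝ × (ℝ × ℝ) => V u z.1 z.2.2) z :=
        ContinuousAt.comp (f := fun z : ℝ × (ℝ × ℝ) => (z.1, z.2.2)) (g := fun z : ℝ × ℝ => V u z.1 z.2)
          (V_cont S.ui S.uc t0 z.2.2) (by fun_prop)
      have c3 : Continuous φ := continuous_iff_continuousAt.2 fun v => (dφ v).continuousAt
      have c4 : ContinuousAt (fun z : ℝ × (ℝ × ℝ) => φ (z.2.1 - z.2.2) + 2 * N * (1 - (z.1 - s)/(T - s))) z := by
        refine Continuous.continuousAt ?_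
        fun_prop
      exact (c1.sub c2).sub c4
    · intro p hp
      have h1 := Wle s ⟨le_rfl, hsT.le⟩ p.1 p.2 hp.1
      have h2 := φnn _ (sub_nonneg.2 hp.1) hp.2
      simp only [hΨ, sub_self, zero_div, sub_zero, mul_one]; linarith
    · rintro t ht hmax ⟨x₀, y₀⟩ hp heq
      have t0 : 0 < t := hs.trans_le ht.1
      have ht' : t ∈ Icc s T := ⟨ht.1, ht.2.le⟩
      have hl := lin t ht'
      simp only [hΨ] at heq
      have z0 : y₀ < x₀ := by
        refine lt_of_le_of_ne hp.1 ?_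
        intro e
        rw [e] at heq
        simp only [sub_self, hφ] at heq
        simp at heq
        have := lin t ht'
        linarith
      have z1 : x₀ - y₀ < ε := by
        refine lt_of_le_of_ne hp.2.1 ?_
        intro e
        rw [e] at heq
        have h1 := Wle t ht' x₀ y₀ z0.le
        have : φ ε = 2 * N := by simp only [hφ]; rw [div_self hε.ne']; ring
        rw [this] at heq
        linarith
      have uc0 := (S.u2 t t0).continuous
      have hVd : ∀ x, HasDerivAt (V u t) (u t x) x := V_der (S.ui t t0) uc0
      have hmax' : ∀ x y, y ≤ x → x - y ≤ ε → V u t x - V u t y - φ (x - y) ≤ V u t x₀ - V u t y₀ - φ (x₀ - y₀) := by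
        intro x y h1 h2
        have := hmax (x, y) ⟨h1, h2⟩
        simp only [hΨ] at this
        linarith
      have m1 : IsLocalMax (fun x => V u t x - V u t y₀ - φ (x - y₀)) x₀ := by
        filter_upwards [Ioo_mem_nhds z0 (show x₀ < y₀ + ε by linarith)] with x hx
        exact hmax' x y₀ hx.1.le (by linarith [hx.2])
      have m2 : IsLocalMax (fun y => V u t x₀ - V u t y - φ (x₀ - y)) y₀ := by
        filter_upwards [Ioo_mem_nhds (show x₀ - ε < y₀ by linarith) z0] with y hy
        exact hmax' x₀ y hy.2.le (by linarith [hy.1])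
      have e1 : u t x₀ - φ1 (x₀ - y₀) = 0 := by
        refine m1.hasDerivAt_eq_zero ?_
        exact ((hVd x₀).sub_const _).sub ((dφ (x₀ - y₀)).comp_sub_const x₀ y₀)
      have e2 : -u t y₀ - -φ1 (x₀ - y₀) = 0 := by
        refine m2.hasDerivAt_eq_zero ?_
        exact ((hVd y₀).const_sub _).sub ((dφ (x₀ - y₀)).comp_const_sub x₀ y₀)
      have eu : u t x₀ = u t y₀ := by linarith
      have m3 : IsLocalMax (fun θ => V u t (x₀ + θ) - V u t (y₀ - θ) - φ (x₀ - y₀ + 2 * θ)) 0 := by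
        have : ∀ᶠ θ : ℝ in 𝓝 0, θ ∈ Ioo (-(x₀-y₀)/2) ((ε - (x₀ - y₀))/2) := Ioo_mem_nhds (by linarith) (by linarith)
        filter_upwards [this] with θ hθ
        have := hmax' (x₀ + θ) (y₀ - θ) (by linarith [hθ.1]) (by linarith [hθ.2])
        have e : x₀ + θ - (y₀ - θ) = x₀ - y₀ + 2 * θ := by ring
        rw [e] at this
        simpa using this
      have e3 : deriv (u t) x₀ - -deriv (u t) y₀ * (-1) + 0 - (-4 * N / ε^2) * 2 * 2 ≤ 0 := by
        refine snd_max (g' := fun θ => u t (x₀ + θ) + u t (y₀ - θ) - φ1 (x₀ - y₀ + 2 * θ) * 2) ?_ ?_ m3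
        · intro θ
          have d1 := (hVd (x₀ + θ)).comp_const_add x₀ θ
          have d2 := (hVd (y₀ - θ)).comp_const_sub y₀ θ
          have d3 : HasDerivAt (fun θ => x₀ - y₀ + 2 * θ) (2 * 1) θ := ((hasDerivAt_id' θ).const_mul 2).const_add _
          have d4 := (dφ (x₀ - y₀ + 2 * θ)).comp θ d3
          exact ((d1.sub d2).sub d4).congr_deriv (by ring)
        · have d1 : HasDerivAt (fun θ => u t (x₀ + θ)) (deriv (u t) x₀) 0 := by
            have := (cd_d0 (S.u2 t t0) (x₀ + 0)).comp_const_add x₀ 0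
            simpa using this
          have d2 : HasDerivAt (fun θ => u t (y₀ - θ)) (-deriv (u t) y₀) 0 := by
            have := (cd_d0 (S.u2 t t0) (y₀ - 0)).comp_const_sub y₀ 0
            simpa using this
          have d3 : HasDerivAt (fun θ => x₀ - y₀ + 2 * θ) (2 * 1) 0 := ((hasDerivAt_id' 0).const_mul 2).const_add _
          have d4 := ((dφ1 (x₀ - y₀ + 2 * 0)).comp 0 d3).mul_const 2
          exact ((d1.add d2).sub d4).congr_deriv (by ring)
      have hV1 := (abs_le.1 (V_abs (S.hi t t0) x₀)).2
      have hV2 := (abs_le.1 (V_abs (S.hi t t0) y₀)).1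
      have hHt := hH t ht'
      have neg : GG a μ u h t x₀ - GG a μ u h t y₀ + 2 * N / (T - s) < 0 := by
        unfold GG
        rw [eu]
        have k : μ * (deriv (u t) x₀ - deriv (u t) y₀) ≤ μ * (-16 * N / ε^2) := by
          refine mul_le_mul_of_nonneg_left ?_ S.μp.le
          have : -16 * N / ε^2 = (-4 * N / ε^2) * 2 * 2 := by ring
          rw [this]; linarith
        have : μ * (-16 * N / ε^2) = -(16 * μ * N / ε^2) := by ring
        rw [this] at k
        linarith
      filter_upwards [S.stepW t0 R ε (p := (x₀, y₀)) neg] with w hw hpos hK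
      have := hw hpos hK
      simp only [hΨ]
      have e : 2 * N * (1 - (t + w.1 - s)/(T - s)) = 2 * N * (1 - (t - s)/(T - s)) - 2 * N / (T - s) * w.1 := by
        field_simp; ring
      rw [e]; linarith
  have T0 : 0 < T := hs.trans hsT
  have bound : ∀ z, 0 < z → z < ε → V u T (x + z) - V u T x ≤ 4 * N / ε * z := by
    intro z h1 h2
    refine le_of_forall_pos_le_add fun η hη => ?_
    have := main η hη (x + z, x) ⟨by simp; exact h1.le, by simp; exact h2.le⟩
    simp only [hΨ] at this
    rw [div_self hTs.ne'] at this
    have e : φ (x + z - x) ≤ 4 * N / ε * z := by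
      simp only [hφ]
      have : 4 * N / ε * z = 2 * N * (2 * (z/ε)) := by ring
      rw [this]
      have : x + z - x = z := by ring
      rw [this]
      have : 0 ≤ (z/ε)^2 := by positivity
      gcongr; linarith
    linarith
  have hVd := V_der (S.ui T T0) (S.u2 T T0).continuous x
  have := hVd.tendsto_slope_zero_right
  refine le_of_tendsto this ?_
  filter_upwards [Ioo_mem_nhdsGT hε] with z hz
  have := bound z hz.1 hz.2
  rw [smul_eq_mul, inv_mul_le_iff₀ hz.1]
  linarith

/-- local in time boundedness -/
theorem LocSol.bdd {a : ℝ → ℝ} {μ : ℝ} {u h : ℝ → ℝ → ℝ} (S : LocSol a μ u h) {s T : ℝ} (hs : 0 < s) :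
    ∃ B, 0 < B ∧ ∀ t ∈ Icc s T, ∀ x, |u t x| ≤ B := by
  obtain ⟨N0, hN0, uN⟩ := l1_bdd S.ui S.uc (t := T) (half_pos hs)
  obtain ⟨H, hH0, hH⟩ := l1_bdd S.hi S.hc (t := T) (half_pos hs)
  set N := N0 + 1 with hN
  have Np : 0 < N := by positivity
  have μp := S.μp
  have lim : Tendsto (fun ε : ℝ => 16 * μ * N / ε^2) (𝓝[>] 0) atTop := by
    have : Tendsto (fun ε : ℝ => ε^2) (𝓝[>] 0) (𝓝[>] 0) := by
      refine tendsto_nhdsWithin_iff.2 ⟨?_, ?_⟩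
      · have := (continuous_pow 2 : Continuous fun ε : ℝ => ε^2).tendsto 0
        simp at this
        exact this.mono_left nhdsWithin_le_nhds
      · filter_upwards [self_mem_nhdsWithin] with ε hε
        have hε' : 0 < ε := hε
        exact pow_pos hε' 2
    exact (this.inv_tendsto_nhdsGT_zero).const_mul_atTop (show 0 < 16 * μ * N by positivity)
  obtain ⟨ε, hε, εp⟩ := ((lim.eventually (eventually_gt_atTop (2 * H + 2 * N / (s/2)))).and self_mem_nhdsWithin).exists
  have εp' : 0 < ε := εp
  refine ⟨4 * N / ε, by positivity, fun t ht x => ?_⟩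
  have h1 : t - s/2 < t := by linarith
  have e1 : t - (t - s/2) = s/2 := by ring
  have mem : ∀ τ ∈ Icc (t - s/2) t, τ ∈ Icc (s/2) T := fun τ hτ => ⟨by linarith [hτ.1, ht.1], hτ.2.trans ht.2⟩
  rw [abs_le]
  constructor
  · have := S.neg.crude (s := t - s/2) (T := t) (N := N) (H := H) (ε := ε) (by linarith [ht.1]) h1 Np
      (fun τ hτ => by simp only [abs_neg]; linarith [uN τ (mem τ hτ)]) (fun τ hτ => by simp only [abs_neg]; linarith [hH τ (mem τ hτ)]) εp'
      (by rw [e1]; exact hε) x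
    linarith
  · exact S.crude (s := t - s/2) (T := t) (N := N) (H := H) (ε := ε) (by linarith [ht.1]) h1 Np
      (fun τ hτ => by linarith [uN τ (mem τ hτ)]) (fun τ hτ => by linarith [hH τ (mem τ hτ)]) εp'
      (by rw [e1]; exact hε) x

end Aux

namespace Aux
open Set Topology

structure Ent (β β1 β2 : ℝ → ℝ) : Prop where
  d0 : ∀ w, HasDerivAt β (β1 w) w
  d1 : ∀ w, HasDerivAt β1 (β2 w) w
  c2 : Continuous β2
  nn : ∀ w, 0 ≤ β2 w
  b1 : ∀ w, |β1 w| ≤ 1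
  cv : ∀ v w, β w - β v ≤ β1 w * (w - v)

lemma Ent.cont {β β1 β2 : ℝ → ℝ} (E : Ent β β1 β2) : Continuous β :=
  continuous_iff_continuousAt.2 fun v => (E.d0 v).continuousAt
lemma Ent.cont1 {β β1 β2 : ℝ → ℝ} (E : Ent β β1 β2) : Continuous β1 :=
  continuous_iff_continuousAt.2 fun v => (E.d1 v).continuousAt
lemma Ent.lip {β β1 β2 : ℝ → ℝ} (E : Ent β β1 β2) (v w : ℝ) : |β w - β v| ≤ |w - v| := by
  have key : ∀ v w, β w - β v ≤ |w - v| := fun v w =>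
    (E.cv v w).trans ((le_abs_self _).trans (by
      rw [abs_mul]; exact mul_le_of_le_one_left (abs_nonneg _) (E.b1 w)))
  rw [abs_le]
  have h1 := key w v
  rw [abs_sub_comm] at h1
  exact ⟨by linarith, key v w⟩

lemma ent_id : Ent (fun w => w) (fun _ => 1) (fun _ => 0) where
  d0 w := hasDerivAt_id' w
  d1 w := hasDerivAt_const _ _
  c2 := continuous_const
  nn w := le_rfl
  b1 w := by simp
  cv v w := by simp

lemma ent_sqrt {ε : ℝ} (hε : 0 < ε) : Ent (fun w => √(w^2+ε^2) - ε) (fun w => w / √(w^2+ε^2))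
    (fun w => ε^2 / ((w^2+ε^2) * √(w^2+ε^2))) := by
  have pos : ∀ w : ℝ, 0 < w^2+ε^2 := fun w => by positivity
  have sp : ∀ w : ℝ, 0 < √(w^2+ε^2) := fun w => Real.sqrt_pos.2 (pos w)
  have ss : ∀ w : ℝ, √(w^2+ε^2) * √(w^2+ε^2) = w^2+ε^2 := fun w => Real.mul_self_sqrt (pos w).le
  have ds : ∀ w : ℝ, HasDerivAt (fun w => √(w^2+ε^2)) (w / √(w^2+ε^2)) w := by
    intro w
    have h1 : HasDerivAt (fun w : ℝ => w^2+ε^2) (2*w) w := by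
      have := (hasDerivAt_pow 2 w).add_const (ε^2)
      simpa using this
    refine (h1.sqrt (pos w).ne').congr_deriv ?_
    have := (sp w).ne'
    field_simp
  have hs : ∀ w : ℝ, |w| ≤ √(w^2+ε^2) := fun w => Real.abs_le_sqrt (by nlinarith)
  refine ⟨fun w => (ds w).sub_const ε, fun w => ?_, ?_, fun w => by positivity, fun w => ?_, fun v w => ?_⟩
  · refine ((hasDerivAt_id' w).fun_div (ds w) (sp w).ne').congr_deriv ?_
    have h1 := (sp w).ne'; have h2 := (pos w).ne'
    have h3 : √(w^2+ε^2)^2 = w^2+ε^2 := by rw [sq, ss]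
    rw [h3]
    field_simp
    rw [h3]; ring
  · refine Continuous.div (by fun_prop) (by fun_prop) fun w => (mul_pos (pos w) (sp w)).ne'
  · rw [abs_div, abs_of_pos (sp w), div_le_one (sp w)]; exact hs w
  · have h1 : v * w + ε^2 ≤ √(v^2+ε^2) * √(w^2+ε^2) := by
      rw [← Real.sqrt_mul (pos v).le]
      refine Real.le_sqrt_of_sq_le ?_
      nlinarith [mul_nonneg (sq_nonneg (v - w)) (sq_nonneg ε)]
    have h2 : w / √(w^2+ε^2) * (w - v) = (w^2 - v*w)/√(w^2+ε^2) := by ring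
    rw [h2, le_div_iff₀ (sp w)]
    have := ss w
    nlinarith

/-- entropy production density and functional -/
noncomputable def gE (a : ℝ → ℝ) (μ : ℝ) (u h : ℝ → ℝ → ℝ) (β β1 χ : ℝ → ℝ) (c d t : ℝ) : ℝ :=
  ∫ x in Ioc c d, (fl (fun w => a w * β1 w) (u t x) * deriv χ x + μ * β (u t x) * deriv (deriv χ) x + β1 (u t x) * χ x * h t x)

lemma bdd_int {f g : ℝ → ℝ} {c d : ℝ} (hf : IntegrableOn f (Ioc c d)) (hg : Continuous g) :
    IntegrableOn (fun x => g x * f x) (Ioc c d) := by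
  obtain ⟨M, hM⟩ := (isCompact_Icc (a := c) (b := d)).exists_bound_of_continuousOn hg.continuousOn
  refine Integrable.bdd_mul (c := M) hf hg.aestronglyMeasurable ?_
  filter_upwards [ae_restrict_mem measurableSet_Ioc] with x hx
  exact hM x ⟨hx.1.le, hx.2⟩

lemma parts {a : ℝ → ℝ} {μ : ℝ} {u h : ℝ → ℝ → ℝ} (S : LocSol a μ u h) {β β1 β2 χ : ℝ → ℝ} (E : Ent β β1 β2)
    (χ2 : ContDiff ℝ 2 χ) (χ0 : ∀ x, 0 ≤ χ x) {c d : ℝ} (hcd : c ≤ d) (hc : χ c = 0) (hd : χ d = 0) (hc' : deriv χ c = 0) (hd' : deriv χ d = 0)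
    {t : ℝ} (ht : 0 < t) :
    ∫ x in Ioc c d, β1 (u t x) * χ x * deriv (fun s => u s x) t ≤ gE a μ u h β β1 χ c d t := by
  have c1 := cd_c1 (S.u2 t ht); have c2 := cd_c2 (S.u2 t ht); have c0 := (S.u2 t ht).continuous
  have x0 := χ2.continuous; have x1 := cd_c1 χ2; have x2 := cd_c2 χ2
  have b0 := E.cont; have b1 := E.cont1; have b2 := E.c2; have ac := S.ac
  have Fc : Continuous fun w => a w * β1 w := by fun_prop
  set F := fl (fun w => a w * β1 w) with hF
  have Fcc : Continuous F := continuous_iff_continuousAt.2 fun v => (fl_deriv Fc v).continuousAt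
  set e' : ℝ → ℝ := fun x => μ * (β2 (u t x) * deriv (u t) x * deriv (u t) x + β1 (u t x) * deriv (deriv (u t)) x) * χ x
    + μ * (β1 (u t x) * deriv (u t) x) * deriv χ x - (μ * (β1 (u t x) * deriv (u t) x) * deriv χ x + μ * β (u t x) * deriv (deriv χ) x)
    - (a (u t x) * β1 (u t x) * deriv (u t) x * χ x + F (u t x) * deriv χ x) with he'
  have key : ∫ x in c..d, e' x = 0 := by
    rw [intervalIntegral.integral_eq_sub_of_hasDerivAt
      (f := fun x => μ * (β1 (u t x) * deriv (u t) x) * χ x - μ * β (u t x) * deriv χ x - F (u t x) * χ x)]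
    · simp [hc, hd, hc', hd']
    · intro x _
      have u0 := cd_d0 (S.u2 t ht) x
      have u1 := cd_d1 (S.u2 t ht) x
      have y0 := cd_d0 χ2 x
      have y1 := cd_d1 χ2 x
      have B0 : HasDerivAt (fun x => β (u t x)) (β1 (u t x) * deriv (u t) x) x := (E.d0 (u t x)).comp x u0
      have B1 : HasDerivAt (fun x => β1 (u t x)) (β2 (u t x) * deriv (u t) x) x := (E.d1 (u t x)).comp x u0
      have F0 : HasDerivAt (fun x => F (u t x)) (a (u t x) * β1 (u t x) * deriv (u t) x) x := (fl_deriv Fc (u t x)).comp x u0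
      exact ((((B1.fun_mul u1).const_mul μ).fun_mul y0).fun_sub ((B0.const_mul μ).fun_mul y1)).fun_sub (F0.fun_mul y0)
    · exact Continuous.intervalIntegrable (by simp only [he']; fun_prop) _ _
  rw [intervalIntegral.integral_of_le hcd] at key
  have ie : IntegrableOn e' (Ioc c d) := Continuous.integrableOn_Ioc (by simp only [he']; fun_prop)
  have cc : Continuous fun x => β1 (u t x) * χ x := by fun_prop
  have i1 : IntegrableOn (fun x => β1 (u t x) * χ x * deriv (fun s => u s x) t) (Ioc c d) := bdd_int (S.r0_int ht c d) cc
  have ih : IntegrableOn (fun x => β1 (u t x) * χ x * h t x) (Ioc c d) := bdd_int (S.hi t ht).integrableOn cc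
  have i2 : IntegrableOn (fun x => F (u t x) * deriv χ x + μ * β (u t x) * deriv (deriv χ) x + β1 (u t x) * χ x * h t x) (Ioc c d) := by
    refine Integrable.add ?_ ih
    exact Continuous.integrableOn_Ioc (by fun_prop)
  unfold gE
  rw [← hF]
  calc _ ≤ ∫ x in Ioc c d, (F (u t x) * deriv χ x + μ * β (u t x) * deriv (deriv χ) x + β1 (u t x) * χ x * h t x + e' x) := by
        refine integral_mono i1 (i2.add ie) fun x => ?_
        simp only [he', S.pde t ht x]
        have : 0 ≤ μ * β2 (u t x) * deriv (u t) x^2 * χ x := by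
          have := S.μp; have := E.nn (u t x); have := χ0 x; positivity
        nlinarith
    _ = _ := by
        rw [integral_add i2 ie, key, add_zero]

lemma ent_right {a : ℝ → ℝ} {μ : ℝ} {u h : ℝ → ℝ → ℝ} (S : LocSol a μ u h) {β β1 β2 χ : ℝ → ℝ} (E : Ent β β1 β2)
    (χc : Continuous χ) (χ0 : ∀ x, 0 ≤ χ x) (χ1 : ∀ x, χ x ≤ 1) (c d : ℝ) {t : ℝ} (ht : 0 < t) {ε : ℝ} (hε : 0 < ε) :
    ∀ᶠ η in 𝓝[>] (0:ℝ), (∫ x in Ioc c d, β (u (t+η) x) * χ x) - (∫ x in Ioc c d, β (u t x) * χ x)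
      ≤ η * ((∫ x in Ioc c d, β1 (u t x) * χ x * deriv (fun s => u s x) t) + ε) := by
  have b0 := E.cont; have b1 := E.cont1
  have lim : Tendsto (fun η => ∫ x in Ioc c d, β1 (u (t+η) x) * χ x * deriv (fun s => u s x) t) (𝓝[>] 0)
      (𝓝 (∫ x in Ioc c d, β1 (u t x) * χ x * deriv (fun s => u s x) t)) := by
    refine tendsto_integral_filter_of_dominated_convergence (fun x => |deriv (fun s => u s x) t|) ?_ ?_ (S.r0_int ht c d).abs ?_
    · filter_upwards [self_mem_nhdsWithin] with η hη
      have hη' : 0 < η := hη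
      have := (S.u2 (t+η) (by linarith)).continuous
      exact (bdd_int (S.r0_int ht c d) (by fun_prop)).aestronglyMeasurable
    · refine Eventually.of_forall fun η => Eventually.of_forall fun x => ?_
      rw [Real.norm_eq_abs, abs_mul, abs_mul, abs_of_nonneg (χ0 x)]
      refine mul_le_of_le_one_left (abs_nonneg _) ?_
      exact mul_le_one₀ (E.b1 _) (χ0 x) (χ1 x)
    · refine Eventually.of_forall fun x => ?_
      have h1 : ContinuousAt (fun s => u s x) t := (S.dt ht x).continuousAt
      have h2 : Tendsto (fun η => t + η) (𝓝[>] 0) (𝓝 t) := by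
        have := (show Continuous fun η : ℝ => t + η by fun_prop).tendsto 0
        simp at this
        exact this.mono_left nhdsWithin_le_nhds
      have h3 := (b1.tendsto (u t x)).comp (h1.tendsto.comp h2)
      exact (h3.mul_const (χ x)).mul_const _
  filter_upwards [D_abs S c d ht (half_pos hε), lim.eventually (gt_mem_nhds (lt_add_of_pos_right _ (half_pos hε))), self_mem_nhdsWithin] with η h1 h2 hη
  have hη' : 0 < η := hη
  have tη : 0 < t + η := by linarith
  have cu := (S.u2 t ht).continuous; have cu' := (S.u2 (t+η) tη).continuous
  have i0 : IntegrableOn (fun x => β (u t x) * χ x) (Ioc c d) := Continuous.integrableOn_Ioc (by fun_prop)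
  have i0' : IntegrableOn (fun x => β (u (t+η) x) * χ x) (Ioc c d) := Continuous.integrableOn_Ioc (by fun_prop)
  have i1 : IntegrableOn (fun x => β1 (u (t+η) x) * χ x * deriv (fun s => u s x) t) (Ioc c d) := bdd_int (S.r0_int ht c d) (by fun_prop)
  have i2 : IntegrableOn (fun x => |u (t+η) x - u t x - η * deriv (fun s => u s x) t|) (Ioc c d) :=
    (((S.ui _ tη).integrableOn.sub (S.ui _ ht).integrableOn).sub ((S.r0_int ht c d).const_mul η)).abs
  rw [← integral_sub i0' i0]
  calc _ ≤ ∫ x in Ioc c d, (η * (β1 (u (t+η) x) * χ x * deriv (fun s => u s x) t) + |u (t+η) x - u t x - η * deriv (fun s => u s x) t|) := by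
        refine integral_mono (i0'.sub i0) ((i1.const_mul η).add i2) fun x => ?_
        have k1 := mul_le_mul_of_nonneg_right (E.cv (u t x) (u (t+η) x)) (χ0 x)
        have k2 : β1 (u (t+η) x) * χ x * (u (t+η) x - u t x - η * deriv (fun s => u s x) t) ≤ |u (t+η) x - u t x - η * deriv (fun s => u s x) t| := by
          refine (le_abs_self _).trans ?_
          rw [abs_mul, abs_mul, abs_of_nonneg (χ0 x)]
          refine mul_le_of_le_one_left (abs_nonneg _) ?_
          exact mul_le_one₀ (E.b1 _) (χ0 x) (χ1 x)
        show β (u (t+η) x) * χ x - β (u t x) * χ x ≤ _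
        nlinarith
    _ = η * (∫ x in Ioc c d, β1 (u (t+η) x) * χ x * deriv (fun s => u s x) t) + ∫ x in Ioc c d, |u (t+η) x - u t x - η * deriv (fun s => u s x) t| := by
        rw [integral_add (i1.const_mul η) i2, integral_const_mul]
    _ ≤ η * ((∫ x in Ioc c d, β1 (u t x) * χ x * deriv (fun s => u s x) t) + ε/2) + ε/2*η := by gcongr
    _ = _ := by ring

theorem entC {a : ℝ → ℝ} {μ : ℝ} {u h : ℝ → ℝ → ℝ} (S : LocSol a μ u h) {β β1 β2 χ : ℝ → ℝ} (E : Ent β β1 β2)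
    (χ2 : ContDiff ℝ 2 χ) (χ0 : ∀ x, 0 ≤ χ x) (χ1 : ∀ x, χ x ≤ 1) {c d : ℝ} (hcd : c ≤ d) (hc : χ c = 0) (hd : χ d = 0) (hc' : deriv χ c = 0) (hd' : deriv χ d = 0)
    {s t M : ℝ} (hs : 0 < s) (hst : s ≤ t) (hM : ∀ τ ∈ Icc s t, gE a μ u h β β1 χ c d τ ≤ M) :
    (∫ x in Ioc c d, β (u t x) * χ x) - (∫ x in Ioc c d, β (u s x) * χ x) ≤ M * (t - s) := by
  have b0 := E.cont; have x0 := χ2.continuous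
  set P : ℝ → ℝ := fun τ => ∫ x in Ioc c d, β (u τ x) * χ x with hP
  have ii : ∀ τ, 0 < τ → IntegrableOn (fun x => β (u τ x) * χ x) (Ioc c d) := fun τ hτ => by
    have := (S.u2 τ hτ).continuous
    exact Continuous.integrableOn_Ioc (by fun_prop)
  have Pc : ContinuousOn P (Icc s t) := by
    intro t₀ ht₀
    have h0 : 0 < t₀ := hs.trans_le ht₀.1
    refine ContinuousAt.continuousWithinAt ?_
    refine tendsto_iff_dist_tendsto_zero.mpr ?_
    refine squeeze_zero' (Eventually.of_forall fun _ => dist_nonneg) ?_ (S.uc t₀ h0)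
    filter_upwards [Ioi_mem_nhds h0] with τ hτ
    have i1 : Integrable (fun x => |u τ x - u t₀ x|) := ((S.ui τ hτ).sub (S.ui t₀ h0)).abs
    rw [Real.dist_eq, hP, ← integral_sub (ii τ hτ) (ii t₀ h0)]
    refine abs_integral_le_integral_abs.trans (le_trans ?_ (setIntegral_le_integral (s := Ioc c d) i1 (Eventually.of_forall fun x => abs_nonneg _)))
    refine integral_mono (((ii τ hτ).sub (ii t₀ h0)).abs) i1.integrableOn fun x => ?_
    show |β (u τ x) * χ x - β (u t₀ x) * χ x| ≤ _
    rw [← sub_mul, abs_mul, abs_of_nonneg (χ0 x)]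
    exact (mul_le_of_le_one_right (abs_nonneg _) (χ1 x)).trans (E.lip _ _)
  have main := image_le_of_liminf_slope_right_le_deriv_boundary (f := P) (a := s) (b := t) (B := fun τ => P s + M * (τ - s)) (B' := fun _ => M)
    Pc (by simp) (by fun_prop) (fun x _ => by
      have := (((hasDerivAt_id' x).sub_const s).const_mul M).const_add (P s)
      simpa using this.hasDerivWithinAt) (by
      intro x hx r hr
      have x0 : 0 < x := hs.trans_le hx.1
      have e := ent_right S E χ2.continuous χ0 χ1 c d x0 (half_pos (sub_pos.2 hr))
      have p := (parts S E χ2 χ0 hcd hc hd hc' hd' x0).trans (hM x ⟨hx.1, hx.2.le⟩)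
      have h6 : Tendsto (fun τ : ℝ => τ - x) (𝓝[>] x) (𝓝[>] 0) := by
        refine tendsto_nhdsWithin_iff.2 ⟨?_, ?_⟩
        · have := (show Continuous fun τ : ℝ => τ - x by fun_prop).tendsto x
          simp at this
          exact this.mono_left nhdsWithin_le_nhds
        · filter_upwards [self_mem_nhdsWithin] with τ hτ
          have hτ2 : x < τ := hτ
          exact sub_pos.2 hτ2
      have e2 := h6.eventually e
      refine Eventually.frequently ?_
      filter_upwards [e2, self_mem_nhdsWithin] with z hz hzx
      have hzx2 : x < z := hzx
      have hzx' : 0 < z - x := sub_pos.2 hzx2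
      rw [slope_def_field, div_lt_iff₀ hzx']
      have ex : x + (z - x) = z := by ring
      rw [ex] at hz
      refine lt_of_le_of_lt hz ?_
      rw [mul_comm]
      refine mul_lt_mul_of_pos_right ?_ hzx'
      linarith)
  have := main ⟨hst, le_rfl⟩
  linarith

end Aux

namespace Aux
open Set Topology

/-- cutoff functions -/
lemma cutoff : ∃ C : ℝ, 0 < C ∧ ∀ R : ℝ, 1 ≤ R → ∃ b : ℝ → ℝ, ContDiff ℝ 2 b ∧ (∀ x, 0 ≤ b x) ∧ (∀ x, b x ≤ 1) ∧
    (∀ x ∈ Icc (-R) R, b x = 1) ∧ (∀ x, x ∉ Ioc (-(3*R)) (3*R) → b x = 0) ∧ b (-(3*R)) = 0 ∧ b (3*R) = 0 ∧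
    deriv b (-(3*R)) = 0 ∧ deriv b (3*R) = 0 ∧ (∀ x, |deriv b x| ≤ C/R) ∧ (∀ x, |deriv (deriv b) x| ≤ C/R) ∧
    (∀ x, x ∉ Ioc (-(3*R)) (3*R) → deriv b x = 0 ∧ deriv (deriv b) x = 0) := by
  let B : ContDiffBump (0:ℝ) := ⟨1, 2, by norm_num, by norm_num⟩
  have B2 : ContDiff ℝ 2 (B : ℝ → ℝ) := B.contDiff
  have hB : HasCompactSupport (B : ℝ → ℝ) := B.hasCompactSupport
  have hB1 : HasCompactSupport (deriv (B : ℝ → ℝ)) := hB.deriv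
  have hB2 : HasCompactSupport (deriv (deriv (B : ℝ → ℝ))) := hB1.deriv
  obtain ⟨C1, h1⟩ := hB1.exists_bound_of_continuous (cd_c1 B2)
  obtain ⟨C2, h2⟩ := hB2.exists_bound_of_continuous (cd_c2 B2)
  have C10 : 0 ≤ C1 := (norm_nonneg _).trans (h1 0)
  have C20 : 0 ≤ C2 := (norm_nonneg _).trans (h2 0)
  refine ⟨C1 + C2 + 1, by positivity, fun R hR => ?_⟩
  have R0 : 0 < R := by linarith
  have z0 : ∀ x : ℝ, 2 ≤ |x| → B x = 0 := fun x hx => B.zero_of_le_dist (by simpa [B] using hx)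
  have d0 : ∀ x, HasDerivAt (fun x => B (x/R)) (deriv B (x/R) / R) x := fun x => by
    have := (cd_d0 B2 (x/R)).comp x ((hasDerivAt_id' x).div_const R)
    exact this.congr_deriv (by ring)
  have d1 : ∀ x, HasDerivAt (fun x => deriv B (x/R) / R) (deriv (deriv B) (x/R) / R / R) x := fun x => by
    have := ((cd_d1 B2 (x/R)).comp x ((hasDerivAt_id' x).div_const R)).div_const R
    exact this.congr_deriv (by ring)
  have e0 : deriv (fun x => B (x/R)) = fun x => deriv B (x/R) / R := funext fun x => (d0 x).deriv
  have e1 : deriv (fun x => deriv B (x/R) / R) = fun x => deriv (deriv B) (x/R) / R / R := funext fun x => (d1 x).deriv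
  have dz : ∀ x : ℝ, 2 < |x| → deriv B x = 0 := fun x hx => by
    have : (B : ℝ → ℝ) =ᶠ[𝓝 x] fun _ => 0 := by
      filter_upwards [(isOpen_lt continuous_const continuous_abs).mem_nhds hx] with y hy
      exact z0 y (le_of_lt hy)
    rw [this.deriv_eq]; simp
  have dz2 : ∀ x : ℝ, 2 < |x| → deriv (deriv B) x = 0 := fun x hx => by
    have : (deriv B : ℝ → ℝ) =ᶠ[𝓝 x] fun _ => 0 := by
      filter_upwards [(isOpen_lt continuous_const continuous_abs).mem_nhds hx] with y hy
      exact dz y hy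
    rw [this.deriv_eq]; simp
  have q3 : 3 * R / R = 3 := by field_simp
  have q3' : -(3 * R) / R = -3 := by field_simp
  have bb : ∀ c, 0 ≤ c → c ≤ C1 + C2 + 1 → c / R ≤ (C1 + C2 + 1)/R := fun c _ h => by gcongr
  refine ⟨fun x => B (x/R), B2.comp (by fun_prop), fun x => B.nonneg, fun x => B.le_one, fun x hx => ?_, fun x hx => ?_, ?_, ?_, ?_, ?_, fun x => ?_, fun x => ?_, fun x hx => ?_⟩
  · refine B.one_of_mem_closedBall ?_
    simp only [B, Metric.mem_closedBall, Real.dist_eq, sub_zero]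
    rw [abs_div, abs_of_pos R0, div_le_one R0]
    exact abs_le.2 hx
  · refine z0 _ ?_
    rw [abs_div, abs_of_pos R0, le_div_iff₀ R0]
    by_contra hh
    push Not at hh
    have := abs_lt.1 hh
    exact hx ⟨by linarith, by linarith⟩
  · show B (-(3*R)/R) = 0
    rw [q3']; exact z0 _ (by norm_num)
  · show B ((3*R)/R) = 0
    rw [q3]; exact z0 _ (by norm_num)
  · rw [e0]; simp only [q3']; rw [dz _ (by norm_num)]; simp
  · rw [e0]; simp only [q3]; rw [dz _ (by norm_num)]; simp
  · rw [e0]; simp only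
    rw [abs_div, abs_of_pos R0]
    exact bb _ (abs_nonneg _) (by have := h1 (x/R); rw [Real.norm_eq_abs] at this; linarith)
  · rw [e0, e1]; simp only
    rw [abs_div, abs_div, abs_of_pos R0]
    have : |deriv (deriv B) (x/R)| / R ≤ |deriv (deriv B) (x/R)| := div_le_self (abs_nonneg _) hR
    have := h2 (x/R)
    rw [Real.norm_eq_abs] at this
    exact bb _ (by positivity) (by linarith)
  · have : 2 < |x/R| := by
      rw [abs_div, abs_of_pos R0, lt_div_iff₀ R0]
      by_contra hh
      push Not at hh
      have := abs_le.1 hh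
      exact hx ⟨by linarith, by linarith⟩
    rw [e0, e1]; simp only
    rw [dz _ this, dz2 _ this]; simp

end Aux

namespace Aux
open Set Topology

noncomputable def iW (a : ℝ → ℝ) (μ : ℝ) (u h : ℝ → ℝ → ℝ) (β β1 χ : ℝ → ℝ) (t x : ℝ) : ℝ :=
  fl (fun w => a w * β1 w) (u t x) * deriv χ x + μ * β (u t x) * deriv (deriv χ) x + β1 (u t x) * χ x * h t x

noncomputable def gW (a : ℝ → ℝ) (μ : ℝ) (u h : ℝ → ℝ → ℝ) (β β1 χ : ℝ → ℝ) (t : ℝ) : ℝ :=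
  ∫ x, iW a μ u h β β1 χ t x

lemma tail_mono {f : ℝ → ℝ} (hf : Integrable f) {R R' : ℝ} (h : R ≤ R') :
    ∫ x in (Icc (-R') R')ᶜ, |f x| ≤ ∫ x in (Icc (-R) R)ᶜ, |f x| := by
  refine setIntegral_mono_set hf.abs.integrableOn (Eventually.of_forall fun x => abs_nonneg _) (LE.le.eventuallyLE ?_)
  exact compl_subset_compl.2 (Icc_subset_Icc (by linarith) h)

lemma Ent.le_abs {β β1 β2 : ℝ → ℝ} (E : Ent β β1 β2) (z : β 0 = 0) (w : ℝ) : |β w| ≤ |w| := by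
  have := E.lip 0 w
  simpa [z] using this

lemma Ent.int {β β1 β2 : ℝ → ℝ} (E : Ent β β1 β2) (z : β 0 = 0) {v χ : ℝ → ℝ} (hv : Integrable v) (χc : Continuous χ)
    (χ0 : ∀ x, 0 ≤ χ x) (χ1 : ∀ x, χ x ≤ 1) : Integrable fun x => β (v x) * χ x := by
  refine hv.mono ((E.cont.comp_aestronglyMeasurable hv.1).mul χc.aestronglyMeasurable) (Eventually.of_forall fun x => ?_)
  rw [norm_mul, Real.norm_eq_abs, Real.norm_eq_abs, abs_of_nonneg (χ0 x)]
  exact (mul_le_of_le_one_right (abs_nonneg _) (χ1 x)).trans (E.le_abs z _)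

lemma LocSol.iW_int {a : ℝ → ℝ} {μ : ℝ} {u h : ℝ → ℝ → ℝ} (S : LocSol a μ u h) {β β1 β2 χ : ℝ → ℝ} (E : Ent β β1 β2) (z : β 0 = 0)
    (χ2 : ContDiff ℝ 2 χ) (χ0 : ∀ x, 0 ≤ χ x) (χ1 : ∀ x, χ x ≤ 1) {D : ℝ} (D1 : ∀ x, |deriv χ x| ≤ D) (D2 : ∀ x, |deriv (deriv χ) x| ≤ D)
    {t : ℝ} (ht : 0 < t) : Integrable (iW a μ u h β β1 χ t) := by
  have ac := S.ac; have b1 := E.cont1; have b0 := E.cont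
  have acc : Continuous fun w => a w * β1 w := by fun_prop
  obtain ⟨B, B0, hB⟩ := S.bdd (s := t) (T := t) ht
  obtain ⟨A, A0, hA⟩ := fl_lip acc B
  have uc := (S.u2 t ht).continuous
  have c1 := cd_c1 χ2; have c2 := cd_c2 χ2; have c0 := χ2.continuous
  have flc : Continuous (fl fun w => a w * β1 w) := continuous_iff_continuousAt.2 fun v => (fl_deriv acc v).continuousAt
  have fl0 : fl (fun w => a w * β1 w) 0 = 0 := by simp [fl]
  have i1 : Integrable fun x => fl (fun w => a w * β1 w) (u t x) * deriv χ x := by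
    refine ((S.ui t ht).norm.const_mul (A * D)).mono' (by fun_prop) (Eventually.of_forall fun x => ?_)
    have := hA (u t x) 0 (hB t ⟨le_rfl, le_rfl⟩ x) (by simpa using B0.le)
    rw [fl0, sub_zero, sub_zero] at this
    rw [norm_mul, Real.norm_eq_abs, Real.norm_eq_abs, Real.norm_eq_abs]
    calc _ ≤ (A * |u t x|) * D := mul_le_mul this (D1 x) (abs_nonneg _) (by positivity)
      _ = _ := by ring
  have i2 : Integrable fun x => μ * β (u t x) * deriv (deriv χ) x := by
    refine ((S.ui t ht).norm.const_mul (μ * D)).mono' (by fun_prop) (Eventually.of_forall fun x => ?_)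
    rw [norm_mul, norm_mul, Real.norm_eq_abs, Real.norm_eq_abs, Real.norm_eq_abs, Real.norm_eq_abs, abs_of_pos S.μp]
    have := S.μp.le
    calc _ ≤ (μ * |u t x|) * D := mul_le_mul (mul_le_mul_of_nonneg_left (E.le_abs z _) this) (D2 x) (abs_nonneg _) (by positivity)
      _ = _ := by ring
  have i3 : Integrable fun x => β1 (u t x) * χ x * h t x := by
    refine (S.hi t ht).bdd_mul (c := 1) (by fun_prop) (Eventually.of_forall fun x => ?_)
    rw [norm_mul, Real.norm_eq_abs, Real.norm_eq_abs, abs_of_nonneg (χ0 x)]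
    exact mul_le_one₀ (E.b1 _) (χ0 x) (χ1 x)
  exact (i1.add i2).add i3

theorem entW {a : ℝ → ℝ} {μ : ℝ} {u h : ℝ → ℝ → ℝ} (S : LocSol a μ u h) {β β1 β2 χ : ℝ → ℝ} (E : Ent β β1 β2) (z : β 0 = 0)
    (χ2 : ContDiff ℝ 2 χ) (χ0 : ∀ x, 0 ≤ χ x) (χ1 : ∀ x, χ x ≤ 1) {D : ℝ} (D1 : ∀ x, |deriv χ x| ≤ D) (D2 : ∀ x, |deriv (deriv χ) x| ≤ D)
    {s t M : ℝ} (hs : 0 < s) (hst : s ≤ t) (hM : ∀ τ ∈ Icc s t, gW a μ u h β β1 χ τ ≤ M) :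
    (∫ x, β (u t x) * χ x) - (∫ x, β (u s x) * χ x) ≤ M * (t - s) := by
  have ac := S.ac; have b1 := E.cont1; have b0 := E.cont
  have acc : Continuous fun w => a w * β1 w := by fun_prop
  have D0 : 0 ≤ D := (abs_nonneg _).trans (D1 0)
  have μ0 := S.μp.le
  obtain ⟨B, B0, hB⟩ := S.bdd (s := s) (T := t) hs
  obtain ⟨A, A0, hA⟩ := fl_lip acc B
  obtain ⟨N, N0, hN⟩ := l1_bdd S.ui S.uc (t := t) hs
  have fl0 : fl (fun w => a w * β1 w) 0 = 0 := by simp [fl]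
  obtain ⟨C, C0, cut⟩ := cutoff
  set κ := A*C + 2*μ*D*C + μ*C with hκ
  have κ0 : 0 ≤ κ := by positivity
  suffices key : ∀ δ : ℝ, 0 < δ → (∫ x, β (u t x) * χ x) - (∫ x, β (u s x) * χ x) ≤ (M + ((A*D+μ*D)*δ + δ + κ*N*δ)) * (t - s) + 2*δ by
    have lim : Tendsto (fun δ : ℝ => (M + ((A*D+μ*D)*δ + δ + κ*N*δ)) * (t - s) + 2*δ) (𝓝[>] 0) (𝓝 (M * (t - s))) := by
      have := (show Continuous fun δ : ℝ => (M + ((A*D+μ*D)*δ + δ + κ*N*δ)) * (t - s) + 2*δ by fun_prop).tendsto 0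
      simp at this
      exact this.mono_left nhdsWithin_le_nhds
    refine ge_of_tendsto lim ?_
    filter_upwards [self_mem_nhdsWithin] with δ hδ using key δ hδ
  intro δ hδ
  obtain ⟨R1, R10, hR1⟩ := tails S.ui S.uc (T := t) hs hδ
  obtain ⟨R2, R20, hR2⟩ := tails S.hi S.hc (T := t) hs hδ
  set R := max (max R1 R2) (max 1 (1/δ)) with hR
  have Ra : 1 ≤ R := (le_max_left _ _).trans (le_max_right _ _)
  have Rb : 1/δ ≤ R := (le_max_right _ _).trans (le_max_right _ _)
  have Rc : R1 ≤ R := (le_max_left _ _).trans (le_max_left _ _)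
  have Rd : R2 ≤ R := (le_max_right _ _).trans (le_max_left _ _)
  have R0 : 0 < R := by linarith
  have Rδ : 1 / R ≤ δ := by
    rw [div_le_iff₀ R0]; rw [div_le_iff₀ hδ] at Rb; linarith
  have tu : ∀ τ ∈ Icc s t, ∫ x in (Icc (-R) R)ᶜ, |u τ x| ≤ δ := fun τ hτ =>
    (tail_mono (S.ui τ (hs.trans_le hτ.1)) Rc).trans (hR1 τ hτ)
  have th : ∀ τ ∈ Icc s t, ∫ x in (Icc (-R) R)ᶜ, |h τ x| ≤ δ := fun τ hτ =>
    (tail_mono (S.hi τ (hs.trans_le hτ.1)) Rd).trans (hR2 τ hτ)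
  obtain ⟨b, bC, bp, b1', bone, bout, ba, bb, ba', bb', bd1, bd2, bout'⟩ := cut R Ra
  have ms : MeasurableSet (Icc (-R) R)ᶜ := measurableSet_Icc.compl
  set ψ : ℝ → ℝ := fun x => χ x * b x with hψ
  have dψ : ∀ x, HasDerivAt ψ (deriv χ x * b x + χ x * deriv b x) x := fun x => (cd_d0 χ2 x).fun_mul (cd_d0 bC x)
  have eψ : deriv ψ = fun x => deriv χ x * b x + χ x * deriv b x := funext fun x => (dψ x).deriv
  have eψ2 : deriv (deriv ψ) = fun x => (deriv (deriv χ) x * b x + deriv χ x * deriv b x) + (deriv χ x * deriv b x + χ x * deriv (deriv b) x) := by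
    rw [eψ]
    exact funext fun x => (((cd_d1 χ2 x).fun_mul (cd_d0 bC x)).fun_add ((cd_d0 χ2 x).fun_mul (cd_d1 bC x))).deriv
  have ψ2 : ContDiff ℝ 2 ψ := χ2.mul bC
  have ψ0 : ∀ x, 0 ≤ ψ x := fun x => mul_nonneg (χ0 x) (bp x)
  have ψ1 : ∀ x, ψ x ≤ 1 := fun x => mul_le_one₀ (χ1 x) (bp x) (b1' x)
  have one_sub : ∀ x, 1 - b x ≤ (Icc (-R) R)ᶜ.indicator (fun _ => (1:ℝ)) x := fun x => by
    by_cases hx : x ∈ Icc (-R) R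
    · rw [bone x hx]; simp [hx]
    · rw [indicator_of_mem (show x ∈ (Icc (-R) R)ᶜ from hx)]; linarith [bp x]
  have ind_mul : ∀ (f : ℝ → ℝ) x, (Icc (-R) R)ᶜ.indicator (fun _ => (1:ℝ)) x * f x = (Icc (-R) R)ᶜ.indicator f x := fun f x => by
    by_cases hx : x ∈ (Icc (-R) R)ᶜ
    · rw [indicator_of_mem hx, indicator_of_mem hx, one_mul]
    · rw [indicator_of_notMem hx, indicator_of_notMem hx, zero_mul]
  -- comparison of the integrals
  have P : ∀ τ ∈ Icc s t, |(∫ x in Ioc (-(3*R)) (3*R), β (u τ x) * ψ x) - ∫ x, β (u τ x) * χ x| ≤ δ := by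
    intro τ hτ
    have τ0 := hs.trans_le hτ.1
    rw [setIntegral_eq_integral_of_forall_compl_eq_zero (fun x hx => by simp [hψ, bout x hx])]
    rw [← integral_sub (E.int z (S.ui τ τ0) ψ2.continuous ψ0 ψ1) (E.int z (S.ui τ τ0) χ2.continuous χ0 χ1)]
    refine abs_integral_le_integral_abs.trans (le_trans ?_ (tu τ hτ))
    rw [← integral_indicator ms]
    refine integral_mono (((E.int z (S.ui τ τ0) ψ2.continuous ψ0 ψ1)).sub (E.int z (S.ui τ τ0) χ2.continuous χ0 χ1)).abs
      ((S.ui τ τ0).abs.indicator ms) fun x => ?_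
    show |β (u τ x) * (χ x * b x) - β (u τ x) * χ x| ≤ (Icc (-R) R)ᶜ.indicator (fun x => |u τ x|) x
    rw [← ind_mul]
    have : β (u τ x) * (χ x * b x) - β (u τ x) * χ x = - (β (u τ x) * χ x * (1 - b x)) := by ring
    rw [this, abs_neg, abs_mul, abs_mul, abs_of_nonneg (χ0 x), abs_of_nonneg (sub_nonneg.2 (b1' x)), mul_comm]
    refine mul_le_mul (one_sub x) ((mul_le_of_le_one_right (abs_nonneg _) (χ1 x)).trans (E.le_abs z _)) (mul_nonneg (abs_nonneg _) (χ0 x)) ?_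
    exact (sub_nonneg.2 (b1' x)).trans (one_sub x)
  have G : ∀ τ ∈ Icc s t, gE a μ u h β β1 ψ (-(3*R)) (3*R) τ ≤ M + ((A*D+μ*D)*δ + δ + κ*N*δ) := by
    intro τ hτ
    have τ0 := hs.trans_le hτ.1
    refine le_trans ?_ (add_le_add (hM τ hτ) le_rfl)
    have hz : ∀ x, x ∉ Ioc (-(3*R)) (3*R) → iW a μ u h β β1 ψ τ x = 0 := by
      intro x hx
      unfold iW
      rw [eψ2, eψ]
      simp [hψ, bout x hx, bout' x hx]
    have DD : 0 ≤ C / R := by positivity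
    have dψ1 : ∀ x, |deriv ψ x| ≤ D + 2*D*(C/R) + C/R := by
      intro x
      rw [eψ]
      have h1 : |deriv χ x * b x| ≤ D := by
        rw [abs_mul, abs_of_nonneg (bp x)]; exact (mul_le_of_le_one_right (abs_nonneg _) (b1' x)).trans (D1 x)
      have h2 : |χ x * deriv b x| ≤ C/R := by
        rw [abs_mul, abs_of_nonneg (χ0 x)]; exact (mul_le_of_le_one_left (abs_nonneg _) (χ1 x)).trans (bd1 x)
      have h3 : 0 ≤ 2*D*(C/R) := by positivity
      exact (abs_add_le _ _).trans (by linarith)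
    have mm : ∀ x, |deriv χ x * deriv b x| ≤ D * (C/R) := fun x => by
      rw [abs_mul]; exact mul_le_mul (D1 x) (bd1 x) (abs_nonneg _) D0
    have mm2 : ∀ x, |χ x * deriv (deriv b) x| ≤ C/R := fun x => by
      rw [abs_mul, abs_of_nonneg (χ0 x)]; exact (mul_le_of_le_one_left (abs_nonneg _) (χ1 x)).trans (bd2 x)
    have mm3 : ∀ x, |χ x * deriv b x| ≤ C/R := fun x => by
      rw [abs_mul, abs_of_nonneg (χ0 x)]; exact (mul_le_of_le_one_left (abs_nonneg _) (χ1 x)).trans (bd1 x)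
    have dψ2 : ∀ x, |deriv (deriv ψ) x| ≤ D + 2*D*(C/R) + C/R := by
      intro x
      rw [eψ2]
      have h1 : |deriv (deriv χ) x * b x| ≤ D := by
        rw [abs_mul, abs_of_nonneg (bp x)]; exact (mul_le_of_le_one_right (abs_nonneg _) (b1' x)).trans (D2 x)
      refine (abs_add_le _ _).trans ?_
      have := abs_add_le (deriv (deriv χ) x * b x) (deriv χ x * deriv b x)
      have := abs_add_le (deriv χ x * deriv b x) (χ x * deriv (deriv b) x)
      have := mm x; have := mm2 x
      linarith
    have iψ := S.iW_int E z ψ2 ψ0 ψ1 dψ1 dψ2 τ0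
    have iχ := S.iW_int E z χ2 χ0 χ1 D1 D2 τ0
    have e1 : gE a μ u h β β1 ψ (-(3*R)) (3*R) τ = ∫ x, iW a μ u h β β1 ψ τ x :=
      setIntegral_eq_integral_of_forall_compl_eq_zero hz
    have iu := (S.ui τ τ0).abs; have ih := (S.hi τ τ0).abs
    have j1 : Integrable fun x => (A*D+μ*D) * (Icc (-R) R)ᶜ.indicator (fun x => |u τ x|) x := (iu.indicator ms).const_mul _
    have j2 : Integrable fun x => (Icc (-R) R)ᶜ.indicator (fun x => |h τ x|) x := ih.indicator ms
    have j3 : Integrable fun x => κ / R * |u τ x| := iu.const_mul _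
    have le : ∫ x, iW a μ u h β β1 ψ τ x ≤ ∫ x, (iW a μ u h β β1 χ τ x + (((A*D+μ*D) * (Icc (-R) R)ᶜ.indicator (fun x => |u τ x|) x + (Icc (-R) R)ᶜ.indicator (fun x => |h τ x|) x) + κ / R * |u τ x|)) := by
      refine integral_mono iψ (iχ.add ((j1.add j2).add j3)) fun x => ?_
      show iW a μ u h β β1 ψ τ x ≤ iW a μ u h β β1 χ τ x + (((A*D+μ*D) * (Icc (-R) R)ᶜ.indicator (fun x => |u τ x|) x + (Icc (-R) R)ᶜ.indicator (fun x => |h τ x|) x) + κ / R * |u τ x|)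
      rw [← ind_mul (fun x => |u τ x|), ← ind_mul (fun x => |h τ x|)]
      unfold iW
      rw [eψ2, eψ]
      simp only [hψ]
      have hF := hA (u τ x) 0 (hB τ hτ x) (by simpa using B0.le)
      rw [fl0, sub_zero, sub_zero] at hF
      have hβ := E.le_abs z (u τ x)
      have hβ1 := E.b1 (u τ x)
      set F := fl (fun w => a w * β1 w) (u τ x)
      set b0 := β (u τ x)
      set c0 := β1 (u τ x)
      set i0 := (Icc (-R) R)ᶜ.indicator (fun _ => (1:ℝ)) x
      have o1 : 0 ≤ 1 - b x := sub_nonneg.2 (b1' x)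
      have o2 : 1 - b x ≤ i0 := one_sub x
      set U := |u τ x|
      have U0 : 0 ≤ U := abs_nonneg _
      have k0 : ∀ p q P Q : ℝ, |p| ≤ P → |q| ≤ Q → p * q ≤ P * Q := fun p q P Q h1 h2 =>
        (le_abs_self _).trans (by rw [abs_mul]; exact mul_le_mul h1 h2 (abs_nonneg _) ((abs_nonneg _).trans h1))
      have k1 : -(F * deriv χ x) ≤ (A*U) * D := by
        rw [← neg_mul]; exact k0 _ _ _ _ (by rw [abs_neg]; exact hF) (D1 x)
      have k2 : -(b0 * deriv (deriv χ) x) ≤ U * D := by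
        rw [← neg_mul]; exact k0 _ _ _ _ (by rw [abs_neg]; exact hβ) (D2 x)
      have k3 : -(c0 * χ x * h τ x) ≤ 1 * |h τ x| := by
        rw [← neg_mul]
        refine k0 _ _ _ _ ?_ le_rfl
        rw [abs_neg, abs_mul, abs_of_nonneg (χ0 x)]
        exact mul_le_one₀ hβ1 (χ0 x) (χ1 x)
      have k4 : F * (χ x * deriv b x) ≤ (A * U) * (C/R) := k0 _ _ _ _ hF (mm3 x)
      have k5 : b0 * (deriv χ x * deriv b x) ≤ U * (D * (C/R)) := k0 _ _ _ _ hβ (mm x)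
      have k6 : b0 * (χ x * deriv (deriv b) x) ≤ U * (C/R) := k0 _ _ _ _ hβ (mm2 x)
      have l1 : (1 - b x) * (-(F * deriv χ x) + μ * (-(b0 * deriv (deriv χ) x)) + -(c0 * χ x * h τ x)) ≤ i0 * ((A*U)*D + μ * (U*D) + 1 * |h τ x|) := by
        refine (mul_le_mul_of_nonneg_left (add_le_add (add_le_add k1 (mul_le_mul_of_nonneg_left k2 μ0)) k3) o1).trans ?_
        exact mul_le_mul_of_nonneg_right o2 (by positivity)
      have l2 := mul_le_mul_of_nonneg_left k5 μ0
      have l3 := mul_le_mul_of_nonneg_left k6 μ0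
      have eκ : κ / R * U = A * U * (C/R) + 2 * (μ * (U * (D * (C/R)))) + μ * (U * (C/R)) := by
        rw [hκ]; ring
      rw [eκ]
      linarith
    rw [e1]
    refine le.trans ?_
    have j123 : Integrable fun x => ((A*D+μ*D) * (Icc (-R) R)ᶜ.indicator (fun x => |u τ x|) x + (Icc (-R) R)ᶜ.indicator (fun x => |h τ x|) x) + κ / R * |u τ x| := (j1.add j2).add j3
    rw [integral_add iχ j123]
    have e2 : (∫ x, (((A*D+μ*D) * (Icc (-R) R)ᶜ.indicator (fun x => |u τ x|) x + (Icc (-R) R)ᶜ.indicator (fun x => |h τ x|) x) + κ / R * |u τ x|))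
        = ((A*D+μ*D) * (∫ x in (Icc (-R) R)ᶜ, |u τ x|) + ∫ x in (Icc (-R) R)ᶜ, |h τ x|) + κ / R * ∫ x, |u τ x| := by
      have j12 : Integrable fun x => (A*D+μ*D) * (Icc (-R) R)ᶜ.indicator (fun x => |u τ x|) x + (Icc (-R) R)ᶜ.indicator (fun x => |h τ x|) x := j1.add j2
      rw [integral_add j12 j3, integral_add j1 j2, integral_const_mul, integral_const_mul, integral_indicator ms, integral_indicator ms]
    refine add_le_add le_rfl ?_
    refine e2.le.trans ?_
    refine add_le_add (add_le_add (mul_le_mul_of_nonneg_left (tu τ hτ) (by positivity)) (th τ hτ)) ?_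
    calc κ / R * ∫ x, |u τ x| ≤ κ / R * N := mul_le_mul_of_nonneg_left (hN τ hτ) (by positivity)
      _ = κ * N * (1/R) := by ring
      _ ≤ κ * N * δ := by gcongr
  have fin := entC S E ψ2 ψ0 ψ1 (c := -(3*R)) (d := 3*R) (by linarith) (by simp [hψ, ba]) (by simp [hψ, bb])
    (by rw [eψ]; simp [ba, ba']) (by rw [eψ]; simp [bb, bb']) hs hst G
  have p1 := abs_le.1 (P t ⟨hst, le_rfl⟩)
  have p2 := abs_le.1 (P s ⟨le_rfl, hst⟩)
  linarith [p1.1, p2.2]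

end Aux

namespace Aux
open Set Topology

lemma ent_neg : Ent (fun w => -w) (fun _ => -1) (fun _ => 0) where
  d0 w := hasDerivAt_neg' w
  d1 w := hasDerivAt_const _ _
  c2 := continuous_const
  nn w := le_rfl
  b1 w := by simp
  cv v w := by linarith

lemma small_int {v f : ℝ → ℝ} (hv : Integrable v) (hf : Integrable f) {ε R δ : ℝ} (hR : 0 < R) (h1 : ∀ x, f x ≤ ε) (h2 : ∀ x, f x ≤ |v x|)
    (ht : ∫ x in (Icc (-R) R)ᶜ, |v x| ≤ δ) : ∫ x, f x ≤ ε * (2*R) + δ := by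
  rw [← integral_add_compl (s := Icc (-R) R) measurableSet_Icc hf]
  refine add_le_add ?_ (le_trans ?_ ht)
  · calc ∫ x in Icc (-R) R, f x ≤ ∫ x in Icc (-R) R, ε := integral_mono hf.integrableOn (integrable_const _) h1
      _ = ε * (2*R) := by
        rw [setIntegral_const]; simp [Measure.real]
        rw [ENNReal.toReal_ofReal (by linarith)]; ring
  · exact integral_mono hf.integrableOn hv.abs.integrableOn h2

theorem contr {a : ℝ → ℝ} {μ Λ : ℝ} {u h k : ℝ → ℝ → ℝ} (S : LocSol a μ u h) (hΛ : 0 ≤ Λ) (hh : ∀ t, 0 < t → ∀ x, h t x = Λ * (k t x - u t x))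
    (ki : ∀ t, 0 < t → Integrable (k t)) (kb : ∀ t, 0 < t → ∫ x, |k t x| ≤ ∫ x, |u t x|) {s t : ℝ} (hs : 0 < s) (hst : s ≤ t) :
    ∫ x, |u t x| ≤ ∫ x, |u s x| := by
  suffices key : ∀ δ : ℝ, 0 < δ → ∫ x, |u t x| ≤ (∫ x, |u s x|) + ((Λ * (2*δ)) * (t - s) + 2*δ) by
    have lim : Tendsto (fun δ : ℝ => (∫ x, |u s x|) + ((Λ * (2*δ)) * (t - s) + 2*δ)) (𝓝[>] 0) (𝓝 (∫ x, |u s x|)) := by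
      have := (show Continuous fun δ : ℝ => (∫ x, |u s x|) + ((Λ * (2*δ)) * (t - s) + 2*δ) by fun_prop).tendsto 0
      simp at this
      exact this.mono_left nhdsWithin_le_nhds
    refine ge_of_tendsto lim ?_
    filter_upwards [self_mem_nhdsWithin] with δ hδ using key δ hδ
  intro δ hδ
  obtain ⟨R, R0, hR⟩ := tails S.ui S.uc (T := t) hs hδ
  set ε := δ / (2*R) with hε
  have ε0 : 0 < ε := by positivity
  have εR : ε * (2*R) = δ := by rw [hε]; field_simp
  have E := ent_sqrt ε0
  have sp : ∀ w : ℝ, 0 < √(w^2+ε^2) := fun w => Real.sqrt_pos.2 (by positivity)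
  have sle : ∀ w : ℝ, √(w^2+ε^2) ≤ |w| + ε := fun w => by
    refine Real.sqrt_le_iff.2 ⟨by positivity, ?_⟩
    nlinarith [sq_abs w, mul_nonneg (abs_nonneg w) ε0.le]
  have sge : ∀ w : ℝ, |w| ≤ √(w^2+ε^2) := fun w => Real.abs_le_sqrt (by nlinarith)
  have sge' : ∀ w : ℝ, ε ≤ √(w^2+ε^2) := fun w => Real.le_sqrt_of_sq_le (by nlinarith [sq_nonneg w])
  have z : (fun w => √(w^2+ε^2) - ε) 0 = 0 := by simp [Real.sqrt_sq ε0.le]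
  have d1 : deriv (fun _ : ℝ => (1:ℝ)) = fun _ => 0 := by simp
  have d2 : deriv (deriv (fun _ : ℝ => (1:ℝ))) = fun _ => 0 := by simp
  have main := entW S E z (χ := fun _ => 1) (D := 0) contDiff_const (fun _ => zero_le_one) (fun _ => le_rfl) (by simp) (by simp) (M := Λ * (2*δ)) hs hst ?_
  · simp only [mul_one] at main
    have t0 := hs.trans_le hst
    have it := E.int z (S.ui t t0) (χ := fun _ => 1) continuous_const (fun _ => zero_le_one) (fun _ => le_rfl)
    have is := E.int z (S.ui s hs) (χ := fun _ => 1) continuous_const (fun _ => zero_le_one) (fun _ => le_rfl)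
    simp only [mul_one] at it is
    have m1 : ∫ x, (√((u s x)^2+ε^2) - ε) ≤ ∫ x, |u s x| := integral_mono is (S.ui s hs).abs fun x => by
      have := sle (u s x); show _ - _ ≤ |_|; linarith
    have m2 : ∫ x, (|u t x| - (√((u t x)^2+ε^2) - ε)) ≤ ε * (2*R) + δ := by
      refine small_int (S.ui t t0) ((S.ui t t0).abs.sub it) R0 (fun x => ?_) (fun x => ?_) (hR t ⟨hst, le_rfl⟩)
      · have := sge (u t x); show |u t x| - (√((u t x)^2+ε^2) - ε) ≤ ε; linarith
      · have := sge' (u t x); show |u t x| - (√((u t x)^2+ε^2) - ε) ≤ |u t x|; linarith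
    rw [integral_sub (S.ui t t0).abs it, εR] at m2
    linarith
  · intro τ hτ
    have τ0 := hs.trans_le hτ.1
    unfold gW iW
    rw [d2, d1]
    simp only [mul_zero, zero_add, mul_one]
    have uc := (S.u2 τ τ0).continuous
    have cβ : Continuous fun x => u τ x / √((u τ x)^2+ε^2) := E.cont1.comp uc
    have bβ : ∀ x, ‖u τ x / √((u τ x)^2+ε^2)‖ ≤ 1 := fun x => E.b1 (u τ x)
    have i1 : Integrable fun x => u τ x / √((u τ x)^2+ε^2) * k τ x := (ki τ τ0).bdd_mul cβ.aestronglyMeasurable (Eventually.of_forall bβ)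
    have i2 : Integrable fun x => u τ x / √((u τ x)^2+ε^2) * u τ x := (S.ui τ τ0).bdd_mul cβ.aestronglyMeasurable (Eventually.of_forall bβ)
    have e : (fun x => u τ x / √((u τ x)^2+ε^2) * h τ x) = fun x => Λ * (u τ x / √((u τ x)^2+ε^2) * k τ x - u τ x / √((u τ x)^2+ε^2) * u τ x) := by
      funext x; rw [hh τ τ0]; ring
    rw [e, integral_const_mul, integral_sub i1 i2]
    refine mul_le_mul_of_nonneg_left ?_ hΛ
    have m1 : ∫ x, u τ x / √((u τ x)^2+ε^2) * k τ x ≤ ∫ x, |k τ x| := integral_mono i1 (ki τ τ0).abs fun x => by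
      refine (le_abs_self _).trans ?_
      rw [abs_mul]
      exact mul_le_of_le_one_left (abs_nonneg _) (bβ x)
    have m2 : ∫ x, (|u τ x| - u τ x / √((u τ x)^2+ε^2) * u τ x) ≤ ε * (2*R) + δ := by
      refine small_int (S.ui τ τ0) ((S.ui τ τ0).abs.sub i2) R0 (fun x => ?_) (fun x => ?_) (hR τ hτ)
      · have h1 := sle (u τ x)
        have : |u τ x| - ε ≤ u τ x / √((u τ x)^2+ε^2) * u τ x := by
          rw [div_mul_eq_mul_div, le_div_iff₀ (sp _)]
          have h2 := sge (u τ x)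
          have h3 := abs_mul_abs_self (u τ x)
          rcases le_total (|u τ x|) ε with h | h
          · nlinarith [sp (u τ x), abs_nonneg (u τ x)]
          · nlinarith [abs_nonneg (u τ x)]
        show |u τ x| - u τ x / √((u τ x)^2+ε^2) * u τ x ≤ ε
        linarith
      · have : 0 ≤ u τ x / √((u τ x)^2+ε^2) * u τ x := by
          rw [div_mul_eq_mul_div]; exact div_nonneg (mul_self_nonneg _) (sp _).le
        show |u τ x| - u τ x / √((u τ x)^2+ε^2) * u τ x ≤ |u τ x|
        linarith
    rw [integral_sub (S.ui τ τ0).abs i2, εR] at m2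
    linarith [kb τ τ0]

theorem massc {a : ℝ → ℝ} {μ : ℝ} {u h : ℝ → ℝ → ℝ} (S : LocSol a μ u h) (h0 : ∀ t, 0 < t → ∫ x, h t x = 0) {s t : ℝ} (hs : 0 < s) (hst : s ≤ t) :
    ∫ x, u t x = ∫ x, u s x := by
  have d1 : deriv (fun _ : ℝ => (1:ℝ)) = fun _ => 0 := by simp
  have d2 : deriv (deriv (fun _ : ℝ => (1:ℝ))) = fun _ => 0 := by simp
  have m1 := entW S ent_id rfl (χ := fun _ => 1) (D := 0) contDiff_const (fun _ => zero_le_one) (fun _ => le_rfl) (by simp) (by simp) (M := 0) hs hst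
    (fun τ hτ => by
      unfold gW iW
      rw [d2, d1]
      simp [h0 τ (hs.trans_le hτ.1)])
  have m2 := entW S ent_neg neg_zero (χ := fun _ => 1) (D := 0) contDiff_const (fun _ => zero_le_one) (fun _ => le_rfl) (by simp) (by simp) (M := 0) hs hst
    (fun τ hτ => by
      unfold gW iW
      rw [d2, d1]
      simp [integral_neg, h0 τ (hs.trans_le hτ.1)])
  simp [integral_neg] at m1 m2
  linarith

end Aux

namespace Aux
open Set Topology

lemma gW_cont {a : ℝ → ℝ} {μ : ℝ} {u h : ℝ → ℝ → ℝ} (S : LocSol a μ u h) {χ : ℝ → ℝ}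
    (χ2 : ContDiff ℝ 2 χ) (χ0 : ∀ x, 0 ≤ χ x) (χ1 : ∀ x, χ x ≤ 1) {D : ℝ} (D1 : ∀ x, |deriv χ x| ≤ D) (D2 : ∀ x, |deriv (deriv χ) x| ≤ D)
    {t : ℝ} (ht : 0 < t) : Tendsto (fun τ => gW a μ u h (fun w => w) (fun _ => 1) χ τ) (𝓝 t) (𝓝 (gW a μ u h (fun w => w) (fun _ => 1) χ t)) := by
  have ac := S.ac
  have D0 : 0 ≤ D := (abs_nonneg _).trans (D1 0)
  have μ0 := S.μp.le
  have acc : Continuous fun w => a w * 1 := by fun_prop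
  obtain ⟨B, B0, hB⟩ := S.bdd (s := t/2) (T := t+1) (half_pos ht)
  obtain ⟨A, A0, hA⟩ := fl_lip acc B
  refine tendsto_iff_dist_tendsto_zero.mpr ?_
  have lim : Tendsto (fun τ => (A*D+μ*D) * (∫ x, |u τ x - u t x|) + ∫ x, |h τ x - h t x|) (𝓝 t) (𝓝 0) := by
    have := ((S.uc t ht).const_mul (A*D+μ*D)).add (S.hc t ht)
    simpa using this
  refine squeeze_zero' (Eventually.of_forall fun _ => dist_nonneg) ?_ lim
  filter_upwards [Icc_mem_nhds (show t/2 < t by linarith) (show t < t+1 by linarith)] with τ hτ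
  have τ0 : 0 < τ := by linarith [hτ.1]
  have ht' : t ∈ Icc (t/2) (t+1) := ⟨by linarith, by linarith⟩
  have i1 := S.iW_int ent_id rfl χ2 χ0 χ1 D1 D2 τ0
  have i2 := S.iW_int ent_id rfl χ2 χ0 χ1 D1 D2 ht
  have j1 : Integrable fun x => (A*D+μ*D) * |u τ x - u t x| := ((S.ui τ τ0).sub (S.ui t ht)).abs.const_mul _
  have j2 : Integrable fun x => |h τ x - h t x| := ((S.hi τ τ0).sub (S.hi t ht)).abs
  unfold gW
  rw [Real.dist_eq, ← integral_sub i1 i2, ← integral_const_mul, ← integral_add j1 j2]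
  refine abs_integral_le_integral_abs.trans (integral_mono (i1.sub i2).abs (j1.add j2) fun x => ?_)
  show |iW a μ u h (fun w => w) (fun _ => 1) χ τ x - iW a μ u h (fun w => w) (fun _ => 1) χ t x| ≤ (A*D+μ*D) * |u τ x - u t x| + |h τ x - h t x|
  unfold iW
  have k1 := hA (u τ x) (u t x) (hB τ hτ x) (hB t ht' x)
  set F := fl (fun w => a w * 1) (u τ x)
  set F' := fl (fun w => a w * 1) (u t x)
  have e : F * deriv χ x + μ * u τ x * deriv (deriv χ) x + 1 * χ x * h τ x - (F' * deriv χ x + μ * u t x * deriv (deriv χ) x + 1 * χ x * h t x)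
    = ((F - F') * deriv χ x + (μ * (u τ x - u t x)) * deriv (deriv χ) x) + χ x * (h τ x - h t x) := by ring
  show |F * deriv χ x + μ * u τ x * deriv (deriv χ) x + 1 * χ x * h τ x - (F' * deriv χ x + μ * u t x * deriv (deriv χ) x + 1 * χ x * h t x)| ≤ _
  rw [e]
  refine (abs_add_le _ _).trans (add_le_add ((abs_add_le _ _).trans ?_) ?_)
  · rw [abs_mul, abs_mul, abs_mul, abs_of_nonneg μ0]
    have l1 : |F - F'| * |deriv χ x| ≤ (A * |u τ x - u t x|) * D := mul_le_mul k1 (D1 x) (abs_nonneg _) (by positivity)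
    have l2 : μ * |u τ x - u t x| * |deriv (deriv χ) x| ≤ μ * |u τ x - u t x| * D := mul_le_mul_of_nonneg_left (D2 x) (by positivity)
    linarith
  · rw [abs_mul, abs_of_nonneg (χ0 x)]
    exact mul_le_of_le_one_left (abs_nonneg _) (χ1 x)

lemma Q_der {a : ℝ → ℝ} {μ : ℝ} {u h : ℝ → ℝ → ℝ} (S : LocSol a μ u h) {χ : ℝ → ℝ}
    (χ2 : ContDiff ℝ 2 χ) (χ0 : ∀ x, 0 ≤ χ x) (χ1 : ∀ x, χ x ≤ 1) {D : ℝ} (D1 : ∀ x, |deriv χ x| ≤ D) (D2 : ∀ x, |deriv (deriv χ) x| ≤ D)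
    {t : ℝ} (ht : 0 < t) {ε : ℝ} (hε : 0 < ε) : ∀ᶠ η in 𝓝[>] (0:ℝ),
      |(∫ x, u (t+η) x * χ x) - (∫ x, u t x * χ x) - η * gW a μ u h (fun w => w) (fun _ => 1) χ t| ≤ ε * η := by
  have c := gW_cont S χ2 χ0 χ1 D1 D2 ht
  obtain ⟨δ, δ0, hδ⟩ := Metric.eventually_nhds_iff.1 (Metric.tendsto_nhds.1 c ε hε)
  filter_upwards [Ioo_mem_nhdsGT δ0] with η hη
  have b : ∀ τ ∈ Icc t (t+η), |gW a μ u h (fun w => w) (fun _ => 1) χ τ - gW a μ u h (fun w => w) (fun _ => 1) χ t| ≤ ε := fun τ hτ => by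
    refine (hδ ?_).le
    rw [Real.dist_eq, abs_lt]
    exact ⟨by linarith [hτ.1], by linarith [hτ.2, hη.2]⟩
  have m1 := entW S ent_id rfl χ2 χ0 χ1 D1 D2 (t := t+η) (M := gW a μ u h (fun w => w) (fun _ => 1) χ t + ε) ht (by linarith [hη.1]) (fun τ hτ => by
    have := abs_le.1 (b τ hτ); linarith [this.2])
  have m2 := entW S ent_neg neg_zero χ2 χ0 χ1 D1 D2 (t := t+η) (M := -gW a μ u h (fun w => w) (fun _ => 1) χ t + ε) ht (by linarith [hη.1]) (fun τ hτ => by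
    have := abs_le.1 (b τ hτ)
    have e : gW a μ u h (fun w => -w) (fun _ => -1) χ τ = - gW a μ u h (fun w => w) (fun _ => 1) χ τ := by
      unfold gW
      rw [← integral_neg]
      congr 1; funext x
      unfold iW
      have : fl (fun w => a w * -1) (u τ x) = - fl (fun w => a w * 1) (u τ x) := by simp [fl]
      rw [this]; ring
    rw [e]; linarith [this.1])
  simp only [neg_mul, integral_neg] at m2
  rw [abs_le]
  have e : t + η - t = η := by ring
  rw [e] at m1 m2
  constructor <;> nlinarith

/-- smooth step -/
lemma stepfn : ∃ (χ : ℝ → ℝ) (D : ℝ), ContDiff ℝ 2 χ ∧ (∀ x, 0 ≤ χ x) ∧ (∀ x, χ x ≤ 1) ∧ (∀ x, |deriv χ x| ≤ D) ∧ (∀ x, |deriv (deriv χ) x| ≤ D) ∧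
    (∀ x, x ≤ -1 → χ x = 1) ∧ (∀ x, 0 ≤ x → χ x = 0) ∧ (∀ x, x ∉ Ioo (-1) 0 → deriv χ x = 0) ∧ (∀ x, x ∉ Ioo (-1) 0 → deriv (deriv χ) x = 0) := by
  set χ : ℝ → ℝ := fun x => Real.smoothTransition (-x) with hχ
  have χ2 : ContDiff ℝ 2 χ := Real.smoothTransition.contDiff.comp (by fun_prop)
  have a1 : ∀ x, x ≤ -1 → χ x = 1 := fun x hx => Real.smoothTransition.one_of_one_le (by linarith)
  have a2 : ∀ x, 0 ≤ x → χ x = 0 := fun x hx => Real.smoothTransition.zero_of_nonpos (by linarith)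
  have gen : ∀ f : ℝ → ℝ, Continuous (deriv f) → (∃ c, ∀ x, x < -1 → f x = c) → (∃ c, ∀ x, 0 < x → f x = c) → ∀ x, x ∉ Ioo (-1) 0 → deriv f x = 0 := by
    intro f fc ⟨c, hc⟩ ⟨d, hd⟩ x hx
    have b1 : ∀ x, x < -1 → deriv f x = 0 := fun x hx => by
      have : f =ᶠ[𝓝 x] fun _ => c := by filter_upwards [Iio_mem_nhds hx] with y hy using hc y hy
      rw [this.deriv_eq]; simp
    have b2 : ∀ x, 0 < x → deriv f x = 0 := fun x hx => by
      have : f =ᶠ[𝓝 x] fun _ => d := by filter_upwards [Ioi_mem_nhds hx] with y hy using hd y hy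
      rw [this.deriv_eq]; simp
    have cl : IsClosed {x | deriv f x = 0} := isClosed_eq fc continuous_const
    have k1 : closure (Iio (-1:ℝ)) ⊆ {x | deriv f x = 0} := cl.closure_subset_iff.2 fun y hy => b1 y hy
    have k2 : closure (Ioi (0:ℝ)) ⊆ {x | deriv f x = 0} := cl.closure_subset_iff.2 fun y hy => b2 y hy
    rw [closure_Iio] at k1
    rw [closure_Ioi] at k2
    rcases le_or_gt x (-1) with h | h
    · exact k1 h
    · exact k2 (not_lt.1 fun h' => hx ⟨h, h'⟩)
  have g1 := gen χ (cd_c1 χ2) ⟨1, fun x hx => a1 x hx.le⟩ ⟨0, fun x hx => a2 x hx.le⟩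
  have g2 := gen (deriv χ) (cd_c2 χ2) ⟨0, fun x hx => g1 x fun h => by linarith [h.1]⟩ ⟨0, fun x hx => g1 x fun h => by linarith [h.2]⟩
  obtain ⟨M1, h1⟩ := (isCompact_Icc (a := (-1:ℝ)) (b := 0)).exists_bound_of_continuousOn (cd_c1 χ2).continuousOn
  obtain ⟨M2, h2⟩ := (isCompact_Icc (a := (-1:ℝ)) (b := 0)).exists_bound_of_continuousOn (cd_c2 χ2).continuousOn
  have M10 := (norm_nonneg _).trans (h1 0 (by simp))
  have M20 := (norm_nonneg _).trans (h2 0 (by simp))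
  refine ⟨χ, max M1 M2, χ2, fun x => Real.smoothTransition.nonneg _, fun x => Real.smoothTransition.le_one _, fun x => ?_, fun x => ?_, a1, a2, g1, g2⟩
  · by_cases hx : x ∈ Ioo (-1:ℝ) 0
    · exact (h1 x ⟨hx.1.le, hx.2.le⟩).trans (le_max_left _ _)
    · rw [g1 x hx, abs_zero]; exact M10.trans (le_max_left _ _)
  · by_cases hx : x ∈ Ioo (-1:ℝ) 0
    · exact (h2 x ⟨hx.1.le, hx.2.le⟩).trans (le_max_right _ _)
    · rw [g2 x hx, abs_zero]; exact M20.trans (le_max_right _ _)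

end Aux

namespace Aux
open Set Topology

lemma split_int {χ v : ℝ → ℝ} (χc : Continuous χ) (χ0 : ∀ x, 0 ≤ χ x) (χ1 : ∀ x, χ x ≤ 1) (a1 : ∀ x, x ≤ -1 → χ x = 1) (a2 : ∀ x, 0 ≤ x → χ x = 0)
    (hv : Integrable v) : ∫ x in Iic 0, v x = (∫ x, χ x * v x) + ∫ x in Ioc (-1) 0, (1 - χ x) * v x := by
  have i1 : Integrable fun x => χ x * v x := hv.bdd_mul (c := 1) χc.aestronglyMeasurable (Eventually.of_forall fun x => by
    rw [Real.norm_eq_abs, abs_of_nonneg (χ0 x)]; exact χ1 x)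
  have i2 : Integrable fun x => (1 - χ x) * v x := hv.bdd_mul (c := 1) (by fun_prop) (Eventually.of_forall fun x => by
    rw [Real.norm_eq_abs, abs_of_nonneg (by linarith [χ1 x])]; linarith [χ0 x])
  have e1 : ∫ x, χ x * v x = ∫ x in Iic 0, χ x * v x := by
    refine (setIntegral_eq_integral_of_forall_compl_eq_zero fun x hx => ?_).symm
    rw [a2 x (le_of_lt (not_le.1 hx)), zero_mul]
  have e2 : ∫ x in Ioc (-1) 0, (1 - χ x) * v x = ∫ x in Iic 0, (1 - χ x) * v x := by
    refine (setIntegral_eq_of_subset_of_forall_diff_eq_zero measurableSet_Iic (fun x hx => hx.2) fun x hx => ?_).symm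
    have : x ≤ -1 := by
      by_contra hh
      exact hx.2 ⟨not_le.1 hh, hx.1⟩
    rw [a1 x this]; ring
  rw [e1, e2, ← integral_add i1.integrableOn i2.integrableOn]
  congr 1; funext x; ring

lemma V_t0 {a : ℝ → ℝ} {μ : ℝ} {u h : ℝ → ℝ → ℝ} (S : LocSol a μ u h) {t : ℝ} (ht : 0 < t) {ε : ℝ} (hε : 0 < ε) : ∀ᶠ η in 𝓝[>] (0:ℝ),
    |V u (t+η) 0 - V u t 0 - η * GG a μ u h t 0| ≤ ε * η := by
  obtain ⟨χ, D, χ2, χ0, χ1, D1, D2, a1, a2, g1, g2⟩ := stepfn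
  have χc := χ2.continuous
  have c1 := cd_c1 (S.u2 t ht); have c2 := cd_c2 (S.u2 t ht); have c0 := (S.u2 t ht).continuous
  have χc1 := cd_c1 χ2; have χc2 := cd_c2 χ2
  have ac := S.ac
  have flc : Continuous (fl a) := continuous_iff_continuousAt.2 fun v => (fl_deriv ac v).continuousAt
  have key : GG a μ u h t 0 = gW a μ u h (fun w => w) (fun _ => 1) χ t + ∫ x in Ioc (-1) 0, (1 - χ x) * deriv (fun s => u s x) t := by
    have ftc := intervalIntegral.integral_eq_sub_of_hasDerivAt (a := -1) (b := 0)
      (f := fun x => (1 - χ x) * (μ * deriv (u t) x - fl a (u t x)) + μ * (deriv χ x * u t x))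
      (f' := fun x => (1 - χ x) * (μ * deriv (deriv (u t)) x - a (u t x) * deriv (u t) x) + (fl a (u t x) * deriv χ x + μ * u t x * deriv (deriv χ) x))
      (fun x _ => by
        have d1 := (((cd_d1 (S.u2 t ht) x).const_mul μ).fun_sub ((fl_deriv S.ac (u t x)).comp x (cd_d0 (S.u2 t ht) x)))
        have d2 := ((cd_d0 χ2 x).const_sub 1).fun_mul d1
        have d3 := ((cd_d1 χ2 x).fun_mul (cd_d0 (S.u2 t ht) x)).const_mul μ
        refine (d2.fun_add d3).congr_deriv ?_
        simp only [Function.comp]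
        ring)
      (Continuous.intervalIntegrable (by fun_prop) _ _)
    have n1 : (-1:ℝ) ∉ Ioo (-1:ℝ) 0 := by simp
    have n2 : (0:ℝ) ∉ Ioo (-1:ℝ) 0 := by simp
    simp only [a1 (-1) le_rfl, a2 0 le_rfl, g1 _ n1, g1 _ n2] at ftc
    rw [intervalIntegral.integral_of_le (by norm_num)] at ftc
    have j1 : IntegrableOn (fun x => (1 - χ x) * (μ * deriv (deriv (u t)) x - a (u t x) * deriv (u t) x)) (Ioc (-1) 0) := Continuous.integrableOn_Ioc (by fun_prop)
    have j2 : IntegrableOn (fun x => fl a (u t x) * deriv χ x + μ * u t x * deriv (deriv χ) x) (Ioc (-1) 0) := Continuous.integrableOn_Ioc (by fun_prop)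
    rw [integral_add j1 j2] at ftc
    have j3 : IntegrableOn (fun x => (1 - χ x) * h t x) (Ioc (-1) 0) := bdd_int (S.hi t ht).integrableOn (by fun_prop)
    have e1 : ∫ x in Ioc (-1) 0, (1 - χ x) * deriv (fun s => u s x) t = (∫ x in Ioc (-1) 0, (1 - χ x) * h t x) + ∫ x in Ioc (-1) 0, (1 - χ x) * (μ * deriv (deriv (u t)) x - a (u t x) * deriv (u t) x) := by
      rw [← integral_add j3 j1]
      congr 1; funext x; rw [S.pde t ht x]; ring
    have zz : ∀ x, x ∉ Ioc (-1:ℝ) 0 → fl a (u t x) * deriv χ x + μ * u t x * deriv (deriv χ) x = 0 := fun x hx => by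
      have : x ∉ Ioo (-1:ℝ) 0 := fun h => hx ⟨h.1, h.2.le⟩
      rw [g1 x this, g2 x this]; ring
    have j4 : Integrable (fun x => fl a (u t x) * deriv χ x + μ * u t x * deriv (deriv χ) x) := by
      rw [← integrableOn_univ]
      refine j2.of_forall_diff_eq_zero MeasurableSet.univ fun x hx => zz x hx.2
    have j5 : Integrable fun x => χ x * h t x := (S.hi t ht).bdd_mul (c := 1) χc.aestronglyMeasurable (Eventually.of_forall fun x => by
      rw [Real.norm_eq_abs, abs_of_nonneg (χ0 x)]; exact χ1 x)
    have e2 : gW a μ u h (fun w => w) (fun _ => 1) χ t = (∫ x in Ioc (-1) 0, (fl a (u t x) * deriv χ x + μ * u t x * deriv (deriv χ) x)) + ∫ x, χ x * h t x := by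
      rw [setIntegral_eq_integral_of_forall_compl_eq_zero zz, ← integral_add j4 j5]
      unfold gW iW
      simp only [mul_one, one_mul]
    have e3 := split_int χc χ0 χ1 a1 a2 (S.hi t ht)
    unfold GG V
    rw [e1, e2, e3]
    linarith
  filter_upwards [Q_der S χ2 χ0 χ1 D1 D2 ht (half_pos hε), D_abs S (-1) 0 ht (half_pos hε), self_mem_nhdsWithin] with η h1 h2 h3
  have η0 : 0 < η := h3
  have tη : 0 < t + η := by linarith
  unfold V
  rw [split_int χc χ0 χ1 a1 a2 (S.ui _ tη), split_int χc χ0 χ1 a1 a2 (S.ui _ ht), key]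
  simp only [mul_comm (χ _)]
  have i0 := S.r0_int ht (-1) 0
  have k1 : IntegrableOn (fun x => (1 - χ x) * u (t+η) x) (Ioc (-1) 0) := bdd_int (S.ui _ tη).integrableOn (by fun_prop)
  have k2 : IntegrableOn (fun x => (1 - χ x) * u t x) (Ioc (-1) 0) := bdd_int (S.ui _ ht).integrableOn (by fun_prop)
  have k3 : IntegrableOn (fun x => (1 - χ x) * deriv (fun s => u s x) t) (Ioc (-1) 0) := bdd_int i0 (by fun_prop)
  have k12 : IntegrableOn (fun x => (1 - χ x) * u (t+η) x - (1 - χ x) * u t x) (Ioc (-1) 0) := k1.sub k2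
  have k4 : |(∫ x in Ioc (-1) 0, (1 - χ x) * u (t+η) x) - (∫ x in Ioc (-1) 0, (1 - χ x) * u t x) - η * ∫ x in Ioc (-1) 0, (1 - χ x) * deriv (fun s => u s x) t| ≤ ε/2*η := by
    rw [← integral_const_mul, ← integral_sub k1 k2, ← integral_sub k12 (k3.const_mul η)]
    refine abs_integral_le_integral_abs.trans (le_trans ?_ h2)
    have i2 : IntegrableOn (fun x => |u (t+η) x - u t x - η * deriv (fun s => u s x) t|) (Ioc (-1) 0) :=
      (((S.ui _ tη).integrableOn.sub (S.ui _ ht).integrableOn).sub (i0.const_mul η)).abs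
    refine integral_mono (k12.sub (k3.const_mul η)).abs i2 fun x => ?_
    show |(1 - χ x) * u (t+η) x - (1 - χ x) * u t x - η * ((1 - χ x) * deriv (fun s => u s x) t)| ≤ |u (t+η) x - u t x - η * deriv (fun s => u s x) t|
    have : (1 - χ x) * u (t+η) x - (1 - χ x) * u t x - η * ((1 - χ x) * deriv (fun s => u s x) t) = (1 - χ x) * (u (t+η) x - u t x - η * deriv (fun s => u s x) t) := by ring
    rw [this, abs_mul, abs_of_nonneg (by linarith [χ1 x])]
    exact mul_le_of_le_one_left (abs_nonneg _) (by linarith [χ0 x])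
  have := abs_add_le ((∫ x, u (t+η) x * χ x) - (∫ x, u t x * χ x) - η * gW a μ u h (fun w => w) (fun _ => 1) χ t)
    ((∫ x in Ioc (-1) 0, (1 - χ x) * u (t+η) x) - (∫ x in Ioc (-1) 0, (1 - χ x) * u t x) - η * ∫ x in Ioc (-1) 0, (1 - χ x) * deriv (fun s => u s x) t)
  refine le_trans (le_of_eq ?_) (this.trans (by linarith))
  congr 1; ring

theorem V_t {a : ℝ → ℝ} {μ : ℝ} {u h : ℝ → ℝ → ℝ} (S : LocSol a μ u h) {t : ℝ} (ht : 0 < t) (R : ℝ) {ε : ℝ} (hε : 0 < ε) : ∀ᶠ η in 𝓝[>] (0:ℝ),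
    ∀ x, |x| ≤ R → |V u (t+η) x - V u t x - η * GG a μ u h t x| ≤ ε * η := by
  filter_upwards [V_t0 S ht (half_pos hε), S.W_der ht (-R) R (half_pos hε)] with η h1 h2 x hx
  have hx' := abs_le.1 hx
  have R0 : 0 ≤ R := (abs_nonneg _).trans hx
  rw [abs_le] at h1 ⊢
  rcases le_total 0 x with h | h
  · have := abs_le.1 (h2 x 0 (by linarith) h hx'.2)
    constructor <;> linarith [this.1, this.2]
  · have := abs_le.1 (h2 0 x hx'.1 h R0)
    constructor <;> linarith [this.1, this.2]

end Aux

namespace Aux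
open Set Topology

lemma th_conc {α p p' : ℝ} (h0 : 0 ≤ α) (h1 : α ≤ 1) (hp : 0 < p) (hp' : 0 ≤ p') : p'^α - p^α ≤ α * p^(α-1) * (p' - p) := by
  have hs : -1 ≤ p'/p - 1 := by have := div_nonneg hp' hp.le; linarith
  have b := rpow_one_add_le_one_add_mul_self hs h0 h1
  have e : p'^α = p^α * (1 + (p'/p - 1))^α := by
    rw [← Real.mul_rpow hp.le (by linarith)]; congr 1; field_simp; ring
  have e2 : p^(α-1) = p^α / p := by rw [Real.rpow_sub hp, Real.rpow_one]
  rw [e, e2]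
  have hpa : 0 < p^α := Real.rpow_pos_of_pos hp _
  have := mul_le_mul_of_nonneg_left b hpa.le
  have e3 : α * (p^α/p) * (p' - p) = p^α * (α * (p'/p - 1)) := by field_simp
  rw [e3]; linarith

lemma L_conv {r c τ : ℝ} (h0 : 0 ≤ r) (h1 : r ≤ 1) (hc : 0 < c) (hτ : 0 ≤ τ) : c^(-r) - r * c^(-r-1) * τ ≤ (c+τ)^(-r) := by
  have s0 : 0 ≤ τ/c := by positivity
  have b := rpow_one_add_le_one_add_mul_self (s := τ/c) (by linarith) h0 h1
  have e : (c+τ)^(-r) = c^(-r) * (1 + τ/c)^(-r) := by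
    rw [← Real.mul_rpow hc.le (by linarith)]; congr 1; field_simp
  have e2 : c^(-r-1) = c^(-r) / c := by rw [Real.rpow_sub hc, Real.rpow_one]
  rw [e, e2]
  have hca : 0 < c^(-r) := Real.rpow_pos_of_pos hc _
  have k : 1 - r * (τ/c) ≤ (1 + τ/c)^(-r) := by
    rw [Real.rpow_neg (by linarith)]
    have pp : 0 < (1 + τ/c)^r := Real.rpow_pos_of_pos (by linarith) _
    rw [← one_div, le_div_iff₀ pp]
    have : 0 ≤ r * (τ/c) := by positivity
    rcases le_total (1 - r * (τ/c)) 0 with h | h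
    · nlinarith
    · nlinarith
  have := mul_le_mul_of_nonneg_left k hca.le
  have e3 : r * (c^(-r)/c) * τ = c^(-r) * (r * (τ/c)) := by field_simp
  rw [e3]; linarith

/-- perspective inequality -/
lemma persp {m A B A' B' : ℝ} (hm : 1 ≤ m) (hB : 0 < B) (hAB : B ≤ A) (hA' : 0 ≤ A') (hB' : 0 ≤ B') (h : A' - A ≤ B' - B) :
    (A'^m - A^m) / A^(m-1) ≤ (B'^m - B^m) / B^(m-1) := by
  have hA : 0 < A := hB.trans_le hAB
  have g : ∀ X Y : ℝ, 0 < X → 0 ≤ Y → (Y^m - X^m) / X^(m-1) = X * (Y/X)^m - X := fun X Y hX hY => by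
    rw [Real.div_rpow hY hX.le, Real.rpow_sub hX, Real.rpow_one]
    have := (Real.rpow_pos_of_pos hX m).ne'
    field_simp
  rw [g A A' hA hA', g B B' hB hB']
  have c := (convexOn_rpow hm).2 (show B'/B ∈ Ici (0:ℝ) from mem_Ici.2 (div_nonneg hB' hB.le)) (show (1:ℝ) ∈ Ici (0:ℝ) from mem_Ici.2 zero_le_one)
    (show (0:ℝ) ≤ B/A by positivity) (show (0:ℝ) ≤ (A-B)/A from div_nonneg (by linarith) hA.le) (by field_simp; ring)
  simp only [smul_eq_mul, Real.one_rpow, mul_one] at c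
  have e : B/A * (B'/B) + (A-B)/A = (B' + (A - B))/A := by field_simp
  rw [e] at c
  have k : (A'/A)^m ≤ ((B' + (A-B))/A)^m := by
    refine Real.rpow_le_rpow (by positivity) ?_ (by linarith)
    gcongr; linarith
  have := mul_le_mul_of_nonneg_left (k.trans c) hA.le
  have e2 : A * (B/A * (B'/B)^m + (A-B)/A) = B * (B'/B)^m + (A - B) := by field_simp
  rw [e2] at this
  linarith

lemma fl_pow {q v : ℝ} (hq : 1 < q) (hv : 0 ≤ v) : fl (fun w => |w|^(q-1)) v = v^q/q := by
  unfold fl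
  have : ∫ w in (0:ℝ)..v, |w|^(q-1) = ∫ w in (0:ℝ)..v, w^(q-1) := by
    refine intervalIntegral.integral_congr fun w hw => ?_
    rw [uIcc_of_le hv] at hw
    simp only [abs_of_nonneg hw.1]
  rw [this, integral_rpow (Or.inl (by linarith))]
  have e : q - 1 + 1 = q := by ring
  rw [e, Real.zero_rpow (by linarith), sub_zero]

theorem keyneg {q μ Λ L η : ℝ} (hq : 1 < q) (hμ : 0 < μ) (hΛ : 0 ≤ Λ) (hL : 0 < L) (hη : 0 < η) {v P H j : ℝ → ℝ} (v2 : ContDiff ℝ 2 v)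
    (Pd : ∀ x, HasDerivAt P (v x) x) (Pp : ∀ x, 0 < P x) {N : ℝ} (PN : ∀ x, P x ≤ N) (j0 : ∀ z, 0 ≤ j z) (ji : Integrable j)
    (hH : ∀ x, H x = Λ * ∫ z, j z * (P (x - z) - P x)) {x₀ y₀ : ℝ} (hxy : y₀ < x₀)
    (hmax : ∀ x y, y ≤ x → (P x)^((q-1)/q) - (P y)^((q-1)/q) - L * (x - y) ≤ η)
    (heq : (P x₀)^((q-1)/q) - (P y₀)^((q-1)/q) - L * (x₀ - y₀) = η) :
    ((q-1)/q * (P x₀)^((q-1)/q - 1)) * (μ * deriv v x₀ - fl (fun w => |w|^(q-1)) (v x₀) + H x₀)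
     - ((q-1)/q * (P y₀)^((q-1)/q - 1)) * (μ * deriv v y₀ - fl (fun w => |w|^(q-1)) (v y₀) + H y₀)
     + (1 / (q * ((q-1)/q)^(q-1))) * L^(q+1) * (x₀ - y₀) < 0 := by
  set α := (q-1)/q with hα
  have q0 : 0 < q := by linarith
  have α0 : 0 < α := div_pos (by linarith) q0
  have α1 : α < 1 := by rw [hα, div_lt_one q0]; linarith
  set κ := 1 / (q * α^(q-1)) with hκ
  have κ0 : 0 < κ := by positivity
  have Pc : Continuous P := continuous_iff_continuousAt.2 fun x => (Pd x).continuousAt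
  have Zd : ∀ x, HasDerivAt (fun x => (P x)^α) (v x * α * (P x)^(α-1)) x := fun x => (Pd x).rpow_const (Or.inl (Pp x).ne')
  have Zd2 : ∀ x, HasDerivAt (fun x => v x * α * (P x)^(α-1)) (deriv v x * α * (P x)^(α-1) + v x * α * (v x * (α-1) * (P x)^(α-1-1))) x := fun x =>
    ((cd_d0 v2 x).mul_const α).fun_mul ((Pd x).rpow_const (Or.inl (Pp x).ne'))
  have m1 : IsLocalMax (fun x => (P x)^α - (P y₀)^α - L * (x - y₀)) x₀ := by
    filter_upwards [Ioi_mem_nhds hxy] with x hx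
    rw [heq]; exact hmax x y₀ (le_of_lt hx)
  have m2 : IsLocalMax (fun y => (P x₀)^α - (P y)^α - L * (x₀ - y)) y₀ := by
    filter_upwards [Iio_mem_nhds hxy] with y hy
    rw [heq]; exact hmax x₀ y (le_of_lt hy)
  have D1 : ∀ x, HasDerivAt (fun x => (P x)^α - (P y₀)^α - L * (x - y₀)) (v x * α * (P x)^(α-1) - L) x := fun x => by
    have := ((Zd x).sub_const ((P y₀)^α)).fun_sub (((hasDerivAt_id' x).sub_const y₀).const_mul L)
    simpa using this
  have D2 : ∀ y, HasDerivAt (fun y => (P x₀)^α - (P y)^α - L * (x₀ - y)) (L - v y * α * (P y)^(α-1)) y := fun y => by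
    have := ((Zd y).const_sub ((P x₀)^α)).fun_sub (((hasDerivAt_id' y).const_sub x₀).const_mul L)
    exact this.congr_deriv (by ring)
  have e1 := m1.hasDerivAt_eq_zero (D1 x₀)
  have e2 := m2.hasDerivAt_eq_zero (D2 y₀)
  have s1 := snd_max D1 ((Zd2 x₀).sub_const L) m1
  have s2 := snd_max D2 ((Zd2 y₀).const_sub L) m2
  have le : (P y₀)^α ≤ (P x₀)^α := by nlinarith
  have pt : ∀ x, v x * α * (P x)^(α-1) = L → 0 < v x ∧ (α * (P x)^(α-1)) * fl (fun w => |w|^(q-1)) (v x) = κ * L^q * (P x)^α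
      ∧ v x * α * (v x * (α-1) * (P x)^(α-1-1)) = - ((1-α)/α * L^2 / (P x)^α) := by
    intro x hx
    have pp := Pp x
    have pa : 0 < (P x)^(α-1) := Real.rpow_pos_of_pos pp _
    have vp : 0 < v x := by
      by_contra hh
      push Not at hh
      have : v x * α * (P x)^(α-1) ≤ 0 := by
        have : v x * (α * (P x)^(α-1)) ≤ 0 := mul_nonpos_of_nonpos_of_nonneg hh (by positivity)
        linarith
      linarith
    have ev : v x = L * (P x)^(1-α) / α := by
      have : (P x)^(1-α) * (P x)^(α-1) = 1 := by
        rw [← Real.rpow_add pp]; simp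
      rw [← hx]; field_simp; rw [mul_comm ((P x)^(α-1)), this]
    refine ⟨vp, ?_, ?_⟩
    · rw [fl_pow hq vp.le]
      have : (v x)^q = v x * (v x)^(q-1) := by
        rw [mul_comm, ← Real.rpow_add_one vp.ne']; congr 1; ring
      have e : α * (P x)^(α-1) * ((v x)^q/q) = L * ((v x)^(q-1)/q) := by
        rw [this, ← hx]; ring
      rw [e, ev, Real.div_rpow (by positivity) α0.le, Real.mul_rpow hL.le (by positivity), ← Real.rpow_mul pp.le]
      have : (1-α) * (q-1) = α := by rw [hα]; field_simp; ring
      rw [this]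
      have : L^q = L * L^(q-1) := by rw [mul_comm, ← Real.rpow_add_one hL.ne']; congr 1; ring
      rw [this, hκ]
      field_simp
    · have e3 : (P x)^(α-1-1) = (P x)^(α-1) * (P x)^(α-1) / (P x)^α := by
        rw [← Real.rpow_add pp, ← Real.rpow_sub pp]; congr 1; ring
      have hx2 : v x * (P x)^(α-1) = L / α := by field_simp; linarith
      have : v x * α * (v x * (α-1) * (P x)^(α-1-1)) = α * (α - 1) * (v x * (P x)^(α-1))^2 / (P x)^α := by rw [e3]; ring
      rw [this, hx2]; field_simp; ring
  obtain ⟨vx, fx, gx⟩ := pt x₀ (by linarith)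
  obtain ⟨vy, fy, gy⟩ := pt y₀ (by linarith)
  rw [gx] at s1
  rw [gy] at s2
  -- viscosity
  have visc : (α * (P x₀)^(α-1)) * (μ * deriv v x₀) - (α * (P y₀)^(α-1)) * (μ * deriv v y₀) ≤ 0 := by
    have h1 : (1-α)/α * L^2 / (P x₀)^α ≤ (1-α)/α * L^2 / (P y₀)^α := by
      have := Real.rpow_pos_of_pos (Pp y₀) α
      refine div_le_div_of_nonneg_left ?_ this le
      have : 0 < 1 - α := by linarith
      positivity
    have : deriv v x₀ * α * (P x₀)^(α-1) - deriv v y₀ * α * (P y₀)^(α-1) ≤ 0 := by linarith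
    have := mul_nonpos_of_nonneg_of_nonpos hμ.le this
    linarith
  -- nonlocal term
  have nonl : (α * (P x₀)^(α-1)) * H x₀ - (α * (P y₀)^(α-1)) * H y₀ ≤ 0 := by
    have ii : ∀ x, Integrable fun z => j z * (P (x - z) - P x) := fun x => by
      refine ji.mul_bdd (c := 2 * N) (by fun_prop) (Eventually.of_forall fun z => ?_)
      have := Pp x; have := Pp (x - z); have := PN x; have := PN (x-z)
      rw [Real.norm_eq_abs, abs_le]; constructor <;> linarith
    rw [hH, hH]
    have e : (α * (P x₀)^(α-1)) * (Λ * ∫ z, j z * (P (x₀ - z) - P x₀)) - (α * (P y₀)^(α-1)) * (Λ * ∫ z, j z * (P (y₀ - z) - P y₀))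
        = (Λ * α) * ∫ z, ((P x₀)^(α-1) * (j z * (P (x₀ - z) - P x₀)) - (P y₀)^(α-1) * (j z * (P (y₀ - z) - P y₀))) := by
      rw [integral_sub ((ii x₀).const_mul _) ((ii y₀).const_mul _), integral_const_mul, integral_const_mul]; ring
    rw [e]
    refine mul_nonpos_of_nonneg_of_nonpos (by positivity) (integral_nonpos fun z => ?_)
    show (P x₀)^(α-1) * (j z * (P (x₀ - z) - P x₀)) - (P y₀)^(α-1) * (j z * (P (y₀ - z) - P y₀)) ≤ 0
    have hm := hmax (x₀ - z) (y₀ - z) (by linarith)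
    have pr := persp (m := 1/α) (A := (P x₀)^α) (B := (P y₀)^α) (A' := (P (x₀ - z))^α) (B' := (P (y₀ - z))^α)
      (by rw [le_div_iff₀ α0]; linarith) (Real.rpow_pos_of_pos (Pp _) _) le (Real.rpow_pos_of_pos (Pp _) _).le (Real.rpow_pos_of_pos (Pp _) _).le
      (by have : x₀ - z - (y₀ - z) = x₀ - y₀ := by ring
          rw [this] at hm; linarith)
    have r1 : ∀ x, ((P x)^α)^(1/α) = P x := fun x => by
      rw [← Real.rpow_mul (Pp x).le, mul_one_div_cancel α0.ne', Real.rpow_one]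
    have r2 : ∀ x, ((P x)^α)^(1/α - 1) = ((P x)^(α-1))⁻¹ := fun x => by
      rw [← Real.rpow_mul (Pp x).le, ← Real.rpow_neg (Pp x).le]; congr 1; field_simp; ring
    rw [r1, r1, r1, r1, r2, r2, div_inv_eq_mul, div_inv_eq_mul] at pr
    have := mul_le_mul_of_nonneg_left pr (j0 z)
    linarith
  have fin : -(κ * L^q * (P x₀)^α) + κ * L^q * (P y₀)^α + κ * L^(q+1) * (x₀ - y₀) < 0 := by
    have e : L^(q+1) = L^q * L := by rw [Real.rpow_add_one hL.ne']
    have lq : 0 < L^q := Real.rpow_pos_of_pos hL _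
    have : -(κ * L^q * (P x₀)^α) + κ * L^q * (P y₀)^α + κ * L^(q+1) * (x₀ - y₀) = -(κ * L^q * η) := by
      rw [e, ← heq]; ring
    rw [this]
    have : 0 < κ * L^q * η := by positivity
    linarith
  linarith

end Aux

namespace Aux
open Set Topology

theorem LocSol.sharp0 {q μ Λ : ℝ} {u h : ℝ → ℝ → ℝ} (S : LocSol (fun v => |v|^(q-1)) μ u h) (hq : 1 < q) (hΛ : 0 ≤ Λ)
    {j : ℝ → ℝ} (j0 : ∀ z, 0 ≤ j z) (ji : Integrable j)
    (hV : ∀ t, 0 < t → ∀ x, V h t x = Λ * ∫ z, j z * (V u t (x - z) - V u t x)) {Am N : ℝ}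
    (lo : ∀ t, 0 < t → ∀ x, 0 ≤ V u t x + Am) (up : ∀ t, 0 < t → ∀ x, V u t x + Am ≤ N) {s T ε : ℝ} (hs : 0 < s) (hsT : s < T)
    (hε : 0 < ε) (x : ℝ) : u T x ≤ (q * (N + ε) / ((q - 1) * (T - s)))^(1/q) := by
  have hTs : 0 < T - s := sub_pos.2 hsT
  have T0 : 0 < T := hs.trans hsT
  have q0 : 0 < q := by linarith
  have N0 : 0 ≤ N := (lo T T0 0).trans (up T T0 0)
  set α := (q-1)/q with hα
  have α0 : 0 < α := div_pos (by linarith) q0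
  have α1 : α < 1 := by rw [hα, div_lt_one q0]; linarith
  set M := α * ε^(α-1) with hM
  have M0 : 0 < M := by positivity
  obtain ⟨B, B0, hB⟩ := S.bdd (T := T) hs
  set b := (α^(q-1))⁻¹ with hb
  have b0 : 0 < b := by positivity
  set ℓ := M * B with hℓ
  have ℓ0 : 0 < ℓ := by positivity
  set c0 := ℓ^(-q) with hc0
  have c00 : 0 < c0 := by positivity
  set L : ℝ → ℝ := fun t => (c0 + b * (t - s))^(-(1/q)) with hL
  have cp : ∀ t, s ≤ t → 0 < c0 + b * (t - s) := fun t ht => by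
    have : 0 ≤ b * (t - s) := mul_nonneg b0.le (by linarith)
    linarith
  have L0 : ∀ t, s ≤ t → 0 < L t := fun t ht => Real.rpow_pos_of_pos (cp t ht) _
  have Ls : L s = ℓ := by
    simp only [hL, sub_self, mul_zero, add_zero, hc0]
    rw [← Real.rpow_mul ℓ0.le]
    have : -q * -(1/q) = 1 := by field_simp
    rw [this, Real.rpow_one]
  have LT : ∀ t ∈ Icc s T, L T ≤ L t := fun t ht => by
    refine Real.rpow_le_rpow_of_nonpos (cp t ht.1) ?_ ?_
    · have := mul_le_mul_of_nonneg_left (show t - s ≤ T - s by linarith [ht.2]) b0.le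
      linarith
    · have : 0 < 1/q := by positivity
      linarith
  have Ld : ∀ t, s ≤ t → ∀ τ, 0 ≤ τ → L t - (1 / (q * α^(q-1))) * (L t)^(q+1) * τ ≤ L (t + τ) := fun t ht τ hτ => by
    have := L_conv (r := 1/q) (by positivity) (by rw [div_le_one q0]; exact hq.le) (cp t ht) (mul_nonneg b0.le hτ)
    have e : c0 + b * (t - s) + b * τ = c0 + b * (t + τ - s) := by ring
    rw [e] at this
    have e2 : (L t)^(q+1) = (c0 + b * (t - s))^(-(1/q) - 1) := by
      simp only [hL]
      rw [← Real.rpow_mul (cp t ht).le]; congr 1; field_simp; ring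
    rw [e2]
    simp only [hL]
    refine le_trans (le_of_eq ?_) this
    rw [hb]; field_simp
  set P : ℝ → ℝ → ℝ := fun t x => V u t x + Am + ε with hP
  have Pε : ∀ t, 0 < t → ∀ x, ε ≤ P t x := fun t ht x => by have := lo t ht x; simp only [hP]; linarith
  have Pp : ∀ t, 0 < t → ∀ x, 0 < P t x := fun t ht x => hε.trans_le (Pε t ht x)
  have PN : ∀ t, 0 < t → ∀ x, P t x ≤ N + ε := fun t ht x => by have := up t ht x; simp only [hP]; linarith
  have θM : ∀ t, 0 < t → ∀ x, α * (P t x)^(α-1) ≤ M := fun t ht x => by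
    refine mul_le_mul_of_nonneg_left (Real.rpow_le_rpow_of_nonpos hε (Pε t ht x) (by linarith)) α0.le
  have θ0 : ∀ t, 0 < t → ∀ x, 0 < α * (P t x)^(α-1) := fun t ht x =>
    mul_pos α0 (Real.rpow_pos_of_pos (Pp t ht x) _)
  set Ψ : ℝ → ℝ × ℝ → ℝ := fun t p => (P t p.1)^α - (P t p.2)^α - L t * (p.1 - p.2) with hΨ
  set D : Set (ℝ × ℝ) := {p | p.2 ≤ p.1} with hD
  have Pc1 : ∀ z : ℝ × (ℝ × ℝ), 0 < z.1 → ContinuousAt (fun z : ℝ × (ℝ × ℝ) => P z.1 z.2.1) z := fun z hz =>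
    ((ContinuousAt.comp (f := fun z : ℝ × (ℝ × ℝ) => (z.1, z.2.1)) (g := fun z : ℝ × ℝ => V u z.1 z.2)
          (V_cont S.ui S.uc hz z.2.1) (by fun_prop)).add_const Am).add_const ε
  have Pc2 : ∀ z : ℝ × (ℝ × ℝ), 0 < z.1 → ContinuousAt (fun z : ℝ × (ℝ × ℝ) => P z.1 z.2.2) z := fun z hz =>
    ((ContinuousAt.comp (f := fun z : ℝ × (ℝ × ℝ) => (z.1, z.2.2)) (g := fun z : ℝ × ℝ => V u z.1 z.2)
          (V_cont S.ui S.uc hz z.2.2) (by fun_prop)).add_const Am).add_const ε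
  have main : ∀ η, 0 < η → ∀ p ∈ D, Ψ T p ≤ η := by
    intro η hη
    obtain ⟨R, Rp, hR⟩ := tails S.ui S.uc (T := T) hs (div_pos hη M0)
    set z0 := (N + ε)^α / L T with hz0
    refine maxp (KK_compact R z0) (D := D) (Ψ := Ψ) (s := s) hsT.le (fun p hp => hp.1) ?_ ?_ ?_ ?_ T ⟨hsT.le, le_rfl⟩
    · intro t ht p hp hpK
      have t0 : 0 < t := hs.trans_le ht.1
      have hp' : p.2 ≤ p.1 := hp
      simp only [hΨ]
      by_cases hz : p.1 - p.2 ≤ z0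
      · have : p.1 < -R ∨ R < p.2 := by
          by_contra hcon
          push Not at hcon
          exact hpK ⟨hp, hz, hcon.1, hcon.2⟩
        have h1 := V_tail (S.ui t t0) (hR t ht) hp this
        have h2 := th_conc α0.le α1.le (Pp t t0 p.2) (Pp t t0 p.1).le
        have h3 : α * (P t p.2)^(α-1) * (P t p.1 - P t p.2) ≤ M * (η/M) := by
          refine (le_abs_self _).trans ?_
          rw [abs_mul, abs_of_pos (θ0 t t0 p.2)]
          refine mul_le_mul (θM t t0 _) ?_ (abs_nonneg _) M0.le
          have : P t p.1 - P t p.2 = V u t p.1 - V u t p.2 := by simp only [hP]; ring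
          rw [this]; exact h1
        have e : M * (η/M) = η := by field_simp
        have h4 : 0 ≤ L t * (p.1 - p.2) := mul_nonneg (L0 t ht.1).le (by linarith)
        linarith
      · push Not at hz
        have h1 : (P t p.1)^α ≤ (N+ε)^α := Real.rpow_le_rpow (Pp t t0 _).le (PN t t0 _) α0.le
        have h2 : 0 ≤ (P t p.2)^α := (Real.rpow_pos_of_pos (Pp t t0 _) _).le
        have h3 : L T * z0 ≤ L t * (p.1 - p.2) := mul_le_mul (LT t ht) hz.le (by have := L0 T hsT.le; positivity) (L0 t ht.1).le
        have h4 : L T * z0 = (N+ε)^α := by have := L0 T hsT.le; rw [hz0]; field_simp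
        linarith
    · intro z hz
      have t0 : 0 < z.1 := hs.trans_le hz.1.1
      refine ContinuousAt.continuousWithinAt ?_
      have c1 := (Pc1 z t0).rpow_const (p := α) (Or.inl (Pp _ t0 _).ne')
      have c2 := (Pc2 z t0).rpow_const (p := α) (Or.inl (Pp _ t0 _).ne')
      have c3 : ContinuousAt (fun z : ℝ × (ℝ × ℝ) => L z.1) z := by
        simp only [hL]
        exact ContinuousAt.rpow_const (by fun_prop) (Or.inl (cp _ hz.1.1).ne')
      exact (c1.sub c2).sub (c3.mul (by fun_prop))
    · intro p hp
      have hp' : p.2 ≤ p.1 := hp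
      have h2 := th_conc α0.le α1.le (Pp s hs p.2) (Pp s hs p.1).le
      have h1 : P s p.1 - P s p.2 ≤ B * (p.1 - p.2) := by
        have : P s p.1 - P s p.2 = V u s p.1 - V u s p.2 := by simp only [hP]; ring
        rw [this, V_sub (S.ui s hs)]
        have := intervalIntegral.norm_integral_le_of_norm_le_const (a := p.2) (b := p.1) (f := u s) (C := B)
          (fun x _ => hB s ⟨le_rfl, hsT.le⟩ x)
        rw [abs_of_nonneg (by linarith : 0 ≤ p.1 - p.2)] at this
        exact (le_abs_self _).trans this
      have h3 : α * (P s p.2)^(α-1) * (P s p.1 - P s p.2) ≤ M * (B * (p.1 - p.2)) := by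
        refine (mul_le_mul_of_nonneg_left h1 (θ0 s hs _).le).trans ?_
        exact mul_le_mul_of_nonneg_right (θM s hs _) (mul_nonneg B0.le (by linarith))
      simp only [hΨ, Ls, hℓ]
      linarith
    · rintro t ht hmax ⟨x₀, y₀⟩ hp heq
      have t0 : 0 < t := hs.trans_le ht.1
      simp only [hΨ] at heq
      have hp1 : y₀ ≤ x₀ := hp.1
      have xy : y₀ < x₀ := by
        refine lt_of_le_of_ne hp1 ?_
        intro e
        rw [e] at heq
        simp at heq
        linarith
      have hVd : ∀ x, HasDerivAt (P t) (u t x) x := fun x =>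
        ((V_der (S.ui t t0) (S.u2 t t0).continuous x).add_const Am).add_const ε
      have kn := keyneg (H := fun x => V h t x) hq S.μp hΛ (L0 t ht.1) hη (S.u2 t t0) hVd (Pp t t0) (PN t t0) j0 ji
        (fun x => by
          rw [hV t t0 x]
          congr 1; congr 1; funext z; simp only [hP]; ring) xy (fun x y hyx => hmax (x, y) hyx) heq
      rw [← hα] at kn
      set κ := 1 / (q * α^(q-1)) with hκ
      set G := GG (fun v => |v|^(q-1)) μ u h t with hG
      have Gc : Continuous G := S.GG_cont t0
      set F : ℝ × (ℝ × ℝ) → ℝ := fun w => (α * (P t w.2.1)^(α-1)) * G w.2.1 - (α * (P (t + w.1) w.2.2)^(α-1)) * G w.2.2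
        + κ * (L t)^(q+1) * (w.2.1 - w.2.2) with hF
      have Fc : ContinuousAt F ((0:ℝ), (x₀, y₀)) := by
        have c1 : ContinuousAt (fun w : ℝ × (ℝ × ℝ) => P t w.2.1) ((0:ℝ), (x₀, y₀)) :=
          ContinuousAt.comp (x := ((0:ℝ), (x₀, y₀))) (g := P t) (f := fun w : ℝ × (ℝ × ℝ) => w.2.1) (hVd x₀).continuousAt (by fun_prop)
        have c2 : ContinuousAt (fun w : ℝ × (ℝ × ℝ) => P (t + w.1) w.2.2) ((0:ℝ), (x₀, y₀)) := by
          refine ContinuousAt.comp (f := fun w : ℝ × (ℝ × ℝ) => (t + w.1, w.2)) (g := fun z : ℝ × (ℝ × ℝ) => P z.1 z.2.2) ?_ (by fun_prop)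
          exact Pc2 _ (by simpa using t0)
        have d1 := c1.rpow_const (p := α - 1) (Or.inl (Pp _ t0 _).ne')
        have d2 := c2.rpow_const (p := α - 1) (Or.inl (by simpa using (Pp _ t0 _).ne'))
        have g1 : ContinuousAt (fun w : ℝ × (ℝ × ℝ) => G w.2.1) ((0:ℝ), (x₀, y₀)) := by fun_prop
        have g2 : ContinuousAt (fun w : ℝ × (ℝ × ℝ) => G w.2.2) ((0:ℝ), (x₀, y₀)) := by fun_prop
        exact (((d1.const_mul α).mul g1).sub ((d2.const_mul α).mul g2)).add (by fun_prop)
      have F0 : F ((0:ℝ), (x₀, y₀)) < 0 := by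
        simp only [hF, hG, GG, add_zero]
        exact kn
      set d := -F ((0:ℝ), (x₀, y₀)) / 2 with hd
      have dp : 0 < d := by rw [hd]; linarith
      have h3 := Fc.eventually (gt_mem_nhds (show F ((0:ℝ), (x₀, y₀)) < -d by rw [hd]; linarith))
      have δp : 0 < d / (2 * M) := by positivity
      have h1 := V_t S t0 (R + z0) δp
      rw [eventually_nhdsWithin_iff] at h1
      have h2 := h1.prod_inl_nhds (x₀, y₀)
      filter_upwards [h2, h3] with w hw hw3 hpos hK
      obtain ⟨τ, x, y⟩ := w
      obtain ⟨k1, k2, k3, k4⟩ := hK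
      simp only at hpos k1 k2 k3 k4 hw
      have wx := (abs_le.1 (hw hpos x (by rw [abs_le]; constructor <;> linarith))).2
      have wy := (abs_le.1 (hw hpos y (by rw [abs_le]; constructor <;> linarith))).1
      have tτ : 0 < t + τ := by linarith
      have cx := th_conc α0.le α1.le (Pp t t0 x) (Pp (t+τ) tτ x).le
      have cy := th_conc α0.le α1.le (Pp (t+τ) tτ y) (Pp t t0 y).le
      have ex : α * (P t x)^(α-1) * (P (t+τ) x - P t x) ≤ α * (P t x)^(α-1) * (τ * G x) + M * (d/(2*M) * τ) := by
        have e : P (t+τ) x - P t x = V u (t+τ) x - V u t x := by simp only [hP]; ring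
        rw [e]
        have l := mul_le_mul_of_nonneg_left (show V u (t+τ) x - V u t x ≤ τ * G x + d/(2*M) * τ by linarith) (θ0 t t0 x).le
        have l2 := mul_le_mul_of_nonneg_right (θM t t0 x) (show 0 ≤ d/(2*M) * τ by positivity)
        linarith
      have ey : α * (P (t+τ) y)^(α-1) * (P t y - P (t+τ) y) ≤ -(α * (P (t+τ) y)^(α-1) * (τ * G y)) + M * (d/(2*M) * τ) := by
        have e : P t y - P (t+τ) y = V u t y - V u (t+τ) y := by simp only [hP]; ring
        rw [e]
        have l := mul_le_mul_of_nonneg_left (show V u t y - V u (t+τ) y ≤ -(τ * G y) + d/(2*M) * τ by linarith) (θ0 (t+τ) tτ y).le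
        have l2 := mul_le_mul_of_nonneg_right (θM (t+τ) tτ y) (show 0 ≤ d/(2*M) * τ by positivity)
        linarith
      have eM : M * (d/(2*M) * τ) = d/2 * τ := by field_simp
      have lL := mul_le_mul_of_nonneg_right (Ld t ht.1 τ hpos.le) (show 0 ≤ x - y by linarith)
      simp only [hF] at hw3
      have hw4 := mul_le_mul_of_nonneg_left hw3.le hpos.le
      simp only [hΨ]
      linarith
  have bound : ∀ z, 0 < z → (P T (x+z))^α - (P T x)^α ≤ L T * z := by
    intro z h1
    refine le_of_forall_pos_le_add fun η hη => ?_
    have := main η hη (x + z, x) (by simp only [hD, mem_ofPred_eq]; linarith)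
    simp only [hΨ] at this
    have e : x + z - x = z := by ring
    rw [e] at this
    linarith
  have hVd : HasDerivAt (P T) (u T x) x :=
        ((V_der (S.ui T T0) (S.u2 T T0).continuous x).add_const Am).add_const ε
  have hZ := hVd.rpow_const (p := α) (Or.inl (Pp T T0 x).ne')
  have fin : u T x * α * (P T x)^(α-1) ≤ L T := by
    refine le_of_tendsto hZ.tendsto_slope_zero_right ?_
    filter_upwards [self_mem_nhdsWithin] with z hz
    have hz' : 0 < z := hz
    have := bound z hz'
    rw [smul_eq_mul, inv_mul_le_iff₀ hz']
    linarith
  have LT2 : L T ≤ (b * (T - s))^(-(1/q)) := by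
    refine Real.rpow_le_rpow_of_nonpos (by positivity) (by linarith) ?_
    have : 0 < 1/q := by positivity
    linarith
  have pp := Pp T T0 x
  have step1 : u T x ≤ (b * (T-s))^(-(1/q)) / (α * (P T x)^(α-1)) := by
    rw [le_div_iff₀ (θ0 T T0 x)]; linarith
  refine step1.trans ?_
  have e1 : (b * (T-s))^(-(1/q)) / (α * (P T x)^(α-1)) = (P T x / (α * (T - s)))^(1/q) := by
    have a1 : α - 1 = -(1/q) := by rw [hα]; field_simp; ring
    rw [Real.mul_rpow b0.le hTs.le, hb, ← Real.rpow_neg α0.le, ← Real.rpow_mul α0.le, a1, Real.div_rpow pp.le (by positivity),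
      Real.mul_rpow α0.le hTs.le, Real.rpow_neg pp.le, Real.rpow_neg hTs.le]
    have a2 : -(q-1) * -(1/q) = 1 - 1/q := by field_simp
    rw [a2, Real.rpow_sub α0, Real.rpow_one]
    field_simp
  rw [e1]
  have e2 : q * (N + ε) / ((q-1) * (T-s)) = (N + ε) / (α * (T-s)) := by
    rw [hα]; have : q - 1 ≠ 0 := by linarith
    field_simp
  rw [e2]
  refine Real.rpow_le_rpow (by positivity) ?_ (by positivity)
  have := PN T T0 x
  gcongr

theorem LocSol.sharp {q μ Λ : ℝ} {u h : ℝ → ℝ → ℝ} (S : LocSol (fun v => |v|^(q-1)) μ u h) (hq : 1 < q) (hΛ : 0 ≤ Λ)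
    {j : ℝ → ℝ} (j0 : ∀ z, 0 ≤ j z) (ji : Integrable j)
    (hV : ∀ t, 0 < t → ∀ x, V h t x = Λ * ∫ z, j z * (V u t (x - z) - V u t x)) {Am N : ℝ}
    (lo : ∀ t, 0 < t → ∀ x, 0 ≤ V u t x + Am) (up : ∀ t, 0 < t → ∀ x, V u t x + Am ≤ N) {T : ℝ} (hT : 0 < T) (x : ℝ) :
    u T x ≤ (q * N / ((q - 1) * T))^(1/q) := by
  have c : ContinuousAt (fun ε : ℝ => (q * (N + ε) / ((q - 1) * (T - ε)))^(1/q)) 0 := by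
    have h2 : ContinuousAt (fun ε : ℝ => q * (N + ε) / ((q - 1) * (T - ε))) 0 := by
      refine ContinuousAt.div (by fun_prop) (by fun_prop) ?_
      have : 0 < (q-1) * (T - 0) := mul_pos (by linarith) (by linarith)
      exact this.ne'
    exact h2.rpow_const (Or.inr (by have : 0 < q := by linarith
                                    positivity))
  have c2 := c.tendsto
  simp only [add_zero, sub_zero] at c2
  refine ge_of_tendsto (c2.mono_left (nhdsWithin_le_nhds (s := Ioi 0))) ?_
  filter_upwards [Ioo_mem_nhdsGT hT] with ε hε
  exact S.sharp0 hq hΛ j0 ji hV lo up hε.1 hε.2 hε.1 x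

end Aux

namespace Aux
open Set Topology

noncomputable def cv (j f : ℝ → ℝ) (x : ℝ) : ℝ := ∫ y, j (x - y) * f y

lemma cv_prod {j f : ℝ → ℝ} (ji : Integrable j) (fi : Integrable f) :
    Integrable (fun p : ℝ × ℝ => j (p.1 - p.2) * f p.2) (volume.prod volume) := by
  have := fi.convolution_integrand (ContinuousLinearMap.mul ℝ ℝ) ji
  refine this.congr (Eventually.of_forall fun p => ?_)
  simp [mul_comm]

lemma cv_int {j f : ℝ → ℝ} (ji : Integrable j) (fi : Integrable f) : Integrable (cv j f) :=
  (cv_prod ji fi).integral_prod_left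

lemma cv_mass {j f : ℝ → ℝ} (ji : Integrable j) (j1 : ∫ z, j z = 1) (fi : Integrable f) : ∫ x, cv j f x = ∫ x, f x := by
  unfold cv
  rw [integral_integral_swap (f := fun x y => j (x - y) * f y) (cv_prod ji fi)]
  congr 1; funext y
  rw [integral_mul_const, integral_sub_right_eq_self j y, j1, one_mul]

lemma cv_abs {j f : ℝ → ℝ} (j0 : ∀ z, 0 ≤ j z) (ji : Integrable j) (j1 : ∫ z, j z = 1) (fi : Integrable f) :
    ∫ x, |cv j f x| ≤ ∫ x, |f x| := by
  rw [← cv_mass ji j1 fi.abs]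
  refine integral_mono (cv_int ji fi).abs (cv_int ji fi.abs) fun x => ?_
  refine abs_integral_le_integral_abs.trans (le_of_eq ?_)
  unfold cv
  congr 1; funext y
  rw [abs_mul, abs_of_nonneg (j0 _)]

lemma cv_sub {j f g : ℝ → ℝ} (ji : Integrable j) (fi : Integrable f) (gi : Integrable g) :
    (fun x => cv j f x - cv j g x) =ᵐ[volume] cv j (fun x => f x - g x) := by
  filter_upwards [(cv_prod ji fi).prod_right_ae, (cv_prod ji gi).prod_right_ae] with x h1 h2
  unfold cv
  rw [← integral_sub h1 h2]
  congr 1; funext y; ring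

lemma cv_V {j f : ℝ → ℝ} (ji : Integrable j) (fi : Integrable f) (x : ℝ) :
    ∫ w in Iic x, cv j f w = ∫ z, j z * ∫ w in Iic (x - z), f w := by
  have e : ∀ w, cv j f w = ∫ z, j z * f (w - z) := fun w => by
    unfold cv
    rw [← integral_sub_left_eq_self (fun z => j z * f (w - z)) volume w]
    congr 1; funext y; simp
  simp only [e]
  have pi : Integrable (fun p : ℝ × ℝ => j p.2 * f (p.1 - p.2)) (volume.prod volume) := by
    have := ji.convolution_integrand (ContinuousLinearMap.mul ℝ ℝ) fi
    refine this.congr (Eventually.of_forall fun p => ?_)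
    simp
  have pr : Integrable (fun p : ℝ × ℝ => j p.2 * f (p.1 - p.2)) ((volume.restrict (Iic x)).prod volume) := by
    have : (volume.restrict (Iic x)).prod (volume : Measure ℝ) = ((volume : Measure ℝ).prod volume).restrict (Iic x ×ˢ univ) := by
      rw [← Measure.prod_restrict, Measure.restrict_univ]
    rw [this]; exact pi.restrict
  rw [integral_integral_swap (f := fun w z => j z * f (w - z)) pr]
  congr 1; funext z
  rw [integral_const_mul]
  congr 1
  rw [← integral_indicator measurableSet_Iic, ← integral_indicator measurableSet_Iic,
    ← integral_sub_right_eq_self (fun w => (Iic (x - z)).indicator (fun w => f w) w) z]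
  congr 1; funext w
  simp only [indicator, mem_Iic, sub_le_sub_iff_right]

lemma cv_VV {j f : ℝ → ℝ} (ji : Integrable j) (j1 : ∫ z, j z = 1) (fi : Integrable f) (Λ x : ℝ) :
    ∫ w in Iic x, Λ * (cv j f w - f w) = Λ * ∫ z, j z * ((∫ w in Iic (x - z), f w) - ∫ w in Iic x, f w) := by
  rw [integral_const_mul, integral_sub (cv_int ji fi).integrableOn fi.integrableOn, cv_V ji fi]
  congr 1
  have Vc : Continuous (fun x => ∫ w in Iic x, f w) := V_cx (u := fun _ => f) (t := 0) fi
  have i1 : Integrable (fun z => j z * ∫ w in Iic (x - z), f w) := by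
    refine ji.mul_bdd (c := ∫ y, |f y|) (Vc.comp (continuous_const.sub continuous_id')).aestronglyMeasurable (Eventually.of_forall fun z => ?_)
    exact V_abs (u := fun _ => f) (t := 0) fi (x - z)
  have i2 : Integrable (fun z => j z * ∫ w in Iic x, f w) := ji.mul_const _
  have : (fun z => j z * ((∫ w in Iic (x - z), f w) - ∫ w in Iic x, f w)) = fun z => (j z * ∫ w in Iic (x - z), f w) - j z * ∫ w in Iic x, f w := by
    funext z; ring
  rw [this, integral_sub i1 i2, integral_mul_const, j1, one_mul]

lemma V_lo {u : ℝ → ℝ → ℝ} {t : ℝ} (hu : Integrable (u t)) (x : ℝ) : (∫ y, u t y) - (∫ y, |u t y|) ≤ 2 * V u t x := by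
  have h1 : -(∫ y in Iic x, (|u t y| - u t y)) ≥ -(∫ y, (|u t y| - u t y)) := by
    refine neg_le_neg (setIntegral_le_integral (hu.abs.sub hu) (Eventually.of_forall fun y => ?_))
    exact sub_nonneg.2 (le_abs_self _)
  rw [integral_sub hu.abs hu, integral_sub hu.abs.integrableOn hu.integrableOn] at h1
  have h2 := neg_le_abs (∫ y in Iic x, u t y)
  have h3 : |∫ y in Iic x, u t y| ≤ ∫ y in Iic x, |u t y| := abs_integral_le_integral_abs
  unfold V
  linarith

lemma V_up {u : ℝ → ℝ → ℝ} {t : ℝ} (hu : Integrable (u t)) (x : ℝ) : 2 * V u t x ≤ (∫ y, u t y) + (∫ y, |u t y|) := by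
  have h1 : (∫ y in Iic x, (|u t y| + u t y)) ≤ ∫ y, (|u t y| + u t y) := by
    refine (setIntegral_le_integral (hu.abs.add hu) (Eventually.of_forall fun y => ?_))
    have := neg_abs_le (u t y)
    show 0 ≤ |u t y| + u t y
    linarith
  rw [integral_add hu.abs hu, integral_add hu.abs.integrableOn hu.integrableOn] at h1
  have h2 := le_abs_self (∫ y in Iic x, u t y)
  have h3 : |∫ y in Iic x, u t y| ≤ ∫ y in Iic x, |u t y| := abs_integral_le_integral_abs
  unfold V
  linarith

theorem LocSol.sharp2 {q μ Λ : ℝ} {u h : ℝ → ℝ → ℝ} (S : LocSol (fun v => |v|^(q-1)) μ u h) (hq : 1 < q) (hΛ : 0 ≤ Λ)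
    {j : ℝ → ℝ} (j0 : ∀ z, 0 ≤ j z) (ji : Integrable j)
    (hV : ∀ t, 0 < t → ∀ x, V h t x = Λ * ∫ z, j z * (V u t (x - z) - V u t x)) {m N : ℝ}
    (hm : ∀ t, 0 < t → ∫ x, u t x = m) (hN : ∀ t, 0 < t → ∫ x, |u t x| ≤ N) {T : ℝ} (hT : 0 < T) (x : ℝ) :
    u T x ≤ (q * N / ((q - 1) * T))^(1/q) := by
  refine S.sharp hq hΛ j0 ji hV (Am := (N - m)/2) (fun t ht x => ?_) (fun t ht x => ?_) hT x
  · have := V_lo (S.ui t ht) x; rw [hm t ht] at this; linarith [hN t ht]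
  · have := V_up (S.ui t ht) x; rw [hm t ht] at this; linarith [hN t ht]

theorem LocSol.sharp3 {q μ Λ : ℝ} {u h : ℝ → ℝ → ℝ} (S : LocSol (fun v => |v|^(q-1)) μ u h) (hq : 1 < q) (hΛ : 0 ≤ Λ)
    {j : ℝ → ℝ} (j0 : ∀ z, 0 ≤ j z) (ji : Integrable j)
    (hV : ∀ t, 0 < t → ∀ x, V h t x = Λ * ∫ z, j z * (V u t (x - z) - V u t x)) {m N : ℝ}
    (hm : ∀ t, 0 < t → ∫ x, u t x = m) (hN : ∀ t, 0 < t → ∫ x, |u t x| ≤ N) {T : ℝ} (hT : 0 < T) (x : ℝ) :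
    |u T x| ≤ (q * N / ((q - 1) * T))^(1/q) := by
  rw [abs_le]
  refine ⟨?_, S.sharp2 hq hΛ j0 ji hV hm hN hT x⟩
  have Vn : ∀ f : ℝ → ℝ → ℝ, ∀ t x, V (fun t x => -f t x) t x = -V f t x := fun f t x => by
    unfold V; rw [integral_neg]
  have := S.neg.sharp2 hq hΛ j0 ji (m := -m) (N := N) (fun t ht x => ?_) (fun t ht => ?_) (fun t ht => ?_) hT x
  · linarith
  · rw [Vn, hV t ht x]
    simp only [Vn]
    rw [← mul_neg, ← integral_neg]
    congr 1; congr 1; funext z; ring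
  · rw [integral_neg, hm t ht]
  · simp only [abs_neg]; exact hN t ht

theorem final {J φ : ℝ → ℝ} {q lam μ : ℝ} {u : ℝ → ℝ → ℝ} (hq : 1 < q) (J0 : ∀ x, 0 ≤ J x) (Ji : Integrable J) (J1 : (∫ x, J x) = 1)
    (hl : 0 < lam) (hμ : 0 < μ) (φi : Integrable φ) (H : IsRescaledSol J q lam μ φ u) {t : ℝ} (ht : 0 < t) :
    (∫ x, |u t x| ≤ ∫ x, |φ x|) ∧ ∀ x, |u t x| ≤ (q * (∫ y, |φ y|) / ((q - 1) * t)) ^ (1 / q) := by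
  obtain ⟨ui, uc, u2, u1, pde, u0⟩ := H
  set j : ℝ → ℝ := fun z => lam * J (lam * z) with hj
  have j0 : ∀ z, 0 ≤ j z := fun z => mul_nonneg hl.le (J0 _)
  have ji : Integrable j := (Ji.comp_mul_left' hl.ne').const_mul lam
  have sc : ∀ f : ℝ → ℝ, ∫ x, lam * f (lam * x) = ∫ x, f x := fun f => by
    rw [integral_const_mul, Measure.integral_comp_mul_left f lam, smul_eq_mul, abs_of_pos (inv_pos.2 hl)]
    field_simp
  have j1 : ∫ z, j z = 1 := by rw [hj, sc J, J1]
  set Λ := lam^q with hΛd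
  have hΛ : 0 ≤ Λ := by positivity
  set h : ℝ → ℝ → ℝ := fun t x => Λ * (cv j (u t) x - u t x) with hh
  have uc' : ∀ t₀, 0 < t₀ → Tendsto (fun t => ∫ x, |u t x - u t₀ x|) (𝓝 t₀) (𝓝 0) := fun t₀ ht₀ => by
    have := uc t₀ ht₀.le
    rwa [nhdsWithin_eq_nhds.2 (Ici_mem_nhds ht₀)] at this
  have S : LocSol (fun v => |v|^(q-1)) μ u h := by
    refine ⟨?_, fun v => by simp, hμ, fun t ht => ui t ht.le, uc', fun t ht => ?_, fun t₀ ht₀ => ?_, u2, u1, fun t ht x => ?_⟩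
    · exact continuous_abs.rpow_const fun _ => Or.inr (by linarith)
    · exact ((cv_int ji (ui t ht.le)).sub (ui t ht.le)).const_mul Λ
    · have lim : Tendsto (fun t => Λ * (2 * ∫ x, |u t x - u t₀ x|)) (𝓝 t₀) (𝓝 0) := by
        simpa using ((uc' t₀ ht₀).const_mul 2).const_mul Λ
      refine squeeze_zero' (Eventually.of_forall fun t => integral_nonneg fun x => abs_nonneg _) ?_ lim
      filter_upwards [lt_mem_nhds ht₀] with t ht
      have i1 := ui t ht.le
      have i2 := ui t₀ ht₀.le
      have id : Integrable fun x => u t x - u t₀ x := i1.sub i2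
      have k1 : ∫ x, |h t x - h t₀ x| ≤ ∫ x, Λ * (|cv j (fun x => u t x - u t₀ x) x| + |u t x - u t₀ x|) := by
        refine integral_mono_of_nonneg (Eventually.of_forall fun x => abs_nonneg _)
          (((cv_int ji id).abs.add id.abs).const_mul Λ) ?_
        filter_upwards [cv_sub ji i1 i2] with x hx
        have : h t x - h t₀ x = Λ * (cv j (fun x => u t x - u t₀ x) x - (u t x - u t₀ x)) := by
          rw [← hx]; simp only [hh]; ring
        rw [this, abs_mul, abs_of_nonneg hΛ]
        exact mul_le_mul_of_nonneg_left (abs_sub _ _) hΛ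
      refine k1.trans ?_
      rw [integral_const_mul, integral_add (cv_int ji id).abs id.abs]
      have := cv_abs j0 ji j1 id
      exact mul_le_mul_of_nonneg_left (by linarith) hΛ
    · have := pde t ht x
      have e : h t x = lam ^ q * ((∫ y, lam * J (lam * (x - y)) * u t y) - u t x) := rfl
      rw [e]
      show _ = _ + _ - |u t x|^(q-1) * _
      linarith
  have mono : ∀ s t, 0 < s → s ≤ t → ∫ x, |u t x| ≤ ∫ x, |u s x| := fun s t hs hst =>
    contr S hΛ (k := fun t => cv j (u t)) (fun t ht x => rfl) (fun t ht => cv_int ji (ui t ht.le))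
      (fun t ht => cv_abs j0 ji j1 (ui t ht.le)) hs hst
  have mass : ∀ s t, 0 < s → s ≤ t → ∫ x, u t x = ∫ x, u s x := fun s t hs hst => by
    refine massc S (fun t ht => ?_) hs hst
    simp only [hh]
    rw [integral_const_mul, integral_sub (cv_int ji (ui t ht.le)) (ui t ht.le), cv_mass ji j1 (ui t ht.le), sub_self, mul_zero]
  have n0 : ∫ x, |u 0 x| = ∫ x, |φ x| := by
    rw [← sc fun x => |φ x|]
    refine integral_congr_ae ?_
    filter_upwards [u0] with x hx
    rw [hx, abs_mul, abs_of_pos hl]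
  have hN : ∀ t, 0 < t → ∫ x, |u t x| ≤ ∫ x, |φ x| := fun t ht => by
    have l0 := (uc 0 le_rfl).mono_left (nhdsWithin_mono 0 (Ioi_subset_Ici_self (a := (0:ℝ))))
    have l1 : Tendsto (fun s => (∫ x, |u s x - u 0 x|) + ∫ x, |φ x|) (𝓝[>] 0) (𝓝 (∫ x, |φ x|)) := by
      simpa using l0.add_const (∫ x, |φ x|)
    refine ge_of_tendsto l1 ?_
    filter_upwards [Ioo_mem_nhdsGT ht] with s hs
    refine (mono s t hs.1 hs.2.le).trans ?_
    rw [← n0]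
    have i1 := ui s hs.1.le
    have i2 := ui 0 le_rfl
    have id : Integrable fun x => |u s x - u 0 x| := (i1.sub i2).abs
    rw [← integral_add id i2.abs]
    refine integral_mono i1.abs (id.add i2.abs) fun x => ?_
    show |u s x| ≤ |u s x - u 0 x| + |u 0 x|
    have := abs_add_le (u s x - u 0 x) (u 0 x)
    simpa using this
  refine ⟨hN t ht, fun x => ?_⟩
  refine S.sharp3 hq hΛ j0 ji (fun t ht x => ?_) (m := ∫ x, u 1 x) (fun t ht => ?_) hN ht x
  · exact cv_VV ji j1 (ui t ht.le) Λ x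
  · rcases le_total t 1 with h | h
    · exact (mass t 1 ht h).symm
    · exact mass 1 t one_pos h

lemma Lp_bd {f : ℝ → ℝ} {c τ K r : ℝ} {p : ℝ≥0∞} (hp : 1 ≤ p) (fi : Integrable f) (hK : ∫ x, |f x| ≤ K) (hc : 0 ≤ c) (hτ : 0 < τ)
    (hf : ∀ x, |f x| ≤ c * τ^(-r)) :
    eLpNorm f p volume ≤ ENNReal.ofReal ((max c ((c^(p.toReal - 1) * K)^(1/p.toReal)) + 1) * τ^(-r * (1 - 1/p.toReal))) := by
  have K0 : 0 ≤ K := (integral_nonneg fun x => abs_nonneg _).trans hK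
  rcases eq_or_ne p ∞ with rfl | hpt
  · have ex : -r * (1 - 1 / (∞ : ℝ≥0∞).toReal) = -r := by simp
    rw [ex, eLpNorm_exponent_top]
    refine eLpNormEssSup_le_of_ae_bound (Eventually.of_forall fun x => (hf x).trans ?_)
    have := le_max_left c ((c ^ ((∞ : ℝ≥0∞).toReal - 1) * K) ^ (1 / (∞ : ℝ≥0∞).toReal))
    have t0 : 0 < τ^(-r) := Real.rpow_pos_of_pos hτ _
    exact mul_le_mul_of_nonneg_right (by linarith) t0.le
  · set s := p.toReal with hs
    have s1 : 1 ≤ s := by rw [hs, ← ENNReal.toReal_one]; exact ENNReal.toReal_mono hpt hp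
    have s0 : 0 < s := by linarith
    set M := c * τ^(-r) with hM
    have t0 : 0 < τ^(-r) := Real.rpow_pos_of_pos hτ _
    have M0 : 0 ≤ M := by positivity
    have p0 : p ≠ 0 := by rintro rfl; simp at hp
    rw [eLpNorm_eq_lintegral_rpow_enorm_toReal p0 hpt, ← hs]
    have h1 : ∫⁻ x, ‖f x‖ₑ^s ≤ ENNReal.ofReal (M^(s-1) * K) := by
      calc ∫⁻ x, ‖f x‖ₑ^s ≤ ∫⁻ x, ENNReal.ofReal (M^(s-1) * |f x|) := by
            refine lintegral_mono fun x => ?_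
            rw [← ofReal_norm, ENNReal.ofReal_rpow_of_nonneg (norm_nonneg _) s0.le]
            refine ENNReal.ofReal_le_ofReal ?_
            rw [Real.norm_eq_abs]
            rcases (abs_nonneg (f x)).eq_or_lt with h | h
            · rw [← h, Real.zero_rpow s0.ne', mul_zero]
            · have : |f x|^s = |f x|^(s-1) * |f x| := by rw [← Real.rpow_add_one h.ne']; congr 1; ring
              rw [this]
              exact mul_le_mul_of_nonneg_right (Real.rpow_le_rpow h.le (hf x) (by linarith)) h.le
        _ = ENNReal.ofReal (∫ x, M^(s-1) * |f x|) := by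
            rw [ofReal_integral_eq_lintegral_ofReal (fi.abs.const_mul _) (Eventually.of_forall fun x => by positivity)]
        _ ≤ _ := by
            refine ENNReal.ofReal_le_ofReal ?_
            rw [integral_const_mul]
            exact mul_le_mul_of_nonneg_left hK (by positivity)
    have h2 := ENNReal.rpow_le_rpow h1 (show 0 ≤ 1/s by positivity)
    refine h2.trans ?_
    rw [ENNReal.ofReal_rpow_of_nonneg (by positivity) (by positivity)]
    refine ENNReal.ofReal_le_ofReal ?_
    have e : (M^(s-1) * K)^(1/s) = (c^(s-1) * K)^(1/s) * τ^(-r * (1 - 1/s)) := by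
      rw [hM, Real.mul_rpow hc t0.le, ← Real.rpow_mul hτ.le]
      have : c^(s-1) * τ^(-r * (s-1)) * K = c^(s-1) * K * τ^(-r * (s-1)) := by ring
      rw [this, Real.mul_rpow (by positivity) (by positivity), ← Real.rpow_mul hτ.le]
      congr 2; field_simp
    rw [e]
    have := le_max_right c ((c^(s-1) * K)^(1/s))
    exact mul_le_mul_of_nonneg_right (by linarith) (by positivity)

end Aux

theorem stmt12
    (q K : ℝ) (hq1 : 1 < q) (hq2 : q < 2) (hK : 0 ≤ K)
    (p : ℝ≥0∞) (hp : 1 ≤ p) :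
    -- explicit L^∞ bound
    (∀ (J φ : ℝ → ℝ) (lam μ : ℝ) (u : ℝ → ℝ → ℝ),
      (∀ x, 0 ≤ J x) → (∀ x, J (-x) = J x) → Integrable J → (∫ x, J x) = 1 →
      0 < lam → 0 < μ → Integrable φ → IsRescaledSol J q lam μ φ u →
      ∀ t : ℝ, 0 < t → ∀ᵐ x ∂(volume : Measure ℝ),
        |u t x| ≤ (q * (∫ y, |φ y|) / ((q - 1) * t)) ^ (1 / q)) ∧
    -- L^p decay with a constant C(‖φ‖₁, p, q), uniform in λ and μ
    (∃ C : ℝ, 0 < C ∧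
      ∀ (J φ : ℝ → ℝ) (lam μ : ℝ) (u : ℝ → ℝ → ℝ),
        (∀ x, 0 ≤ J x) → (∀ x, J (-x) = J x) → Integrable J → (∫ x, J x) = 1 →
        0 < lam → 0 < μ → Integrable φ → (∫ y, |φ y|) = K →
        IsRescaledSol J q lam μ φ u →
        ∀ t : ℝ, 0 < t →
          eLpNorm (u t) p volume
            ≤ ENNReal.ofReal (C * t ^ (-(1 / q) * (1 - 1 / p.toReal)))) := by
  refine ⟨fun J φ lam μ u J0 _ Ji J1 hl hμ φi H t ht =>
    Eventually.of_forall (Aux.final hq1 J0 Ji J1 hl hμ φi H ht).2, ?_⟩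
  have q1 : 0 < q - 1 := by linarith
  have q0 : 0 < q := by linarith
  set c : ℝ := (q * K / (q - 1))^(1/q) with hc
  have c0 : 0 ≤ c := by positivity
  refine ⟨max c ((c^(p.toReal - 1) * K)^(1/p.toReal)) + 1, by have := le_max_left c ((c^(p.toReal - 1) * K)^(1/p.toReal)); linarith, ?_⟩
  intro J φ lam μ u J0 _ Ji J1 hl hμ φi hφ H t ht
  obtain ⟨h1, h2⟩ := Aux.final hq1 J0 Ji J1 hl hμ φi H ht
  rw [hφ] at h1 h2
  refine Aux.Lp_bd hp (H.1 t ht.le) h1 c0 ht fun x => (h2 x).trans (le_of_eq ?_)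
  have : q * K / ((q-1) * t) = q * K / (q - 1) * t⁻¹ := by field_simp
  rw [this, Real.mul_rpow (by positivity) (by positivity), Real.inv_rpow ht.le, ← Real.rpow_neg ht.le]
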